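/- arXiv:2109.06009 — 8 statements merged into one kernel-verified Lean document; each statement's English description precedes it below -/
import Mathlib

section
/- For all real s, t ≥ 0, the local functionals satisfy 2·log 2 · (1/4)(√s − √t)² ≤ ψ(s,t) ≤ 2 · (1/4)(√s − √t)² ≤ (1/2) · (1/4)(s − t)·log(s/t), where ψ(s,t) = (s/2)log(2s/(s+t)) + (t/2)log(2t/(s+t)) (with 0·log 0 = 0; the last term is interpreted with s, t > 0). -/
namespace Stmt10

/-- `ψ(s,t)`: the local entropy functional. -/
noncomputable def psi (s t : ℝ) : ℝ :=
  s / 2 * Real.log (2 * s / (s + t)) + t / 2 * Real.log (2 * t / (s + t))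

end Stmt10

namespace Stmt10

open Real Set

lemma hasDerivAt_sqrt_one_sub_sq {y : ℝ} (hy : y ∈ Ioo (0 : ℝ) 1) :
    HasDerivAt (fun y ↦ √(1 - y ^ 2)) (-y / √(1 - y ^ 2)) y := by
  have h : 0 < 1 - y ^ 2 := by nlinarith [hy.1, hy.2]
  refine (((hasDerivAt_pow 2 y).const_sub 1).sqrt h.ne').congr_deriv ?_
  have := (sqrt_pos.2 h).ne'
  push_cast
  field_simp

lemma sqrt_one_sub_sq_mem_Ioo {y : ℝ} (hy : y ∈ Ioo (0 : ℝ) 1) :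
    √(1 - y ^ 2) ∈ Ioo (0 : ℝ) 1 := by
  refine ⟨sqrt_pos.2 (by nlinarith [hy.1, hy.2]), ?_⟩
  rw [sqrt_lt' one_pos]
  nlinarith [hy.1]

/-- Binary entropy in terms of `y = 2√(p(1-p))`. -/
noncomputable def entropyOfSqrt (y : ℝ) : ℝ := binEntropy ((1 + √(1 - y ^ 2)) / 2)

/-- The derivative of `entropyOfSqrt`. -/
noncomputable def entropyOfSqrtDeriv (y : ℝ) : ℝ :=
  y * ((log (1 + √(1 - y ^ 2)) - log (1 - √(1 - y ^ 2))) / 2) / √(1 - y ^ 2)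

lemma continuous_entropyOfSqrt : Continuous entropyOfSqrt := by
  unfold entropyOfSqrt
  fun_prop

lemma hasDerivAt_entropyOfSqrt {y : ℝ} (hy : y ∈ Ioo (0 : ℝ) 1) :
    HasDerivAt entropyOfSqrt (entropyOfSqrtDeriv y) y := by
  obtain ⟨hx0, hx1⟩ := sqrt_one_sub_sq_mem_Ioo hy
  have hx := hasDerivAt_sqrt_one_sub_sq hy
  unfold entropyOfSqrtDeriv
  have hb := hasDerivAt_binEntropy (p := (1 + √(1 - y ^ 2)) / 2) (by positivity) (by linarith)
  refine (hb.comp y ((hx.const_add 1).div_const 2)).congr_deriv ?_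
  have e : 1 - (1 + √(1 - y ^ 2)) / 2 = (1 - √(1 - y ^ 2)) / 2 := by ring
  rw [e, log_div (by linarith) two_ne_zero, log_div (by linarith) two_ne_zero]
  field_simp
  ring

lemma le_half_log_sub_log {x : ℝ} (hx : x ∈ Ioo (0 : ℝ) 1) :
    x ≤ (log (1 + x) - log (1 - x)) / 2 := by
  have h := sum_range_le_log_div hx.1.le hx.2 1
  rw [log_div (by linarith [hx.1]) (by linarith [hx.2])] at h
  simp at h
  linarith

lemma hasDerivAt_entropyOfSqrtDeriv {y : ℝ} (hy : y ∈ Ioo (0 : ℝ) 1) :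
    HasDerivAt entropyOfSqrtDeriv
      (((log (1 + √(1 - y ^ 2)) - log (1 - √(1 - y ^ 2))) / 2 - √(1 - y ^ 2))
        / √(1 - y ^ 2) ^ 3) y := by
  obtain ⟨hx0, hx1⟩ := sqrt_one_sub_sq_mem_Ioo hy
  have hx := hasDerivAt_sqrt_one_sub_sq hy
  have hsq : √(1 - y ^ 2) ^ 2 = 1 - y ^ 2 := sq_sqrt (by nlinarith [hy.1, hy.2])
  have hA := (((hx.const_add 1).log (by linarith)).sub
    ((hx.const_sub 1).log (by linarith))).div_const 2
  refine (((hasDerivAt_id' y).fun_mul hA).div hx hx0.ne').congr_deriv ?_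
  simp only [Pi.sub_apply]
  generalize √(1 - y ^ 2) = x at *
  generalize log (1 + x) = a
  generalize log (1 - x) = b
  have h1 : 1 + x ≠ 0 := by linarith
  have h2 : 1 - x ≠ 0 := by linarith
  have hy2 : y ^ 2 = (1 + x) * (1 - x) := by linarith
  field_simp
  ring_nf
  grind

lemma convexOn_entropyOfSqrt : ConvexOn ℝ (Icc 0 1) entropyOfSqrt := by
  refine convexOn_of_hasDerivWithinAt2_nonneg (convex_Icc 0 1)
    continuous_entropyOfSqrt.continuousOn (f' := entropyOfSqrtDeriv) (f'' := fun y =>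
      ((log (1 + √(1 - y ^ 2)) - log (1 - √(1 - y ^ 2))) / 2 - √(1 - y ^ 2))
        / √(1 - y ^ 2) ^ 3) ?_ ?_ ?_ <;> rw [interior_Icc] <;> intro y hy
  · exact (hasDerivAt_entropyOfSqrt hy).hasDerivWithinAt
  · exact (hasDerivAt_entropyOfSqrtDeriv hy).hasDerivWithinAt
  · have := le_half_log_sub_log (sqrt_one_sub_sq_mem_Ioo hy)
    exact div_nonneg (by linarith) (by positivity)

lemma entropyOfSqrtDeriv_le_one {y : ℝ} (hy : y ∈ Ioo (0 : ℝ) 1) :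
    entropyOfSqrtDeriv y ≤ 1 := by
  obtain ⟨hx0, hx1⟩ := sqrt_one_sub_sq_mem_Ioo hy
  have hsq : √(1 - y ^ 2) ^ 2 = 1 - y ^ 2 := sq_sqrt (by nlinarith [hy.1, hy.2])
  unfold entropyOfSqrtDeriv
  generalize √(1 - y ^ 2) = x at *
  have hy0 := hy.1
  have h := artanh_eq_half_log (x := x) ⟨by linarith, hx1.le⟩
  have hs := sinh_artanh (x := x) ⟨by linarith, hx1⟩
  have hle := self_le_sinh_iff.2 (artanh_nonneg hx0.le)
  rw [hs, h, log_div (by linarith) (by linarith), show 1 - x ^ 2 = y ^ 2 by linarith,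
    sqrt_sq hy0.le, le_div_iff₀ hy0] at hle
  rw [div_le_one hx0]
  linarith

lemma entropyOfSqrt_le {y : ℝ} (hy : y ∈ Icc (0 : ℝ) 1) : entropyOfSqrt y ≤ log 2 * y := by
  have h := convexOn_entropyOfSqrt.2 (left_mem_Icc.2 zero_le_one) (right_mem_Icc.2 zero_le_one)
    (sub_nonneg.2 hy.2) hy.1 (by ring)
  have h0 : entropyOfSqrt 0 = 0 := by norm_num [entropyOfSqrt]
  have h1 : entropyOfSqrt 1 = log 2 := by simp [entropyOfSqrt]
  simp [h0, h1] at h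
  linarith

lemma le_entropyOfSqrt {y : ℝ} (hy : y ∈ Icc (0 : ℝ) 1) :
    log 2 - (1 - y) ≤ entropyOfSqrt y := by
  have h : AntitoneOn (fun y ↦ entropyOfSqrt y - y) (Icc 0 1) := by
    refine antitoneOn_of_hasDerivWithinAt_nonpos (convex_Icc 0 1)
      (continuous_entropyOfSqrt.sub continuous_id).continuousOn
      (f' := fun y ↦ entropyOfSqrtDeriv y - 1) ?_ ?_ <;> rw [interior_Icc] <;> intro y hy
    · exact ((hasDerivAt_entropyOfSqrt hy).sub (hasDerivAt_id y)).hasDerivWithinAt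
    · linarith [entropyOfSqrtDeriv_le_one hy]
  have h' := h hy (right_mem_Icc.2 zero_le_one) hy.2
  have h1 : entropyOfSqrt 1 = log 2 := by simp [entropyOfSqrt]
  simp only [h1] at h'
  linarith

lemma entropyOfSqrt_two_mul_sqrt {p : ℝ} (hp : p ∈ Icc (0 : ℝ) 1) :
    entropyOfSqrt (2 * √(p * (1 - p))) = binEntropy p := by
  have h : 1 - (2 * √(p * (1 - p))) ^ 2 = (2 * p - 1) ^ 2 := by
    rw [mul_pow, sq_sqrt (mul_nonneg hp.1 (sub_nonneg.2 hp.2))]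
    ring
  rw [entropyOfSqrt, h, sqrt_sq_eq_abs]
  rcases abs_cases (2 * p - 1) with ⟨h, -⟩ | ⟨h, -⟩ <;> rw [h]
  · ring_nf
  · rw [← binEntropy_one_sub]
    ring_nf

lemma psi_eq_binEntropy {s t : ℝ} (h : 0 < s + t) :
    psi s t = (s + t) / 2 * (log 2 - binEntropy (s / (s + t))) := by
  have key (u : ℝ) : u / 2 * log (2 * u / (s + t)) =
      u / 2 * (log 2 + log (u / (s + t))) := by
    rcases eq_or_ne u 0 with rfl | hu
    · simp
    · rw [mul_div_assoc, log_mul two_ne_zero (div_ne_zero hu h.ne')]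
  have e : 1 - s / (s + t) = t / (s + t) := by field_simp; ring
  rw [psi, key, key, binEntropy, e, log_inv, log_inv]
  field_simp
  ring

lemma sq_sqrt_sub_sqrt {s t : ℝ} (hs : 0 ≤ s) (ht : 0 ≤ t) (h : 0 < s + t) :
    (√s - √t) ^ 2 =
      (s + t) * (1 - 2 * √(s / (s + t) * (1 - s / (s + t)))) := by
  have e : s / (s + t) * (1 - s / (s + t)) = s * t / (s + t) ^ 2 := by field_simp; ring
  rw [e, sqrt_div (mul_nonneg hs ht), sqrt_sq h.le, sqrt_mul hs, sub_sq, sq_sqrt hs, sq_sqrt ht]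
  field_simp
  ring

lemma two_mul_sqrt_mul_one_sub_mem_Icc (p : ℝ) :
    2 * √(p * (1 - p)) ∈ Icc (0 : ℝ) 1 := by
  refine ⟨by positivity, ?_⟩
  have : √(p * (1 - p)) ≤ 1 / 2 := by
    rw [sqrt_le_left (by norm_num)]
    nlinarith [sq_nonneg (2 * p - 1)]
  linarith

lemma sq_sqrt_sub_sqrt_le_of_le {s t : ℝ} (ht : 0 < t) (h : t ≤ s) :
    4 * (√s - √t) ^ 2 ≤ (s - t) * log (s / t) := by
  obtain ⟨a, ha, rfl⟩ : ∃ a, 0 ≤ a ∧ a ^ 2 = s := ⟨√s, sqrt_nonneg _, sq_sqrt (by linarith)⟩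
  obtain ⟨b, hb, rfl⟩ : ∃ b, 0 < b ∧ b ^ 2 = t := ⟨√t, sqrt_pos.2 ht, sq_sqrt ht.le⟩
  have hab : b ≤ a := by nlinarith
  have hl := le_log_one_add_of_nonneg (x := (a - b) / b) (div_nonneg (by linarith) hb.le)
  have e1 : 1 + (a - b) / b = a / b := by field_simp; ring
  have e2 : 2 * ((a - b) / b) / ((a - b) / b + 2) = 2 * (a - b) / (a + b) := by
    have : a - b + 2 * b ≠ 0 := by linarith
    have : a + b ≠ 0 := by linarith
    field_simp
    ring
  rw [e1, e2, div_le_iff₀ (by linarith)] at hl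
  rw [sqrt_sq ha, sqrt_sq hb.le, ← div_pow, log_pow]
  push_cast
  nlinarith [mul_le_mul_of_nonneg_left hl (sub_nonneg.2 hab)]

lemma sq_sqrt_sub_sqrt_le {s t : ℝ} (hs : 0 < s) (ht : 0 < t) :
    4 * (√s - √t) ^ 2 ≤ (s - t) * log (s / t) := by
  rcases le_total t s with h | h
  · exact sq_sqrt_sub_sqrt_le_of_le ht h
  · have := sq_sqrt_sub_sqrt_le_of_le hs h
    rw [← inv_div, log_inv]
    linarith [sub_sq_comm √s √t]

end Stmt10

open Stmt10 in
theorem stmt10 (s t : ℝ) (hs : 0 ≤ s) (ht : 0 ≤ t) :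
    2 * Real.log 2 * ((Real.sqrt s - Real.sqrt t) ^ 2 / 4) ≤ psi s t
    ∧ psi s t ≤ 2 * ((Real.sqrt s - Real.sqrt t) ^ 2 / 4)
    ∧ (0 < s → 0 < t →
        2 * ((Real.sqrt s - Real.sqrt t) ^ 2 / 4) ≤
          (1 / 2) * ((s - t) * Real.log (s / t) / 4)) := by
  rw [← and_assoc]
  refine ⟨?_, fun hs ht ↦ by linarith [sq_sqrt_sub_sqrt_le hs ht]⟩
  rcases (add_nonneg hs ht).eq_or_lt with h | h
  · obtain rfl : s = 0 := by linarith
    obtain rfl : t = 0 := by linarith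
    simp [psi]
  have hp : s / (s + t) ∈ Set.Icc (0 : ℝ) 1 :=
    ⟨div_nonneg hs h.le, (div_le_one h).2 (by linarith)⟩
  have hy := two_mul_sqrt_mul_one_sub_mem_Icc (s / (s + t))
  have hu := entropyOfSqrt_le hy
  have hl := le_entropyOfSqrt hy
  rw [entropyOfSqrt_two_mul_sqrt hp] at hu hl
  rw [psi_eq_binEntropy h, sq_sqrt_sub_sqrt hs ht h]
  constructor <;> nlinarith
end

section
/- Let A be a finite nonempty set and f : A → ℝ with f > 0. Then var_A √f ≤ ent_A f ≤ cov_A(f, log f), where var_A g = (1/|A|)∑_{x∈A}(g(x) − ḡ_A)² with ḡ_A = (1/|A|)∑_{x∈A} g(x), ent_A f = (1/|A|)∑_{x∈A} f(x) log(f(x)/f̄_A) with f̄_A = (1/|A|)∑_{x∈A} f(x), and cov_A(f, log f) = (1/|A|)∑_{x∈A}(f(x) − f̄_A)·log f(x). -/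
open Finset

namespace Stmt11

variable {A : Type*} [Fintype A]

/-- Average over `A` w.r.t. the uniform distribution. -/
noncomputable def avg (g : A → ℝ) : ℝ := (∑ x, g x) / (Fintype.card A : ℝ)

/-- Variance over `A`. -/
noncomputable def varBlock (g : A → ℝ) : ℝ := avg (fun x => (g x - avg g) ^ 2)

/-- Block entropy `ent_A f`. -/
noncomputable def entBlock (f : A → ℝ) : ℝ := avg (fun x => f x * Real.log (f x / avg f))

/-- Block covariance `cov_A(f, log f)`. -/
noncomputable def covBlock (f : A → ℝ) : ℝ := avg (fun x => (f x - avg f) * Real.log (f x))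

end Stmt11

namespace Stmt11

theorem avg_add {A : Type*} [Fintype A] (g h : A → ℝ) :
    avg (fun x => g x + h x) = avg g + avg h := by
  simp only [avg, Finset.sum_add_distrib, add_div]

theorem avg_const_mul {A : Type*} [Fintype A] (c : ℝ) (g : A → ℝ) :
    avg (fun x => c * g x) = c * avg g := by
  simp only [avg, ← Finset.mul_sum, mul_div_assoc]

theorem avg_const {A : Type*} [Fintype A] [Nonempty A] (c : ℝ) :
    avg (fun _ : A => c) = c := by
  simp [avg]

theorem avg_mono {A : Type*} [Fintype A] {g h : A → ℝ} (hgh : ∀ x, g x ≤ h x) :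
    avg g ≤ avg h :=
  div_le_div_of_nonneg_right (Finset.sum_le_sum fun x _ => hgh x) (Nat.cast_nonneg _)

theorem avg_pos {A : Type*} [Fintype A] [Nonempty A] {f : A → ℝ} (hf : ∀ x, 0 < f x) :
    0 < avg f :=
  div_pos (Finset.sum_pos (fun x _ => hf x) Finset.univ_nonempty)
    (Nat.cast_pos.mpr Fintype.card_pos)

theorem varBlock_eq {A : Type*} [Fintype A] [Nonempty A] (g : A → ℝ) :
    varBlock g = avg (fun x => g x ^ 2) - avg g ^ 2 := by
  have h : (fun x => (g x - avg g) ^ 2)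
      = fun x => (g x ^ 2 + (-2 * avg g) * g x) + avg g ^ 2 := by
    funext x
    ring
  rw [varBlock, h, avg_add, avg_add, avg_const_mul, avg_const]
  ring

theorem two_mul_sub_le_mul_log_div {a m : ℝ} (ha : 0 < a) (hm : 0 < m) :
    2 * a + (-2 * √m) * √a ≤ a * Real.log (a / m) := by
  have hs : 0 < √a := Real.sqrt_pos.mpr ha
  have ht : 0 < √m := Real.sqrt_pos.mpr hm
  have hlog : Real.log (a / m) = 2 * Real.log (√a / √m) := by
    rw [Real.log_div ha.ne' hm.ne', Real.log_div hs.ne' ht.ne', Real.log_sqrt ha.le,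
      Real.log_sqrt hm.le]
    ring
  have h1 := Real.one_sub_inv_le_log_of_pos (div_pos hs ht)
  have h2 : a * (√a / √m)⁻¹ = √m * √a := by
    rw [inv_div]
    field_simp
    rw [Real.sq_sqrt ha.le]
  rw [hlog]
  nlinarith [mul_le_mul_of_nonneg_left h1 ha.le]

theorem mul_log_div_le {a m : ℝ} (ha : 0 < a) (hm : 0 < m) :
    a * Real.log (a / m) ≤ (a - m) * Real.log a + (1 - Real.log m) * (a + -m) := by
  have h1 := mul_le_mul_of_nonneg_left (Real.log_le_sub_one_of_pos (div_pos ha hm)) hm.le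
  rw [mul_sub, mul_div_cancel₀ _ hm.ne', Real.log_div ha.ne' hm.ne'] at h1
  rw [Real.log_div ha.ne' hm.ne']
  linarith

end Stmt11

open Stmt11 in
theorem stmt11 {A : Type*} [Fintype A] [Nonempty A]
    (f : A → ℝ) (hf : ∀ x, 0 < f x) :
    varBlock (fun x => Real.sqrt (f x)) ≤ entBlock f ∧ entBlock f ≤ covBlock f := by
  have hm := avg_pos hf
  constructor
  · have h := avg_mono fun x => two_mul_sub_le_mul_log_div (hf x) hm
    rw [avg_add, avg_const_mul, avg_const_mul] at h
    have hsq : (fun x => √(f x) ^ 2) = f := funext fun x => Real.sq_sqrt (hf x).le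
    rw [varBlock_eq, hsq, entBlock]
    nlinarith [sq_nonneg (√(avg f) - avg fun x => √(f x)), Real.sq_sqrt hm.le]
  · have h := avg_mono fun x => mul_log_div_le (hf x) hm
    rw [avg_add, avg_const_mul, avg_add, avg_const] at h
    simpa [entBlock, covBlock] using h
end

section
/- For all a, b ≥ 0, the function ρ ↦ ψ̄_ρ(a,b)/h(ρ) is nondecreasing on (0, 1/2]; equivalently, for all 0 < ρ₁ ≤ ρ₂ ≤ 1/2, ψ̄_{ρ₁}(a,b)·h(ρ₂) ≤ ψ̄_{ρ₂}(a,b)·h(ρ₁). -/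
namespace Stmt12

/-- `ψ_ρ(a,b)`: the relative entropy of `(a,b)` w.r.t. the Bernoulli(ρ) distribution. -/
noncomputable def psiR (ρ a b : ℝ) : ℝ :=
  ρ * a * Real.log (a / (ρ * a + (1 - ρ) * b)) +
    (1 - ρ) * b * Real.log (b / (ρ * a + (1 - ρ) * b))

/-- The symmetrized entropy `ψ̄_ρ(a,b)`. -/
noncomputable def psiBar (ρ a b : ℝ) : ℝ := (psiR ρ a b + psiR ρ b a) / 2

/-- Shannon entropy of the Bernoulli(ρ) distribution. -/
noncomputable def hEnt (ρ : ℝ) : ℝ := -ρ * Real.log ρ - (1 - ρ) * Real.log (1 - ρ)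

end Stmt12

open Finset

/-- Chebyshev-type sum inequality: if `B / A` is nondecreasing and `w` is nonincreasing, then the
`B`-weighted mean of `w` is at most the `A`-weighted one. -/
theorem sum_mul_sum_le_of_antitone_weight (w A B : ℕ → ℝ) (hw : Antitone w)
    (hAB : ∀ j n, j ≤ n → A n * B j ≤ B n * A j) (N : ℕ) :
    (∑ k ∈ range N, w k * B k) * (∑ k ∈ range N, A k) ≤
      (∑ k ∈ range N, w k * A k) * (∑ k ∈ range N, B k) := by
  induction N with
  | zero => simp
  | succ n ih =>
    have key : ∑ j ∈ range n, (w n - w j) * (B n * A j - A n * B j) ≤ 0 := by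
      refine sum_nonpos fun j hj => ?_
      have hjn : j ≤ n := (mem_range.mp hj).le
      exact mul_nonpos_of_nonpos_of_nonneg (sub_nonpos.mpr (hw hjn))
        (sub_nonneg.mpr (hAB j n hjn))
    have expand : ∑ j ∈ range n, (w n - w j) * (B n * A j - A n * B j) =
        w n * B n * (∑ j ∈ range n, A j) - w n * A n * (∑ j ∈ range n, B j)
          - B n * (∑ j ∈ range n, w j * A j) + A n * (∑ j ∈ range n, w j * B j) := by
      simp only [mul_sum, ← sum_sub_distrib, ← sum_add_distrib]
      exact sum_congr rfl fun _ _ => by ring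
    simp only [sum_range_succ]
    nlinarith

theorem geom_sum_mul_geom_sum_le {x y : ℝ} (hx : 0 ≤ x) (hxy : x ≤ y) {j n : ℕ} (hjn : j ≤ n) :
    (∑ i ∈ range n, x ^ i) * (∑ i ∈ range j, y ^ i) ≤
      (∑ i ∈ range n, y ^ i) * (∑ i ∈ range j, x ^ i) := by
  induction n, hjn using Nat.le_induction with
  | base => exact (mul_comm _ _).le
  | succ n hn ih =>
    have step : x ^ n * (∑ i ∈ range j, y ^ i) ≤ y ^ n * (∑ i ∈ range j, x ^ i) := by
      rw [mul_sum, mul_sum]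
      refine sum_le_sum fun l hl => ?_
      obtain ⟨d, rfl⟩ := Nat.exists_eq_add_of_le ((mem_range.mp hl).le.trans hn)
      have h := mul_le_mul_of_nonneg_left (pow_le_pow_left₀ hx hxy d)
        (mul_nonneg (pow_nonneg hx l) (pow_nonneg (hx.trans hxy) l))
      calc x ^ (l + d) * y ^ l = x ^ l * y ^ l * x ^ d := by ring
        _ ≤ x ^ l * y ^ l * y ^ d := h
        _ = y ^ (l + d) * x ^ l := by ring
    simp only [sum_range_succ _ n]
    linarith

theorem one_sub_pow_mul_one_sub_pow_le {x y : ℝ} (hx : 0 ≤ x) (hxy : x ≤ y) (hy : y ≤ 1)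
    {j n : ℕ} (hjn : j ≤ n) :
    (1 - x ^ n) * (1 - y ^ j) ≤ (1 - y ^ n) * (1 - x ^ j) := by
  have h := mul_le_mul_of_nonneg_left (geom_sum_mul_geom_sum_le hx hxy hjn)
    (mul_nonneg (sub_nonneg.mpr (hxy.trans hy)) (sub_nonneg.mpr hy))
  simp only [← mul_neg_geom_sum]
  linarith

/-- `(1 + x) log (1 + x) + (1 - x) log (1 - x)`, which is `2 log 2` minus twice the Shannon entropy
of the Bernoulli distribution with parameter `(1 + x) / 2`. -/
noncomputable def entropyDefect (x : ℝ) : ℝ :=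
  (1 + x) * Real.log (1 + x) + (1 - x) * Real.log (1 - x)

theorem continuous_entropyDefect : Continuous entropyDefect :=
  (Real.continuous_mul_log.comp (continuous_const.add continuous_id)).add
    (Real.continuous_mul_log.comp (continuous_const.sub continuous_id))

theorem summable_entropyDefect_coeff :
    Summable fun k : ℕ => 1 / ((2 * (k : ℝ) + 1) * (k + 1)) := by
  have h : Summable fun k : ℕ => 1 / ((k + 1 : ℕ) : ℝ) ^ 2 :=
    (summable_nat_add_iff 1).mpr (Real.summable_one_div_nat_pow.mpr one_lt_two)
  refine h.of_nonneg_of_le (fun k => by positivity) fun k => ?_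
  push_cast
  refine one_div_le_one_div_of_le (by positivity) ?_
  nlinarith [(Nat.cast_nonneg k : (0 : ℝ) ≤ k)]

theorem hasSum_entropyDefect_of_lt_one {x : ℝ} (hx0 : 0 ≤ x) (hx1 : x < 1) :
    HasSum (fun k : ℕ => 1 / ((2 * (k : ℝ) + 1) * (k + 1)) * (x ^ 2) ^ (k + 1))
      (entropyDefect x) := by
  have habs : |x| < 1 := by rwa [abs_of_nonneg hx0]
  have hsq : |x ^ 2| < 1 := by rw [abs_of_nonneg (sq_nonneg x)]; nlinarith
  have h := ((Real.hasSum_log_sub_log_of_abs_lt_one habs).mul_left x).sub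
    (Real.hasSum_pow_div_log_of_abs_lt_one hsq)
  have hlog : Real.log (1 - x ^ 2) = Real.log (1 + x) + Real.log (1 - x) := by
    rw [← Real.log_mul (by linarith) (by linarith)]
    ring_nf
  have hval : entropyDefect x =
      x * (Real.log (1 + x) - Real.log (1 - x)) - -Real.log (1 - x ^ 2) := by
    rw [hlog, entropyDefect]
    ring
  rw [hval]
  convert! h using 2 with k
  have : (2 * (k : ℝ) + 1) ≠ 0 := by positivity
  have : (k : ℝ) + 1 ≠ 0 := by positivity
  field_simp
  ring

theorem hasSum_entropyDefect {x : ℝ} (hx0 : 0 ≤ x) (hx1 : x ≤ 1) :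
    HasSum (fun k : ℕ => 1 / ((2 * (k : ℝ) + 1) * (k + 1)) * (x ^ 2) ^ (k + 1))
      (entropyDefect x) := by
  have hbound : ∀ (k : ℕ), ∀ y ∈ Set.Icc (0 : ℝ) 1,
      ‖1 / ((2 * (k : ℝ) + 1) * (k + 1)) * (y ^ 2) ^ (k + 1)‖ ≤
        1 / ((2 * (k : ℝ) + 1) * (k + 1)) := fun k y hy => by
    rw [Real.norm_of_nonneg (by positivity)]
    exact mul_le_of_le_one_right (by positivity)
      (pow_le_one₀ (sq_nonneg y) (pow_le_one₀ hy.1 hy.2))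
  have hcont : ContinuousOn
      (fun y : ℝ => ∑' k : ℕ, 1 / ((2 * (k : ℝ) + 1) * (k + 1)) * (y ^ 2) ^ (k + 1))
      (Set.Icc 0 1) :=
    continuousOn_tsum (fun k => by fun_prop) summable_entropyDefect_coeff hbound
  have heq : Set.EqOn entropyDefect
      (fun y : ℝ => ∑' k : ℕ, 1 / ((2 * (k : ℝ) + 1) * (k + 1)) * (y ^ 2) ^ (k + 1))
      (Set.Icc 0 1) := by
    refine Set.EqOn.of_subset_closure (s := Set.Ico 0 1)
      (fun y hy => (hasSum_entropyDefect_of_lt_one hy.1 hy.2).tsum_eq.symm)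
      continuous_entropyDefect.continuousOn hcont Set.Ico_subset_Icc_self ?_
    rw [closure_Ico zero_ne_one]
  rw [heq ⟨hx0, hx1⟩]
  exact (summable_entropyDefect_coeff.of_norm_bounded fun k => hbound k x ⟨hx0, hx1⟩).hasSum

theorem entropyDefect_sub_mul_le {t u v : ℝ} (ht0 : 0 ≤ t) (ht1 : t ≤ 1)
    (hu : 0 ≤ u) (huv : u ≤ v) (hv : v ≤ 1) :
    (entropyDefect t - entropyDefect (t * v)) * (entropyDefect 1 - entropyDefect u) ≤
      (entropyDefect t - entropyDefect (t * u)) * (entropyDefect 1 - entropyDefect v) := by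
  set c : ℕ → ℝ := fun k => 1 / ((2 * (k : ℝ) + 1) * (k + 1))
  have hc0 : ∀ k, 0 ≤ c k := fun k => by positivity
  have weighted : ∀ s ∈ Set.Icc (0 : ℝ) 1, ∀ z ∈ Set.Icc (0 : ℝ) 1,
      HasSum (fun k => (s ^ 2) ^ (k + 1) * (c k * (1 - (z ^ 2) ^ (k + 1))))
        (entropyDefect s - entropyDefect (s * z)) := fun s hs z hz => by
    convert! (hasSum_entropyDefect hs.1 hs.2).sub (hasSum_entropyDefect
      (mul_nonneg hs.1 hz.1) (mul_le_one₀ hs.2 hz.1 hz.2)) using 2 with k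
    rw [mul_pow, mul_pow]
    ring
  have unweighted : ∀ z ∈ Set.Icc (0 : ℝ) 1,
      HasSum (fun k => c k * (1 - (z ^ 2) ^ (k + 1)))
        (entropyDefect 1 - entropyDefect z) := fun z hz => by
    simpa using weighted 1 (by simp) z hz
  have hu' : u ∈ Set.Icc (0 : ℝ) 1 := ⟨hu, huv.trans hv⟩
  have hv' : v ∈ Set.Icc (0 : ℝ) 1 := ⟨hu.trans huv, hv⟩
  refine le_of_tendsto_of_tendsto'
    ((weighted t ⟨ht0, ht1⟩ v hv').tendsto_sum_nat.mul (unweighted u hu').tendsto_sum_nat)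
    ((weighted t ⟨ht0, ht1⟩ u hu').tendsto_sum_nat.mul (unweighted v hv').tendsto_sum_nat)
    fun N => sum_mul_sum_le_of_antitone_weight (fun k => (t ^ 2) ^ (k + 1)) _ _ ?_ ?_ N
  · intro j n hjn
    exact pow_le_pow_of_le_one (sq_nonneg t) (pow_le_one₀ ht0 ht1) (by lia)
  · intro j n hjn
    have h := mul_le_mul_of_nonneg_left
      (one_sub_pow_mul_one_sub_pow_le (sq_nonneg u) (pow_le_pow_left₀ hu huv 2)
        (pow_le_one₀ hv'.1 hv) (Nat.succ_le_succ hjn))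
      (mul_nonneg (hc0 n) (hc0 j))
    simp only [Nat.succ_eq_add_one] at h
    linarith

namespace Stmt12

theorem psiBar_comm (ρ a b : ℝ) : psiBar ρ a b = psiBar ρ b a := by
  rw [psiBar, psiBar, add_comm]

theorem hEnt_eq_entropyDefect {ρ : ℝ} (h0 : 0 < ρ) (h1 : ρ < 1) :
    hEnt ρ = (entropyDefect 1 - entropyDefect (1 - 2 * ρ)) / 2 := by
  have e1 : (1 : ℝ) + (1 - 2 * ρ) = 2 * (1 - ρ) := by ring
  have e2 : (1 : ℝ) - (1 - 2 * ρ) = 2 * ρ := by ring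
  have e3 : (1 : ℝ) + 1 = 2 := by norm_num
  rw [hEnt, entropyDefect, entropyDefect, e1, e2, e3,
    Real.log_mul two_ne_zero (by linarith), Real.log_mul two_ne_zero h0.ne']
  ring

theorem mul_log_div {x y : ℝ} (hy : y ≠ 0) :
    x * Real.log (x / y) = x * Real.log x - x * Real.log y := by
  rcases eq_or_ne x 0 with rfl | hx
  · simp
  · rw [Real.log_div hx hy]
    ring

theorem entropyDefect_sub_div_add {x y : ℝ} (h : 0 < x + y) :
    (x + y) * entropyDefect ((x - y) / (x + y)) =
      2 * (x * Real.log x + y * Real.log y) + 2 * (x + y) * (Real.log 2 - Real.log (x + y)) := by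
  have scale : ∀ z : ℝ, z * Real.log (2 * z / (x + y)) =
      z * Real.log z + z * (Real.log 2 - Real.log (x + y)) := fun z => by
    rcases eq_or_ne z 0 with rfl | hz
    · simp
    · rw [Real.log_div (by simpa using hz) h.ne', Real.log_mul two_ne_zero hz]
      ring
  have e1 : 1 + (x - y) / (x + y) = 2 * x / (x + y) := by field_simp; ring
  have e2 : 1 - (x - y) / (x + y) = 2 * y / (x + y) := by field_simp; ring
  rw [entropyDefect, e1, e2]
  calc (x + y) * (2 * x / (x + y) * Real.log (2 * x / (x + y)) +
        2 * y / (x + y) * Real.log (2 * y / (x + y)))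
      = 2 * (x * Real.log (2 * x / (x + y)) + y * Real.log (2 * y / (x + y))) := by
        field_simp
    _ = _ := by rw [scale, scale]; ring

theorem psiBar_eq_entropyDefect {ρ a b : ℝ} (ha : 0 ≤ a) (hb : 0 ≤ b) (hab : 0 < a + b)
    (h0 : 0 < ρ) (h1 : ρ < 1) :
    psiBar ρ a b = (a + b) / 4 * (entropyDefect ((a - b) / (a + b)) -
      entropyDefect ((a - b) / (a + b) * (1 - 2 * ρ))) := by
  have hpos : ∀ x y : ℝ, 0 ≤ x → 0 ≤ y → 0 < x + y → ρ * x + (1 - ρ) * y ≠ 0 :=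
    fun x y hx hy hxy => by
      rcases hx.eq_or_lt with rfl | hx
      · have := mul_pos (sub_pos.mpr h1) (by linarith : 0 < y)
        linarith
      · have := mul_pos h0 hx
        have := mul_nonneg (sub_pos.mpr h1).le hy
        linarith
  have hm := hpos a b ha hb hab
  have hn := hpos b a hb ha (by linarith)
  have hsum : (ρ * b + (1 - ρ) * a) + (ρ * a + (1 - ρ) * b) = a + b := by ring
  have H1 := entropyDefect_sub_div_add hab
  have H2 := entropyDefect_sub_div_add (hsum ▸ hab)
  have harg : (ρ * b + (1 - ρ) * a - (ρ * a + (1 - ρ) * b)) / (a + b) =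
      (a - b) / (a + b) * (1 - 2 * ρ) := by ring
  rw [hsum, harg] at H2
  rw [psiBar, psiR, psiR]
  simp only [mul_assoc, mul_log_div hm, mul_log_div hn]
  linarith

end Stmt12

open Stmt12 in
/-- For fixed `a, b ≥ 0`, the map `ρ ↦ ψ̄_ρ(a,b) / h(ρ)` is nondecreasing on `(0, 1/2]`. -/
theorem stmt12 (a b : ℝ) (ha : 0 ≤ a) (hb : 0 ≤ b)
    (ρ₁ ρ₂ : ℝ) (h0 : 0 < ρ₁) (h12 : ρ₁ ≤ ρ₂) (h2 : ρ₂ ≤ 1 / 2) :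
    psiBar ρ₁ a b * hEnt ρ₂ ≤ psiBar ρ₂ a b * hEnt ρ₁ := by
  wlog hba : b ≤ a generalizing a b
  · rw [psiBar_comm ρ₁, psiBar_comm ρ₂]
    exact this b a hb ha (le_of_not_ge hba)
  rcases (add_nonneg ha hb).eq_or_lt with hab | hab
  · obtain rfl : a = 0 := by linarith
    obtain rfl : b = 0 := by linarith
    simp [psiBar, psiR]
  rw [psiBar_eq_entropyDefect ha hb hab h0 (by linarith),
    psiBar_eq_entropyDefect ha hb hab (h0.trans_le h12) (by linarith),
    hEnt_eq_entropyDefect h0 (by linarith), hEnt_eq_entropyDefect (h0.trans_le h12) (by linarith)]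
  have h := mul_le_mul_of_nonneg_left
    (entropyDefect_sub_mul_le (t := (a - b) / (a + b)) (u := 1 - 2 * ρ₂) (v := 1 - 2 * ρ₁)
      (div_nonneg (by linarith) hab.le) ((div_le_one hab).mpr (by linarith))
      (by linarith) (by linarith) (by linarith))
    (by positivity : 0 ≤ (a + b) / 8)
  linarith
end

section
/- For every ρ ∈ [0,1] and all a, b ≥ 0, log 2 · ψ̄_ρ(a,b) ≤ h(ρ) · ψ(a,b); moreover the constant is optimal: ψ̄_ρ(0,1) = h(ρ)/2 and ψ(0,1) = (log 2)/2, so that ψ̄_ρ(0,1)/ψ(0,1) = h(ρ)/log 2. -/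
namespace Stmt13

/-- `ψ_ρ(a,b)`: the relative entropy of `(a,b)` w.r.t. the Bernoulli(ρ) distribution. -/
noncomputable def psiR (ρ a b : ℝ) : ℝ :=
  ρ * a * Real.log (a / (ρ * a + (1 - ρ) * b)) +
    (1 - ρ) * b * Real.log (b / (ρ * a + (1 - ρ) * b))

/-- The symmetrized entropy `ψ̄_ρ(a,b)`. -/
noncomputable def psiBar (ρ a b : ℝ) : ℝ := (psiR ρ a b + psiR ρ b a) / 2

/-- Shannon entropy of the Bernoulli(ρ) distribution. -/
noncomputable def hEnt (ρ : ℝ) : ℝ := -ρ * Real.log ρ - (1 - ρ) * Real.log (1 - ρ)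

end Stmt13

namespace Stmt13

/-- Chebyshev's sum inequality with nonnegative weights, for similarly ordered families. -/
theorem weighted_chebyshev {ι : Type*} (s : Finset ι) (c x y : ι → ℝ) (hc : ∀ i, 0 ≤ c i)
    (hxy : ∀ i j, 0 ≤ (x i - x j) * (y i - y j)) :
    (∑ i ∈ s, c i * x i) * (∑ i ∈ s, c i * y i) ≤
      (∑ i ∈ s, c i) * ∑ i ∈ s, c i * (x i * y i) := by
  have key : 0 ≤ ∑ i ∈ s, ∑ j ∈ s, c i * c j * ((x i - x j) * (y i - y j)) :=
    Finset.sum_nonneg fun i _ => Finset.sum_nonneg fun j _ =>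
      mul_nonneg (mul_nonneg (hc i) (hc j)) (hxy i j)
  have expand : ∑ i ∈ s, ∑ j ∈ s, c i * c j * ((x i - x j) * (y i - y j)) =
      (∑ i ∈ s, c i * (x i * y i)) * (∑ i ∈ s, c i)
        - (∑ i ∈ s, c i * x i) * (∑ i ∈ s, c i * y i)
        - (∑ i ∈ s, c i * y i) * (∑ i ∈ s, c i * x i)
        + (∑ i ∈ s, c i) * (∑ i ∈ s, c i * (x i * y i)) := by
    simp only [Finset.sum_mul_sum, ← Finset.sum_sub_distrib, ← Finset.sum_add_distrib]
    refine Finset.sum_congr rfl fun i _ => Finset.sum_congr rfl fun j _ => ?_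
    ring
  linarith

/-- Powers of two numbers in `[0,1]` are similarly ordered. -/
theorem pow_sub_pow_mul_nonneg {u v : ℝ} (hu : 0 ≤ u) (hu1 : u ≤ 1) (hv : 0 ≤ v) (hv1 : v ≤ 1)
    (i j : ℕ) : 0 ≤ (u ^ i - u ^ j) * (v ^ i - v ^ j) := by
  rcases le_total i j with h | h
  · exact mul_nonneg (sub_nonneg.2 (pow_le_pow_of_le_one hu hu1 h))
      (sub_nonneg.2 (pow_le_pow_of_le_one hv hv1 h))
  · exact mul_nonneg_of_nonpos_of_nonpos (sub_nonpos.2 (pow_le_pow_of_le_one hu hu1 h))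
      (sub_nonpos.2 (pow_le_pow_of_le_one hv hv1 h))

/-- The entropy deficit `log 2 - hEnt ((1 + t) / 2)`. -/
noncomputable def deficit (t : ℝ) : ℝ :=
  ((1 + t) * Real.log (1 + t) + (1 - t) * Real.log (1 - t)) / 2

/-- The Taylor coefficients of `deficit`. -/
noncomputable def deficitCoeff (k : ℕ) : ℝ := 1 / (2 * k + 1) - 1 / (2 * k + 2)

theorem deficitCoeff_nonneg (k : ℕ) : 0 ≤ deficitCoeff k :=
  sub_nonneg.2 (one_div_le_one_div_of_le (by positivity) (by linarith))

theorem continuous_deficit : Continuous deficit := by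
  have h1 : Continuous fun t : ℝ => (1 + t) * Real.log (1 + t) :=
    Real.continuous_mul_log.comp (continuous_const.add continuous_id)
  have h2 : Continuous fun t : ℝ => (1 - t) * Real.log (1 - t) :=
    Real.continuous_mul_log.comp (continuous_const.sub continuous_id)
  exact (h1.add h2).div_const 2

theorem deficit_one : deficit 1 = Real.log 2 := by
  norm_num [deficit]

theorem deficit_neg (t : ℝ) : deficit (-t) = deficit t := by
  simp only [deficit, sub_neg_eq_add, ← sub_eq_add_neg]
  ring

theorem hasSum_deficit {t : ℝ} (ht : |t| < 1) :
    HasSum (fun k : ℕ => deficitCoeff k * (t ^ 2) ^ (k + 1)) (deficit t) := by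
  obtain ⟨hl, hr⟩ := abs_lt.1 ht
  have ht2 : |t ^ 2| < 1 := by
    rw [abs_pow]; exact pow_lt_one₀ (abs_nonneg t) ht two_ne_zero
  have h1 := (Real.hasSum_log_sub_log_of_abs_lt_one ht).mul_left (t / 2)
  have h2 := (Real.hasSum_pow_div_log_of_abs_lt_one ht2).mul_left (1 / 2)
  have hlog : Real.log (1 - t ^ 2) = Real.log (1 + t) + Real.log (1 - t) := by
    rw [← Real.log_mul (by linarith) (by linarith)]; ring_nf
  have hval : deficit t = t / 2 * (Real.log (1 + t) - Real.log (1 - t))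
      - 1 / 2 * -Real.log (1 - t ^ 2) := by
    rw [hlog, deficit]
    ring
  rw [hval]
  refine Eq.mp (congrArg (HasSum · _) (funext fun k => ?_)) (h1.sub h2)
  have : (k : ℝ) + 1 ≠ 0 := by positivity
  have : 2 * (k : ℝ) + 1 ≠ 0 := by positivity
  rw [deficitCoeff]
  field_simp
  ring

theorem sum_deficitCoeff_le (n : ℕ) : ∑ k ∈ Finset.range n, deficitCoeff k ≤ Real.log 2 := by
  have hF : Filter.Tendsto deficit (nhdsWithin 1 (Set.Iio 1)) (nhds (Real.log 2)) := by
    rw [← deficit_one]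
    exact continuous_deficit.continuousAt.tendsto.mono_left nhdsWithin_le_nhds
  have hP : Filter.Tendsto
      (fun t : ℝ => ∑ k ∈ Finset.range n, deficitCoeff k * (t ^ 2) ^ (k + 1))
      (nhdsWithin 1 (Set.Iio 1)) (nhds (∑ k ∈ Finset.range n, deficitCoeff k)) := by
    have hc : Continuous
        (fun t : ℝ => ∑ k ∈ Finset.range n, deficitCoeff k * (t ^ 2) ^ (k + 1)) := by
      fun_prop
    have := (hc.tendsto 1).mono_left (nhdsWithin_le_nhds (s := Set.Iio (1 : ℝ)))
    simpa using this
  refine le_of_tendsto_of_tendsto hP hF ?_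
  filter_upwards [Ioo_mem_nhdsLT (show (0 : ℝ) < 1 by norm_num)] with t ht
  exact sum_le_hasSum _ (fun k _ => mul_nonneg (deficitCoeff_nonneg k) (by positivity))
    (hasSum_deficit (abs_lt.2 ⟨by linarith [ht.1], ht.2⟩))

theorem deficit_mul_le {s t : ℝ} (hs : |s| ≤ 1) (ht : |t| ≤ 1) :
    deficit s * deficit t ≤ Real.log 2 * deficit (s * t) := by
  have unit_eq : ∀ r : ℝ, |r| = 1 → ∀ q, deficit r * deficit q = Real.log 2 * deficit (r * q) := by
    intro r hr q
    rcases eq_or_eq_neg_of_abs_eq hr with rfl | rfl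
    · rw [deficit_one, one_mul]
    · rw [deficit_neg, deficit_one, neg_one_mul, deficit_neg]
  rcases hs.eq_or_lt with hs1 | hs1
  · exact (unit_eq s hs1 t).le
  rcases ht.eq_or_lt with ht1 | ht1
  · rw [mul_comm, mul_comm s]
    exact (unit_eq t ht1 s).le
  have hst : |s * t| < 1 := by
    rw [abs_mul]; exact mul_lt_one_of_nonneg_of_lt_one_left (abs_nonneg s) hs1 ht
  have Hs := hasSum_deficit hs1
  have Ht := hasSum_deficit ht1
  have Hst := hasSum_deficit hst
  refine le_of_tendsto (Hs.tendsto_sum_nat.mul Ht.tendsto_sum_nat)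
    (Filter.Eventually.of_forall fun n => ?_)
  have hs2 : s ^ 2 ≤ 1 := (sq_le_one_iff_abs_le_one s).2 hs
  have ht2 : t ^ 2 ≤ 1 := (sq_le_one_iff_abs_le_one t).2 ht
  have nonneg : ∀ k, 0 ≤ deficitCoeff k * ((s * t) ^ 2) ^ (k + 1) := fun k =>
    mul_nonneg (deficitCoeff_nonneg k) (by positivity)
  calc (∑ k ∈ Finset.range n, deficitCoeff k * (s ^ 2) ^ (k + 1)) *
        (∑ k ∈ Finset.range n, deficitCoeff k * (t ^ 2) ^ (k + 1))
      ≤ (∑ k ∈ Finset.range n, deficitCoeff k) *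
        ∑ k ∈ Finset.range n, deficitCoeff k * ((s ^ 2) ^ (k + 1) * (t ^ 2) ^ (k + 1)) :=
        weighted_chebyshev _ _ _ _ deficitCoeff_nonneg fun i j =>
          pow_sub_pow_mul_nonneg (sq_nonneg s) hs2 (sq_nonneg t) ht2 (i + 1) (j + 1)
    _ = (∑ k ∈ Finset.range n, deficitCoeff k) *
        ∑ k ∈ Finset.range n, deficitCoeff k * ((s * t) ^ 2) ^ (k + 1) := by
        simp only [← mul_pow]
    _ ≤ Real.log 2 * deficit (s * t) :=
        mul_le_mul (sum_deficitCoeff_le n) (sum_le_hasSum _ (fun k _ => nonneg k) Hst)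
          (Finset.sum_nonneg fun k _ => nonneg k) (Real.log_nonneg one_le_two)

theorem psiR_eq {ρ a b : ℝ} (h0 : 0 ≤ ρ) (h1 : ρ ≤ 1) (ha : 0 ≤ a) (hb : 0 ≤ b) :
    psiR ρ a b = ρ * (a * Real.log a) + (1 - ρ) * (b * Real.log b)
      - (ρ * a + (1 - ρ) * b) * Real.log (ρ * a + (1 - ρ) * b) := by
  have log_split : ∀ p x y : ℝ, 0 ≤ p * x → 0 ≤ y →
      p * x * Real.log (x / (p * x + y)) = p * x * Real.log x - p * x * Real.log (p * x + y) := by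
    intro p x y hpx hy
    rcases hpx.eq_or_lt with h | h
    · simp [← h]
    · rw [Real.log_div (right_ne_zero_of_mul h.ne') (by linarith)]
      ring
  have ha' : 0 ≤ ρ * a := mul_nonneg h0 ha
  have hb' : 0 ≤ (1 - ρ) * b := mul_nonneg (sub_nonneg.2 h1) hb
  have hB := log_split (1 - ρ) b (ρ * a) hb' ha'
  rw [add_comm] at hB
  rw [psiR, log_split ρ a _ ha' hb', hB]
  ring

theorem psiR_mul (ρ a b : ℝ) {m : ℝ} (hm : m ≠ 0) :
    psiR ρ (m * a) (m * b) = m * psiR ρ a b := by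
  have h : ρ * (m * a) + (1 - ρ) * (m * b) = m * (ρ * a + (1 - ρ) * b) := by ring
  simp only [psiR, h, mul_div_mul_left _ _ hm]
  ring

theorem psiBar_mul (ρ a b : ℝ) {m : ℝ} (hm : m ≠ 0) :
    psiBar ρ (m * a) (m * b) = m * psiBar ρ a b := by
  simp only [psiBar, psiR_mul _ _ _ hm]
  ring

theorem psiBar_one_add_one_sub {ρ t : ℝ} (h0 : 0 ≤ ρ) (h1 : ρ ≤ 1) (ht : |t| ≤ 1) :
    psiBar ρ (1 + t) (1 - t) = deficit t - deficit ((2 * ρ - 1) * t) := by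
  obtain ⟨hl, hr⟩ := abs_le.1 ht
  have ha : 0 ≤ 1 + t := by linarith
  have hb : 0 ≤ 1 - t := by linarith
  have e1 : ρ * (1 + t) + (1 - ρ) * (1 - t) = 1 + (2 * ρ - 1) * t := by ring
  have e2 : ρ * (1 - t) + (1 - ρ) * (1 + t) = 1 - (2 * ρ - 1) * t := by ring
  rw [psiBar, psiR_eq h0 h1 ha hb, psiR_eq h0 h1 hb ha, e1, e2, deficit, deficit]
  ring

theorem psiR_half_one_add_one_sub {t : ℝ} (ht : |t| ≤ 1) :
    psiR (1 / 2) (1 + t) (1 - t) = deficit t := by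
  obtain ⟨hl, hr⟩ := abs_le.1 ht
  have e : 1 / 2 * (1 + t) + (1 - 1 / 2) * (1 - t) = 1 := by ring
  rw [psiR_eq (by norm_num) (by norm_num) (by linarith) (by linarith), e, Real.log_one, deficit]
  ring

theorem hEnt_eq (ρ : ℝ) : hEnt ρ = Real.log 2 - deficit (2 * ρ - 1) := by
  have key : ∀ x : ℝ, 2 * x * Real.log (2 * x) = 2 * (x * Real.log 2 + x * Real.log x) := by
    intro x
    rcases eq_or_ne x 0 with rfl | hx
    · simp
    · rw [Real.log_mul two_ne_zero hx]
      ring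
  have e1 : 1 + (2 * ρ - 1) = 2 * ρ := by ring
  have e2 : 1 - (2 * ρ - 1) = 2 * (1 - ρ) := by ring
  rw [hEnt, deficit, e1, e2, key, key]
  ring

theorem log_two_mul_psiBar_le {ρ a b : ℝ} (h0 : 0 ≤ ρ) (h1 : ρ ≤ 1) (ha : 0 ≤ a) (hb : 0 ≤ b) :
    Real.log 2 * psiBar ρ a b ≤ hEnt ρ * psiR (1 / 2) a b := by
  rcases (add_nonneg ha hb).eq_or_lt with hab | hab
  · obtain rfl : a = 0 := by linarith
    obtain rfl : b = 0 := by linarith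
    simp [psiBar, psiR]
  obtain ⟨m, t, hm, ht, rfl, rfl⟩ :
      ∃ m t : ℝ, 0 < m ∧ |t| ≤ 1 ∧ a = m * (1 + t) ∧ b = m * (1 - t) := by
    refine ⟨(a + b) / 2, (a - b) / (a + b), by positivity, ?_, ?_, ?_⟩
    · rw [abs_div, abs_of_pos hab, div_le_one hab, abs_le]
      constructor <;> linarith
    all_goals
      field_simp
      ring
  have hs : |2 * ρ - 1| ≤ 1 := abs_le.2 ⟨by linarith, by linarith⟩
  rw [psiBar_mul _ _ _ hm.ne', psiR_mul _ _ _ hm.ne', psiBar_one_add_one_sub h0 h1 ht,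
    psiR_half_one_add_one_sub ht, hEnt_eq ρ]
  nlinarith [mul_le_mul_of_nonneg_left (deficit_mul_le hs ht) hm.le]

end Stmt13

open Stmt13 in
theorem stmt13 (ρ : ℝ) (h0 : 0 ≤ ρ) (h1 : ρ ≤ 1) :
    (∀ a b : ℝ, 0 ≤ a → 0 ≤ b →
        Real.log 2 * psiBar ρ a b ≤ hEnt ρ * psiR (1 / 2) a b)
    ∧ psiBar ρ 0 1 = hEnt ρ / 2
    ∧ psiR (1 / 2) 0 1 = Real.log 2 / 2 := by
  refine ⟨fun a b ha hb => log_two_mul_psiBar_le h0 h1 ha hb, ?_, ?_⟩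
  · simp [psiBar, psiR, hEnt]
    ring
  · norm_num [psiR]
    ring
end

section
/- Let n ≥ 2. For every a ∈ ℝ_+^n, log n · Ent(ā) ≤ (log n − log(n−1)) · Ent(a), where ā ∈ ℝ_+^n is the vector with entries ā_i = (1/(n−1))∑_{j≠i} a_j. Moreover the constant is optimal: the supremum of Ent(ā)/Ent(a) over all nonconstant a ∈ ℝ_+^n equals 1 − log(n−1)/log n, and it is attained when a is a nonnegative multiple of a standard basis vector. -/
open Finset

namespace Stmt15

/-- The vector `ā` with entries `ā_i = (1/(n-1)) ∑_{j ≠ i} a_j`. -/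
noncomputable def abar (n : ℕ) (a : Fin n → ℝ) : Fin n → ℝ :=
  fun i => (∑ j ∈ Finset.univ.erase i, a j) / ((n : ℝ) - 1)

/-- `Ent(a) = (1/n) ∑_i a_i log(a_i / μ(a))`. -/
noncomputable def EntV (n : ℕ) (a : Fin n → ℝ) : ℝ :=
  (1 / (n : ℝ)) * ∑ i, a i * Real.log (a i / ((∑ j, a j) / (n : ℝ)))

end Stmt15

section

open Real

/-- Two-point subadditivity of the increments of a concave function. -/
lemma ConcaveOn.map_add_add_map_le {f : ℝ → ℝ} {s t x y : ℝ} (hf : ConcaveOn ℝ (Set.Icc s t) f)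
    (hx : 0 ≤ x) (hy : 0 ≤ y) (ht : s + (x + y) ≤ t) :
    f (s + (x + y)) + f s ≤ f (s + x) + f (s + y) := by
  rcases (add_nonneg hx hy).eq_or_lt with h | h
  · have hx0 : x = 0 := by linarith
    have hy0 : y = 0 := by linarith
    simp [hx0, hy0]
  · have hs : s ∈ Set.Icc s t := ⟨le_rfl, by linarith⟩
    have he : s + (x + y) ∈ Set.Icc s t := ⟨by linarith, ht⟩
    have h1 := hf.2 he hs (div_nonneg hx h.le) (div_nonneg hy h.le) (by field_simp)
    have h2 := hf.2 he hs (div_nonneg hy h.le) (div_nonneg hx h.le) (by field_simp; ring)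
    have e1 : x / (x + y) * (s + (x + y)) + y / (x + y) * s = s + x := by field_simp; ring
    have e2 : y / (x + y) * (s + (x + y)) + x / (x + y) * s = s + y := by field_simp; ring
    simp only [smul_eq_mul] at h1 h2
    rw [e1] at h1
    rw [e2] at h2
    have e3 : f (s + (x + y)) + f s
        = (x / (x + y) * f (s + (x + y)) + y / (x + y) * f s)
          + (y / (x + y) * f (s + (x + y)) + x / (x + y) * f s) := by field_simp; ring
    linarith

lemma ConcaveOn.map_add_sum_sub_le {ι : Type*} {f : ℝ → ℝ} {s t : ℝ}
    (hf : ConcaveOn ℝ (Set.Icc s t) f) (K : Finset ι) {x : ι → ℝ} (hx : ∀ i, 0 ≤ x i)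
    (ht : s + ∑ i ∈ K, x i ≤ t) :
    f (s + ∑ i ∈ K, x i) - f s ≤ ∑ i ∈ K, (f (s + x i) - f s) := by
  classical
  induction K using Finset.induction_on with
  | empty => simp
  | insert i K hi ih =>
    rw [Finset.sum_insert hi] at ht
    rw [Finset.sum_insert hi, Finset.sum_insert hi]
    have hK : 0 ≤ ∑ j ∈ K, x j := Finset.sum_nonneg fun j _ => hx j
    have h1 := ih (by linarith [hx i])
    have h2 := hf.map_add_add_map_le (hx i) hK ht
    linarith

lemma ConvexOn.card_mul_map_average_le {ι : Type*} {f : ℝ → ℝ} {D : Set ℝ} (hf : ConvexOn ℝ D f)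
    {K : Finset ι} (hK : K.Nonempty) {x : ι → ℝ} (hx : ∀ i ∈ K, x i ∈ D) :
    (K.card : ℝ) * f ((∑ i ∈ K, x i) / K.card) ≤ ∑ i ∈ K, f (x i) := by
  have hc : (0 : ℝ) < K.card := by exact_mod_cast hK.card_pos
  have h := hf.map_sum_le (t := K) (w := fun _ => (K.card : ℝ)⁻¹) (p := x)
    (fun _ _ => by positivity) (by simp [hc.ne']) hx
  simp only [smul_eq_mul, ← Finset.mul_sum] at h
  rw [div_eq_inv_mul]
  calc (K.card : ℝ) * f ((K.card : ℝ)⁻¹ * ∑ i ∈ K, x i)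
      ≤ K.card * ((K.card : ℝ)⁻¹ * ∑ i ∈ K, f (x i)) := by gcongr
    _ = _ := by field_simp

/-- For a function that is convex and then concave on `[0, 1]`, nonnegativity of symmetric sums over
the simplex only has to be checked where all coordinates but one are equal. -/
lemma sum_nonneg_of_convexOn_of_concaveOn {ι : Type*} [Fintype ι] {f : ℝ → ℝ} {s : ℝ}
    (hs : 0 ≤ s) (hcvx : ConvexOn ℝ (Set.Icc 0 s) f) (hccv : ConcaveOn ℝ (Set.Icc s 1) f)
    (hι : 2 ≤ Fintype.card ι)
    (hf : ∀ m ∈ Set.Icc (0 : ℝ) 1,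
      0 ≤ ((Fintype.card ι : ℝ) - 1) * f ((1 - m) / ((Fintype.card ι : ℝ) - 1)) + f m)
    {p : ι → ℝ} (hp : ∀ i, 0 ≤ p i) (hp1 : ∑ i, p i = 1) : 0 ≤ ∑ i, f (p i) := by
  classical
  have hN : (2 : ℝ) ≤ Fintype.card ι := by exact_mod_cast hι
  have hN1 : (Fintype.card ι : ℝ) - 1 ≠ 0 := by linarith
  by_cases hall : ∀ i, p i ≤ s
  · have hne : (Finset.univ : Finset ι).Nonempty := by
      rw [← Finset.card_pos, Finset.card_univ]; omega
    have h := hcvx.card_mul_map_average_le hne (x := p) fun i _ => ⟨hp i, hall i⟩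
    rw [hp1, Finset.card_univ] at h
    have h' := hf (1 / (Fintype.card ι : ℝ)) ⟨by positivity, by
      rw [div_le_one (by linarith)]; linarith⟩
    have e : (1 - 1 / (Fintype.card ι : ℝ)) / ((Fintype.card ι : ℝ) - 1)
        = 1 / (Fintype.card ι : ℝ) := by field_simp
    rw [e] at h'
    linarith
  · push Not at hall
    obtain ⟨k, hk⟩ := hall
    set x : ι → ℝ := fun i => max (p i - s) 0 with hx
    set q : ι → ℝ := fun i => min (p i) s with hq
    have hx0 : ∀ i, 0 ≤ x i := fun i => le_max_right _ _
    have hpq : ∀ i, p i = q i + x i := fun i => by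
      rcases le_total (p i) s with h | h <;> simp [hx, hq, h]
    have hfq : ∀ i, f (p i) = f (q i) + (f (s + x i) - f s) := fun i => by
      rcases le_total (p i) s with h | h <;> simp [hx, hq, h]
    have hq0 : ∀ i, 0 ≤ q i := fun i => le_min (hp i) hs
    have hqk : q k = s := min_eq_right hk.le
    set E : Finset ι := Finset.univ.erase k with hE
    have hEc : (E.card : ℝ) = (Fintype.card ι : ℝ) - 1 := by
      rw [hE, Finset.card_erase_of_mem (Finset.mem_univ k), Finset.card_univ,
        Nat.cast_sub (by omega), Nat.cast_one]
    have hEne : E.Nonempty := by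
      rw [← Finset.card_pos]
      have : (0 : ℝ) < E.card := by rw [hEc]; linarith
      exact_mod_cast this
    have hsumq : ∑ i, q i = ∑ i ∈ E, q i + s := by
      rw [← hqk]; exact (Finset.sum_erase_add _ _ (Finset.mem_univ k)).symm
    have hsumfq : ∑ i, f (q i) = ∑ i ∈ E, f (q i) + f s := by
      rw [← hqk]
      exact (Finset.sum_erase_add _ (fun i => f (q i)) (Finset.mem_univ k)).symm
    have htot : ∑ i ∈ E, q i + s + ∑ i, x i = 1 := by
      rw [← hsumq, ← Finset.sum_add_distrib, ← hp1]
      exact Finset.sum_congr rfl fun i _ => (hpq i).symm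
    have hQ : 0 ≤ ∑ i ∈ E, q i := Finset.sum_nonneg fun i _ => hq0 i
    have hX : 0 ≤ ∑ i, x i := Finset.sum_nonneg fun i _ => hx0 i
    have h1 := hccv.map_add_sum_sub_le Finset.univ hx0 (by linarith)
    have h2 := hcvx.card_mul_map_average_le hEne (x := q)
      fun i _ => ⟨hq0 i, min_le_right _ _⟩
    have h3 := hf (s + ∑ i, x i) ⟨by linarith, by linarith⟩
    rw [show 1 - (s + ∑ i, x i) = ∑ i ∈ E, q i by linarith, ← hEc] at h3
    have h4 : ∑ i, f (p i) = ∑ i, f (q i) + ∑ i, (f (s + x i) - f s) := by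
      rw [← Finset.sum_add_distrib]
      exact Finset.sum_congr rfl fun i _ => hfq i
    linarith

/-- The function `-(1 - x) log (1 - x) + c x log x`. -/
noncomputable def entropyGap (c x : ℝ) : ℝ := negMulLog (1 - x) - c * negMulLog x

/-- The derivative of `entropyGap c` on `(0, 1)`. -/
noncomputable def entropyGapDeriv (c x : ℝ) : ℝ := log (1 - x) + 1 + c * (log x + 1)

@[simp] lemma entropyGap_zero (c : ℝ) : entropyGap c 0 = 0 := by simp [entropyGap]

@[simp] lemma entropyGap_one (c : ℝ) : entropyGap c 1 = 0 := by simp [entropyGap]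

lemma continuous_entropyGap (c : ℝ) : Continuous (entropyGap c) := by
  unfold entropyGap
  fun_prop

lemma hasDerivAt_entropyGap (c : ℝ) {x : ℝ} (h0 : 0 < x) (h1 : x < 1) :
    HasDerivAt (entropyGap c) (entropyGapDeriv c x) x := by
  have ha := (hasDerivAt_negMulLog (sub_pos.2 h1).ne').comp x ((hasDerivAt_id x).const_sub 1)
  have hb := (hasDerivAt_negMulLog h0.ne').const_mul c
  refine (ha.sub hb).congr_deriv ?_
  simp only [entropyGapDeriv]
  ring

lemma hasDerivAt_entropyGapDeriv (c : ℝ) {x : ℝ} (h0 : 0 < x) (h1 : x < 1) :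
    HasDerivAt (entropyGapDeriv c) (c / x - 1 / (1 - x)) x := by
  have ha := (((hasDerivAt_id x).const_sub 1).log (sub_pos.2 h1).ne').add_const 1
  have hb := (((hasDerivAt_id x).log h0.ne').add_const 1).const_mul c
  refine (ha.add hb).congr_deriv ?_
  simp only [id]
  ring

lemma convexOn_entropyGap {c : ℝ} (hc : 0 < c) :
    ConvexOn ℝ (Set.Icc 0 (c / (1 + c))) (entropyGap c) := by
  have hs : c / (1 + c) < 1 := by rw [div_lt_one (by linarith)]; linarith
  refine convexOn_of_hasDerivWithinAt2_nonneg (convex_Icc _ _)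
    (continuous_entropyGap c).continuousOn (f' := entropyGapDeriv c)
    (f'' := fun x => c / x - 1 / (1 - x)) ?_ ?_ ?_ <;>
    rw [interior_Icc] <;> rintro x ⟨h0, h1⟩
  · exact (hasDerivAt_entropyGap c h0 (h1.trans hs)).hasDerivWithinAt
  · exact (hasDerivAt_entropyGapDeriv c h0 (h1.trans hs)).hasDerivWithinAt
  · have : 0 < 1 - x := by linarith
    rw [lt_div_iff₀ (by linarith)] at h1
    rw [sub_nonneg, div_le_div_iff₀ this h0]
    linarith

lemma concaveOn_entropyGap {c : ℝ} (hc : 0 < c) :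
    ConcaveOn ℝ (Set.Icc (c / (1 + c)) 1) (entropyGap c) := by
  have hs : 0 < c / (1 + c) := by positivity
  refine concaveOn_of_hasDerivWithinAt2_nonpos (convex_Icc _ _)
    (continuous_entropyGap c).continuousOn (f' := entropyGapDeriv c)
    (f'' := fun x => c / x - 1 / (1 - x)) ?_ ?_ ?_ <;>
    rw [interior_Icc] <;> rintro x ⟨h0, h1⟩
  · exact (hasDerivAt_entropyGap c (hs.trans h0) h1).hasDerivWithinAt
  · exact (hasDerivAt_entropyGapDeriv c (hs.trans h0) h1).hasDerivWithinAt
  · have hx : 0 < x := hs.trans h0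
    rw [div_lt_iff₀ (by linarith)] at h0
    rw [sub_nonpos, div_le_div_iff₀ hx (by linarith)]
    linarith

/-- The sum of `entropyGap c` over a probability vector with one entry `1 - e` and `k` entries
`e / k`. -/
noncomputable def entropyGapSum (c k e : ℝ) : ℝ := k * entropyGap c (e / k) + entropyGap c (1 - e)

lemma continuous_entropyGapSum (c k : ℝ) : Continuous (entropyGapSum c k) := by
  have := continuous_entropyGap c
  unfold entropyGapSum
  fun_prop

lemma hasDerivAt_entropyGapSum (c : ℝ) {k e : ℝ} (hk : 1 ≤ k) (h0 : 0 < e) (h1 : e < 1) :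
    HasDerivAt (entropyGapSum c k) (entropyGapDeriv c (e / k) - entropyGapDeriv c (1 - e)) e := by
  have hk0 : 0 < k := by linarith
  have hek : e / k < 1 := by rw [div_lt_one hk0]; linarith
  have ha := ((hasDerivAt_entropyGap c (div_pos h0 hk0) hek).comp e
    ((hasDerivAt_id e).div_const k)).const_mul k
  have hb := (hasDerivAt_entropyGap c (sub_pos.2 h1) (by linarith)).comp e
    ((hasDerivAt_id e).const_sub 1)
  refine (ha.add hb).congr_deriv ?_
  field_simp
  ring

lemma hasDerivAt_deriv_entropyGapSum (c : ℝ) {k e : ℝ} (hk : 1 ≤ k) (h0 : 0 < e) (h1 : e < 1) :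
    HasDerivAt (fun e => entropyGapDeriv c (e / k) - entropyGapDeriv c (1 - e))
      ((c * (k - e) - k * (1 - e)) / (e * (1 - e) * (k - e))) e := by
  have hk0 : 0 < k := by linarith
  have hek : e / k < 1 := by rw [div_lt_one hk0]; linarith
  have ha := (hasDerivAt_entropyGapDeriv c (div_pos h0 hk0) hek).comp e
    ((hasDerivAt_id e).div_const k)
  have hb := (hasDerivAt_entropyGapDeriv c (sub_pos.2 h1) (by linarith)).comp e
    ((hasDerivAt_id e).const_sub 1)
  refine (ha.sub hb).congr_deriv ?_
  have h2 : 1 - e ≠ 0 := by linarith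
  have h3 : k - e ≠ 0 := by linarith
  have h4 : 1 - e / k = (k - e) / k := by field_simp
  rw [h4, sub_sub_cancel]
  field_simp
  ring

lemma entropyGapSum_nonneg {c k : ℝ} (hk : 1 < k) (hc1 : c ≤ 1) (hck : 1 ≤ c * k)
    (hunif : entropyGap c (1 / (k + 1)) = 0) {e : ℝ} (he : e ∈ Set.Icc (0 : ℝ) 1) :
    0 ≤ entropyGapSum c k e := by
  have hk0 : 0 < k := by linarith
  have hkc : 0 < k - c := by linarith
  set z : ℝ := k * (1 - c) / (k - c) with hz
  have hz0 : 0 ≤ z := div_nonneg (mul_nonneg hk0.le (by linarith)) hkc.le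
  set u : ℝ := k / (k + 1) with hu
  have hu0 : 0 < u := by positivity
  have hu1 : u < 1 := by rw [hu, div_lt_one (by linarith)]; linarith
  have hzu : z ≤ u := by
    rw [hz, hu, div_le_div_iff₀ hkc (by linarith)]
    nlinarith
  have huk : u / k = 1 / (k + 1) := by rw [hu]; field_simp
  have hu' : 1 - u = 1 / (k + 1) := by rw [hu]; field_simp; ring
  have hGu : entropyGapSum c k u = 0 := by simp only [entropyGapSum, huk, hu', hunif, mul_zero, add_zero]
  have hcvx : ConvexOn ℝ (Set.Icc z 1) (entropyGapSum c k) := by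
    refine convexOn_of_hasDerivWithinAt2_nonneg (convex_Icc _ _)
      (continuous_entropyGapSum c k).continuousOn
      (f' := fun e => entropyGapDeriv c (e / k) - entropyGapDeriv c (1 - e))
      (f'' := fun e => (c * (k - e) - k * (1 - e)) / (e * (1 - e) * (k - e))) ?_ ?_ ?_ <;>
      rw [interior_Icc] <;> rintro x ⟨h0, h1⟩
    · exact (hasDerivAt_entropyGapSum c hk.le (hz0.trans_lt h0) h1).hasDerivWithinAt
    · exact (hasDerivAt_deriv_entropyGapSum c hk.le (hz0.trans_lt h0) h1).hasDerivWithinAt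
    · have hx : 0 < x := hz0.trans_lt h0
      rw [hz, div_lt_iff₀ hkc] at h0
      refine div_nonneg (by linarith) (mul_nonneg (mul_nonneg hx.le ?_) ?_) <;> linarith
  have hccv : ConcaveOn ℝ (Set.Icc 0 z) (entropyGapSum c k) := by
    refine concaveOn_of_hasDerivWithinAt2_nonpos (convex_Icc _ _)
      (continuous_entropyGapSum c k).continuousOn
      (f' := fun e => entropyGapDeriv c (e / k) - entropyGapDeriv c (1 - e))
      (f'' := fun e => (c * (k - e) - k * (1 - e)) / (e * (1 - e) * (k - e))) ?_ ?_ ?_ <;>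
      rw [interior_Icc] <;> rintro x ⟨h0, h1⟩
    · exact (hasDerivAt_entropyGapSum c hk.le h0
        (h1.trans_le (hzu.trans hu1.le))).hasDerivWithinAt
    · exact (hasDerivAt_deriv_entropyGapSum c hk.le h0
        (h1.trans_le (hzu.trans hu1.le))).hasDerivWithinAt
    · have hx : x < 1 := h1.trans_le (hzu.trans hu1.le)
      rw [hz, lt_div_iff₀ hkc] at h1
      refine div_nonpos_of_nonpos_of_nonneg (by linarith)
        (mul_nonneg (mul_nonneg h0.le ?_) ?_) <;> linarith
  have hright : ∀ x ∈ Set.Icc z 1, 0 ≤ entropyGapSum c k x := by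
    intro x hx
    have hd := hasDerivAt_entropyGapSum c hk.le hu0 hu1
    rw [huk, hu', sub_self] at hd
    have humem : u ∈ Set.Icc z 1 := ⟨hzu, hu1.le⟩
    rcases lt_trichotomy x u with h | h | h
    · have hsl := hcvx.slope_le_of_hasDerivAt hx humem h hd
      rw [slope_def_field, div_le_iff₀ (by linarith), hGu] at hsl
      linarith
    · rw [h, hGu]
    · have hsl := hcvx.le_slope_of_hasDerivAt humem hx h hd
      rw [slope_def_field, le_div_iff₀ (by linarith), hGu] at hsl
      linarith
  rcases le_total z e with h | h
  · exact hright e ⟨h, he.2⟩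
  · have hG0 : entropyGapSum c k 0 = 0 := by simp [entropyGapSum]
    have hGz := hright z ⟨le_rfl, hzu.trans hu1.le⟩
    have := hccv.min_le_of_mem_Icc (Set.left_mem_Icc.2 hz0) (Set.right_mem_Icc.2 hz0) ⟨he.1, h⟩
    rw [hG0] at this
    exact (le_min le_rfl hGz).trans this

lemma log_sub_log_sub_one_mul_sum_negMulLog_le {n : ℕ} (hn : 2 ≤ n) {p : Fin n → ℝ}
    (hp : ∀ i, 0 ≤ p i) (hp1 : ∑ i, p i = 1) :
    ((n : ℝ) - 1) * (log n - log ((n : ℝ) - 1)) * ∑ i, negMulLog (p i)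
      ≤ log n * ∑ i, negMulLog (1 - p i) := by
  rcases hn.eq_or_lt with rfl | hn3
  · rw [Fin.sum_univ_two] at hp1
    have h0 : 1 - p 0 = p 1 := by linarith
    have h1 : 1 - p 1 = p 0 := by linarith
    simp only [Fin.sum_univ_two, h0, h1]
    norm_num
    linarith
  have hN : (3 : ℝ) ≤ n := by exact_mod_cast hn3
  set N : ℝ := (n : ℝ) with hNdef
  have hL : 1 ≤ log N := by
    rw [le_log_iff_exp_le (by linarith)]
    linarith [exp_one_lt_d9]
  have hD : log N - log (N - 1) = - log (1 - 1 / N) := by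
    rw [← log_div (by linarith) (by linarith), ← log_inv]
    congr 1
    have : N - 1 ≠ 0 := by linarith
    field_simp
  have hDlow : 1 / N ≤ log N - log (N - 1) := by
    have : 1 / N < 1 := by rw [div_lt_one (by linarith)]; linarith
    have := log_le_sub_one_of_pos (show 0 < 1 - 1 / N by linarith)
    rw [hD]; linarith
  have hDup : (N - 1) * (log N - log (N - 1)) ≤ 1 := by
    have hN1 : 0 < N - 1 := by linarith
    have := log_le_sub_one_of_pos (show 0 < N / (N - 1) by apply div_pos <;> linarith)
    rw [log_div (by linarith) (by linarith)] at this
    calc _ ≤ (N - 1) * (N / (N - 1) - 1) := by gcongr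
      _ = 1 := by field_simp; ring
  have hLup : log N ≤ N - 2 + 1 / N := by
    have h := log_le_sub_one_of_pos (show 0 < N / 2 by linarith)
    rw [log_div (by linarith) (by norm_num)] at h
    have h2 := log_two_lt_d9
    have : 0 < 1 / N := by positivity
    by_cases h' : N < 3.4
    · have : 1 / 3.4 ≤ 1 / N := by gcongr
      norm_num at this h2 ⊢
      linarith
    · linarith
  set c : ℝ := (N - 1) * (log N - log (N - 1)) / log N with hc
  have hDpos : 0 < log N - log (N - 1) := lt_of_lt_of_le (by positivity) hDlow
  have hc0 : 0 < c := div_pos (mul_pos (by linarith) hDpos) (by linarith)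
  have hc1 : c ≤ 1 := by rw [hc, div_le_one (by linarith)]; linarith
  have hck : 1 ≤ c * (N - 1) := by
    rw [hc, div_mul_eq_mul_div, le_div_iff₀ (by linarith), one_mul]
    calc log N ≤ N - 2 + 1 / N := hLup
      _ = (N - 1) * (1 / N) * (N - 1) := by field_simp; ring
      _ ≤ _ := by gcongr <;> linarith
  have hunif : entropyGap c (1 / (N - 1 + 1)) = 0 := by
    rw [sub_add_cancel, entropyGap, show 1 - 1 / N = (N - 1) / N by field_simp, negMulLog,
      negMulLog, log_div (by linarith) (by linarith), log_div one_ne_zero (by linarith), log_one,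
      hc]
    field_simp
    ring
  have key := sum_nonneg_of_convexOn_of_concaveOn (by positivity) (convexOn_entropyGap hc0)
    (concaveOn_entropyGap hc0) (by simpa using hn) (p := p) (fun m hm => by
      rw [Fintype.card_fin]
      have := entropyGapSum_nonneg (by linarith) hc1 hck hunif (e := 1 - m)
        ⟨by linarith [hm.2], by linarith [hm.1]⟩
      rwa [entropyGapSum, sub_sub_cancel] at this) hp hp1
  simp only [entropyGap, Finset.sum_sub_distrib, ← Finset.mul_sum] at key
  have hmul : (N - 1) * (log N - log (N - 1)) = log N * c := by
    rw [hc]; field_simp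
  rw [hmul, mul_assoc]
  gcongr
  linarith

namespace Stmt15

lemma EntV_mul {n : ℕ} (hn : 0 < n) (S : ℝ) {p : Fin n → ℝ} (hp1 : ∑ i, p i = 1) :
    EntV n (fun i => S * p i) = S / n * (log n - ∑ i, negMulLog (p i)) := by
  have hN : (n : ℝ) ≠ 0 := by positivity
  rcases eq_or_ne S 0 with rfl | hS
  · simp [EntV]
  have hterm : ∀ i, S * p i * log (S * p i / (S / n)) = S * (p i * log n - negMulLog (p i)) := by
    intro i
    rcases eq_or_ne (p i) 0 with h | h
    · simp [h]
    · rw [show S * p i / (S / n) = p i * n by field_simp, log_mul h hN, negMulLog]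
      ring
  simp only [EntV, ← Finset.mul_sum, hp1, mul_one, hterm, Finset.sum_sub_distrib,
    ← Finset.sum_mul, one_mul]
  ring

lemma EntV_abar_mul {n : ℕ} (hn : 2 ≤ n) (S : ℝ) {p : Fin n → ℝ} (hp1 : ∑ i, p i = 1) :
    EntV n (abar n fun i => S * p i)
      = S / n * (log n - log ((n : ℝ) - 1) - (∑ i, negMulLog (1 - p i)) / ((n : ℝ) - 1)) := by
  have hN : (2 : ℝ) ≤ n := by exact_mod_cast hn
  have hN1 : (n : ℝ) - 1 ≠ 0 := by linarith
  have habar : (abar n fun i => S * p i) = fun i => S * ((1 - p i) * ((n : ℝ) - 1)⁻¹) := by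
    ext i
    rw [abar, ← Finset.mul_sum, Finset.sum_erase_eq_sub (Finset.mem_univ i), hp1]
    ring
  have hsum : ∑ i, (1 - p i) = (n : ℝ) - 1 := by simp [Finset.sum_sub_distrib, hp1]
  have hq1 : ∑ i, (1 - p i) * ((n : ℝ) - 1)⁻¹ = 1 := by
    rw [← Finset.sum_mul, hsum, mul_inv_cancel₀ hN1]
  rw [habar, EntV_mul (by omega) S hq1]
  simp only [negMulLog_mul, Finset.sum_add_distrib, ← Finset.mul_sum, ← Finset.sum_mul, hsum]
  rw [negMulLog, log_inv]
  field_simp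
  ring

end Stmt15

end

open Stmt15 in
theorem stmt15 (n : ℕ) (hn : 2 ≤ n) :
    -- the inequality `log n · Ent(ā) ≤ (log n − log(n−1)) · Ent(a)`
    (∀ a : Fin n → ℝ, (∀ i, 0 ≤ a i) →
        Real.log n * EntV n (abar n a)
          ≤ (Real.log n - Real.log ((n : ℝ) - 1)) * EntV n a)
    -- optimality: equality (hence attainment of the supremum `1 - log(n-1)/log n`
    -- of `Ent(ā)/Ent(a)` over nonconstant `a`) at nonnegative multiples of Dirac masses
    ∧ (∀ (i : Fin n) (c : ℝ), 0 ≤ c →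
        Real.log n * EntV n (abar n (fun j => if j = i then c else 0))
          = (Real.log n - Real.log ((n : ℝ) - 1))
              * EntV n (fun j => if j = i then c else 0)) := by
  have hN : (2 : ℝ) ≤ n := by exact_mod_cast hn
  have hN1 : 0 < (n : ℝ) - 1 := by linarith
  refine ⟨fun a ha => ?_, fun i c _ => ?_⟩
  · set S : ℝ := ∑ i, a i with hS
    have hS0 : 0 ≤ S := Finset.sum_nonneg fun i _ => ha i
    rcases hS0.eq_or_lt with h | h
    · have ha0 : a = 0 := by
        ext i
        exact (Finset.sum_eq_zero_iff_of_nonneg fun i _ => ha i).1 h.symm i (Finset.mem_univ i)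
      simp [ha0, EntV, abar]
    · have hp1 : ∑ i, a i / S = 1 := by rw [← Finset.sum_div, ← hS, div_self h.ne']
      have haS : a = fun i => S * (a i / S) := by
        ext i
        field_simp
      have key := log_sub_log_sub_one_mul_sum_negMulLog_le hn
        (fun i => div_nonneg (ha i) hS0) hp1
      rw [haS, EntV_abar_mul hn S hp1, EntV_mul (by omega) S hp1, mul_left_comm,
        mul_left_comm (_ - _)]
      refine mul_le_mul_of_nonneg_left ?_ (by positivity)
      have h2 : (Real.log n - Real.log ((n : ℝ) - 1)) * ∑ i, Real.negMulLog (a i / S)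
          ≤ Real.log n * ((∑ i, Real.negMulLog (1 - a i / S)) / ((n : ℝ) - 1)) := by
        rw [← mul_div_assoc, le_div_iff₀ hN1]
        linarith
      linarith
  · set p : Fin n → ℝ := fun j => if j = i then 1 else 0 with hp
    have hp1 : ∑ j, p j = 1 := by simp [hp]
    have hcp : (fun j => if j = i then c else 0) = fun j => c * p j := by
      ext j
      simp [hp]
    have h1 : ∀ j, Real.negMulLog (p j) = 0 := fun j => by
      by_cases h : j = i <;> simp [hp, h]
    have h2 : ∀ j, Real.negMulLog (1 - p j) = 0 := fun j => by
      by_cases h : j = i <;> simp [hp, h]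
    rw [hcp, EntV_abar_mul hn c hp1, EntV_mul (by omega) c hp1]
    simp only [h1, h2, Finset.sum_const_zero, zero_div, sub_zero]
    ring
end

section
/- For every n ≥ 3, the entropy constant of the star graph S_n satisfies 2·log 2 · (1 − 2/n)/log(n−1) ≤ κ(S_n) ≤ 2·log 2 / log n. -/
open Finset

namespace Stmt16

variable {V : Type*} [Fintype V]

/-- Relative entropy of `f` w.r.t. the uniform distribution on `V`. -/
noncomputable def Ent (f : V → ℝ) : ℝ :=
  (1 / (Fintype.card V : ℝ)) *
    ∑ x, f x * Real.log (f x / ((∑ y, f y) / (Fintype.card V : ℝ)))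

/-- The local entropy `ent_{xy} f`. -/
noncomputable def entEdge (f : V → ℝ) (x y : V) : ℝ :=
  (1 / 2) * f x * Real.log (f x / ((f x + f y) / 2)) +
    (1 / 2) * f y * Real.log (f y / ((f x + f y) / 2))

/-- The entropy constant `κ(G)` of the weighted graph with weights `c`. -/
noncomputable def kappaG (c : V → V → ℝ) : ℝ :=
  sSup {κ : ℝ | 0 ≤ κ ∧ ∀ f : V → ℝ, (∀ x, 0 ≤ f x) →
    κ * Ent f ≤ (2 / (Fintype.card V : ℝ)) * ∑ x, ∑ y, c x y * entEdge f x y}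

theorem mul_sinh_le_mul_sinh {y z : ℝ} (hy : 0 ≤ y) (hyz : y ≤ z) :
    z * Real.sinh y ≤ y * Real.sinh z := by
  rcases hy.eq_or_lt with rfl | hy
  · simp
  have hconv : ConvexOn ℝ (Set.Ici 0) Real.sinh := by
    apply MonotoneOn.convexOn_of_deriv (convex_Ici 0) Real.continuous_sinh.continuousOn
      Real.differentiable_sinh.differentiableOn
    intro a ha b hb hab
    rw [interior_Ici, Set.mem_Ioi] at ha hb
    rw [Real.deriv_sinh, Real.cosh_le_cosh, abs_of_pos ha, abs_of_pos hb]
    exact hab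
  have hz : 0 < z := hy.trans_le hyz
  have h := hconv.2 (Set.mem_Ici.2 le_rfl) (Set.mem_Ici.2 hz.le)
    (sub_nonneg.2 ((div_le_one hz).2 hyz)) (div_nonneg hy.le hz.le) (by ring)
  simp only [smul_eq_mul, mul_zero, zero_add, Real.sinh_zero, div_mul_cancel₀ _ hz.ne'] at h
  calc z * Real.sinh y ≤ z * (y / z * Real.sinh z) := by gcongr
    _ = y * Real.sinh z := by field_simp

/-- Half of the logit. -/
noncomputable def halfLogit (P : ℝ) : ℝ := (Real.log P - Real.log (1 - P)) / 2

/-- The binary entropy minus a multiple of the standard deviation of a Bernoulli variable. -/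
noncomputable def entropyGap (C P : ℝ) : ℝ := Real.binEntropy P - 2 * C * √(P * (1 - P))

theorem sinh_halfLogit {P : ℝ} (h0 : 0 < P) (h1 : P < 1) :
    Real.sinh (halfLogit P) = (2 * P - 1) / (2 * √(P * (1 - P))) := by
  have hQ : 0 < 1 - P := sub_pos.2 h1
  have hP' := Real.sqrt_pos.2 h0
  have hQ' := Real.sqrt_pos.2 hQ
  have h : halfLogit P = Real.log (√P / √(1 - P)) := by
    rw [Real.log_div hP'.ne' hQ'.ne', Real.log_sqrt h0.le, Real.log_sqrt hQ.le, halfLogit]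
    ring
  rw [h, Real.sinh_log (by positivity), Real.sqrt_mul h0.le]
  field_simp
  rw [Real.sq_sqrt h0.le, Real.sq_sqrt hQ.le]
  ring

theorem halfLogit_le_halfLogit {P R : ℝ} (h0 : 0 < P) (hPR : P ≤ R) (h1 : R < 1) :
    halfLogit P ≤ halfLogit R := by
  have := Real.log_le_log h0 hPR
  have := Real.log_le_log (sub_pos.2 h1) (sub_le_sub_left hPR 1)
  unfold halfLogit
  linarith

theorem halfLogit_pos {P : ℝ} (h0 : 1 / 2 < P) (h1 : P < 1) : 0 < halfLogit P := by
  have := Real.log_lt_log (sub_pos.2 h1) (by linarith : 1 - P < P)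
  unfold halfLogit
  linarith

theorem continuous_entropyGap (C : ℝ) : Continuous (entropyGap C) := by
  unfold entropyGap
  fun_prop

theorem entropyGap_one_sub (C P : ℝ) : entropyGap C (1 - P) = entropyGap C P := by
  simp [entropyGap, mul_comm]

theorem hasDerivAt_entropyGap (C : ℝ) {P : ℝ} (h0 : 0 < P) (h1 : P < 1) :
    HasDerivAt (entropyGap C) (2 * (C * Real.sinh (halfLogit P) - halfLogit P)) P := by
  have hPQ : 0 < P * (1 - P) := mul_pos h0 (sub_pos.2 h1)
  have hd : HasDerivAt (fun x : ℝ ↦ x * (1 - x)) (1 * (1 - P) + P * (0 - 1)) P :=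
    (hasDerivAt_id P).mul ((hasDerivAt_const P 1).sub (hasDerivAt_id P))
  refine ((Real.hasDerivAt_binEntropy h0.ne' h1.ne).sub
    ((hd.sqrt hPQ.ne').const_mul (2 * C))).congr_deriv ?_
  rw [sinh_halfLogit h0 h1, halfLogit]
  have := Real.sqrt_pos.2 hPQ
  field_simp
  ring

theorem monotoneOn_entropyGap {C A : ℝ} (hA : 1 / 2 < A) (hA1 : A < 1)
    (h : halfLogit A ≤ C * Real.sinh (halfLogit A)) :
    MonotoneOn (entropyGap C) (Set.Icc A 1) := by
  refine monotoneOn_of_hasDerivWithinAt_nonneg (convex_Icc A 1)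
    (continuous_entropyGap C).continuousOn (f' := fun P ↦
      2 * (C * Real.sinh (halfLogit P) - halfLogit P)) (fun P hP ↦ ?_) fun P hP ↦ ?_ <;>
    rw [interior_Icc] at hP
  · exact (hasDerivAt_entropyGap C (by linarith [hP.1]) hP.2).hasDerivWithinAt
  · have hpos := halfLogit_pos hA hA1
    have hle := halfLogit_le_halfLogit (by linarith) hP.1.le hP.2
    have hs := mul_sinh_le_mul_sinh hpos.le hle
    have hsA : 0 < Real.sinh (halfLogit A) := Real.sinh_pos_iff.2 hpos
    have hC : 0 ≤ C := by
      by_contra! hC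
      nlinarith
    have : halfLogit A * halfLogit P ≤ halfLogit A * (C * Real.sinh (halfLogit P)) := by
      nlinarith [mul_le_mul_of_nonneg_left h (hpos.le.trans hle),
        mul_le_mul_of_nonneg_left hs hC]
    have := le_of_mul_le_mul_left this hpos
    linarith

theorem antitoneOn_entropyGap {C A : ℝ} (hC : 0 ≤ C) (hA1 : A < 1)
    (h : C * Real.sinh (halfLogit A) ≤ halfLogit A) :
    AntitoneOn (entropyGap C) (Set.Icc (1 / 2) A) := by
  refine antitoneOn_of_hasDerivWithinAt_nonpos (convex_Icc (1 / 2) A)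
    (continuous_entropyGap C).continuousOn (f' := fun P ↦
      2 * (C * Real.sinh (halfLogit P) - halfLogit P)) (fun P hP ↦ ?_) fun P hP ↦ ?_ <;>
    rw [interior_Icc] at hP
  · exact (hasDerivAt_entropyGap C (by linarith [hP.1]) (hP.2.trans hA1)).hasDerivWithinAt
  · have hpos := halfLogit_pos hP.1 (hP.2.trans hA1)
    have hle := halfLogit_le_halfLogit (by linarith [hP.1]) hP.2.le hA1
    have hs := mul_sinh_le_mul_sinh hpos.le hle
    have : halfLogit A * (C * Real.sinh (halfLogit P)) ≤ halfLogit A * halfLogit P := by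
      nlinarith [mul_le_mul_of_nonneg_left h hpos.le, mul_le_mul_of_nonneg_left hs hC]
    have := le_of_mul_le_mul_left this (hpos.trans_le hle)
    linarith

/-- Two-point logarithmic Sobolev inequality, in terms of the binary entropy. -/
theorem entropyGap_le_of_critical {C A P : ℝ} (hA : 1 / 2 < A) (hA1 : A < 1)
    (h : C * Real.sinh (halfLogit A) = halfLogit A) (h0 : 0 ≤ P) (h1 : P ≤ 1) :
    entropyGap C A ≤ entropyGap C P := by
  wlog hP : 1 / 2 ≤ P generalizing P
  · rw [← entropyGap_one_sub C P]
    exact this (by linarith) (by linarith) (by linarith)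
  have hpos := halfLogit_pos hA hA1
  have hsA : 0 < Real.sinh (halfLogit A) := Real.sinh_pos_iff.2 hpos
  have hC : 0 ≤ C := by
    by_contra! hC
    nlinarith
  rcases le_total A P with hAP | hPA
  · exact monotoneOn_entropyGap hA hA1 h.ge ⟨le_rfl, hA1.le⟩ ⟨hAP, h1⟩ hAP
  · exact antitoneOn_entropyGap hC hA1 h.le ⟨hP, hPA⟩ ⟨hA.le, le_rfl⟩ hPA

theorem binEntropy_le_log_two_mul_sqrt {P : ℝ} (h0 : 0 ≤ P) (h1 : P ≤ 1) :
    Real.binEntropy P ≤ Real.log 2 * (2 * √(P * (1 - P))) := by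
  have hlog : 0 < Real.log 2 := Real.log_pos one_lt_two
  suffices entropyGap (Real.log 2) P ≤ 0 by
    unfold entropyGap at this
    linarith
  have h_half : entropyGap (Real.log 2) (1 / 2) = 0 := by
    have : (1 / 2 * (1 - 1 / 2) : ℝ) = (1 / 2) ^ 2 := by norm_num
    rw [entropyGap, this, Real.sqrt_sq (by norm_num), one_div, Real.binEntropy_two_inv]
    ring
  have h_one : entropyGap (Real.log 2) 1 = 0 := by simp [entropyGap]
  wlog hP : 1 / 2 ≤ P generalizing P
  · rw [← entropyGap_one_sub]
    exact this (by linarith) (by linarith) (by linarith)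
  rcases hP.eq_or_lt with rfl | hP
  · exact h_half.le
  rcases h1.eq_or_lt with rfl | h1
  · exact h_one.le
  rcases le_total (halfLogit P) (Real.log 2 * Real.sinh (halfLogit P)) with h | h
  · rw [← h_one]
    exact monotoneOn_entropyGap hP h1 h ⟨le_rfl, h1.le⟩ ⟨h1.le, le_rfl⟩ h1.le
  · rw [← h_half]
    exact antitoneOn_entropyGap hlog.le h1 h ⟨le_rfl, hP.le⟩ ⟨hP.le, le_rfl⟩ hP.le

theorem sq_mul_log_sub_quadratic_monotoneOn :
    MonotoneOn (fun t : ℝ ↦ 2 * (t * (t * Real.log t)) - 2 * (t - 1) - 3 * (t - 1) ^ 2)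
      (Set.Ici 0) := by
  refine monotoneOn_of_hasDerivWithinAt_nonneg (convex_Ici 0)
    (f' := fun t ↦ 4 * (t * Real.log t - (t - 1))) ?_ (fun t ht ↦ ?_) fun t ht ↦ ?_
  · have := Real.continuous_mul_log
    fun_prop
  all_goals rw [interior_Ici, Set.mem_Ioi] at ht
  · have hid := hasDerivAt_id t
    refine HasDerivAt.hasDerivWithinAt <| HasDerivAt.congr_deriv
      ((((hid.mul (Real.hasDerivAt_mul_log ht.ne')).const_mul 2).sub
        ((hid.sub_const 1).const_mul 2)).sub (((hid.sub_const 1).pow 2).const_mul 3)) ?_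
    simp only [id_eq, Nat.cast_ofNat]
    ring
  · have := Real.one_sub_inv_le_log_of_pos ht
    have := mul_le_mul_of_nonneg_left this ht.le
    rw [mul_sub, mul_inv_cancel₀ ht.ne'] at this
    linarith

/-- The second-order divided difference at the double node `1` and `t` of `t ↦ t² log t²`. -/
noncomputable def logQuotient (t : ℝ) : ℝ :=
  (2 * (t * (t * Real.log t)) - 2 * (t - 1)) / (t - 1) ^ 2

theorem logQuotient_monotoneOn : MonotoneOn logQuotient (Set.Ioi 1) := by
  refine monotoneOn_of_hasDerivWithinAt_nonneg (convex_Ioi 1)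
    (f' := fun t ↦ (2 * (t ^ 2 - 1) - 4 * (t * Real.log t)) / (t - 1) ^ 3) ?_
    (fun t ht ↦ ?_) fun t ht ↦ ?_
  · have := Real.continuous_mul_log
    unfold logQuotient
    refine ContinuousOn.div (by fun_prop) (by fun_prop) fun t ht ↦ ?_
    exact pow_ne_zero 2 (sub_ne_zero.2 ht.ne')
  all_goals rw [interior_Ioi, Set.mem_Ioi] at ht
  all_goals have ht0 : 0 < t := one_pos.trans ht
  all_goals have ht1 : 0 < t - 1 := sub_pos.2 ht
  · have hid := hasDerivAt_id t
    refine HasDerivAt.hasDerivWithinAt <| HasDerivAt.congr_deriv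
      ((((hid.mul (Real.hasDerivAt_mul_log ht0.ne')).const_mul 2).sub
        ((hid.sub_const 1).const_mul 2)).div ((hid.sub_const 1).pow 2)
          (pow_ne_zero 2 ht1.ne')) ?_
    simp only [id_eq, Nat.cast_ofNat, Pi.sub_apply, Pi.mul_apply]
    field_simp
    ring
  · have hlog := Real.self_le_sinh_iff.2 (Real.log_nonneg ht.le)
    rw [Real.sinh_log ht0] at hlog
    have := mul_le_mul_of_nonneg_left hlog ht0.le
    rw [mul_div_assoc', mul_sub, mul_inv_cancel₀ ht0.ne'] at this
    apply div_nonneg _ (by positivity)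
    nlinarith

/-- Quadratic majorant of `t² log t²` on `[0, T]`, touching at `1` and at `T`. -/
theorem exists_quadratic_majorant_one {T : ℝ} (hT : 1 ≤ T) :
    ∃ c : ℝ, (∀ t, 0 ≤ t → t ≤ T → 2 * (t * (t * Real.log t)) ≤ 2 * (t - 1) + c * (t - 1) ^ 2) ∧
      2 * (T * (T * Real.log T)) = 2 * (T - 1) + c * (T - 1) ^ 2 := by
  have hmono := sq_mul_log_sub_quadratic_monotoneOn
  have hle_one : ∀ t : ℝ, 0 ≤ t → t ≤ 1 →
      2 * (t * (t * Real.log t)) ≤ 2 * (t - 1) + 3 * (t - 1) ^ 2 := fun t h0 h1 ↦ by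
    have := hmono (Set.mem_Ici.2 h0) (Set.mem_Ici.2 zero_le_one) h1
    norm_num at this
    linarith
  rcases hT.eq_or_lt with rfl | hT
  · exact ⟨3, hle_one, by simp⟩
  have heq : ∀ t : ℝ, 1 < t →
      2 * (t * (t * Real.log t)) = 2 * (t - 1) + logQuotient t * (t - 1) ^ 2 := fun t ht ↦ by
    have : t - 1 ≠ 0 := sub_ne_zero.2 ht.ne'
    unfold logQuotient
    field_simp
    ring
  refine ⟨logQuotient T, fun t h0 htT ↦ ?_, heq T hT⟩
  rcases le_or_gt t 1 with h1 | h1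
  · have hc : 3 ≤ logQuotient T := by
      have := hmono (Set.mem_Ici.2 zero_le_one) (Set.mem_Ici.2 (zero_le_one.trans hT.le)) hT.le
      norm_num at this
      rw [logQuotient, le_div_iff₀ (pow_pos (sub_pos.2 hT) 2)]
      linarith
    nlinarith [hle_one t h0 h1, sq_nonneg (t - 1)]
  · rw [heq t h1]
    have := logQuotient_monotoneOn h1 hT htT
    gcongr

theorem exists_quadratic_majorant {u v : ℝ} (hu : 0 ≤ u) (huv : u ≤ v) :
    ∃ a b c : ℝ, (∀ x, 0 ≤ x → x ≤ v → x ^ 2 * Real.log (x ^ 2) ≤ a + b * x + c * x ^ 2) ∧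
      u ^ 2 * Real.log (u ^ 2) = a + b * u + c * u ^ 2 ∧
      v ^ 2 * Real.log (v ^ 2) = a + b * v + c * v ^ 2 := by
  rcases hu.eq_or_lt with rfl | hu
  · refine ⟨0, 0, Real.log (v ^ 2), fun x h0 hx ↦ ?_, by simp, by ring⟩
    rcases h0.eq_or_lt with rfl | h0
    · simp
    have := Real.log_le_log (by positivity) (pow_le_pow_left₀ h0.le hx 2)
    nlinarith [sq_nonneg x]
  obtain ⟨c, hc, hcT⟩ := exists_quadratic_majorant_one ((one_le_div hu).2 huv)
  have key : ∀ x : ℝ, 0 ≤ x → x ^ 2 * Real.log (x ^ 2) =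
      u ^ 2 * (2 * (x / u * (x / u * Real.log (x / u)))) + Real.log (u ^ 2) * x ^ 2 := by
    intro x hx
    rcases hx.eq_or_lt with rfl | hx
    · simp
    rw [Real.log_div hx.ne' hu.ne', Real.log_pow, Real.log_pow]
    field_simp
    push_cast
    ring
  have expand : ∀ x : ℝ, u ^ 2 * (2 * (x / u - 1) + c * (x / u - 1) ^ 2) +
      Real.log (u ^ 2) * x ^ 2 = (c - 2) * u ^ 2 + (2 - 2 * c) * u * x +
        (c + Real.log (u ^ 2)) * x ^ 2 := by
    intro x
    field_simp
    ring
  refine ⟨(c - 2) * u ^ 2, (2 - 2 * c) * u, c + Real.log (u ^ 2), fun x h0 hx ↦ ?_, ?_, ?_⟩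
  · rw [key x h0, ← expand]
    have := hc (x / u) (by positivity) (by gcongr)
    gcongr
  · ring
  · rw [key v (hu.le.trans huv), ← expand, hcT]

theorem entropy_two_point_le {n u v : ℝ} (hn : 2 < n) (hu : 0 ≤ u) (hv : 0 < v) :
    v ^ 2 * Real.log (v ^ 2) + (n - 1) * (u ^ 2 * Real.log (u ^ 2)) ≤
      (v ^ 2 + (n - 1) * u ^ 2) * Real.log ((v ^ 2 + (n - 1) * u ^ 2) / n) +
        (n - 1) * Real.log (n - 1) / (n - 2) * (v - u) ^ 2 := by
  have hn0 : 0 < n := by linarith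
  have hn1 : 0 < n - 1 := by linarith
  have hn2 : 0 < n - 2 := by linarith
  set N := v ^ 2 + (n - 1) * u ^ 2 with hN
  have hNpos : 0 < N := by positivity
  have hA : 1 / 2 < (n - 1) / n := by
    rw [div_lt_div_iff₀ two_pos hn0]
    linarith
  have hA1 : (n - 1) / n < 1 := by
    rw [div_lt_one hn0]
    linarith
  have hcompl : 1 - (n - 1) / n = 1 / n := by
    field_simp
    ring
  have hcompl' : 1 - v ^ 2 / N = (n - 1) * u ^ 2 / N := by
    field_simp
    linarith
  have hlogit : halfLogit ((n - 1) / n) = Real.log (n - 1) / 2 := by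
    rw [halfLogit, hcompl, Real.log_div hn1.ne' hn0.ne', one_div, Real.log_inv]
    ring
  have hsqrt : √((n - 1) / n * (1 - (n - 1) / n)) = √(n - 1) / n := by
    rw [hcompl, div_mul_div_comm, mul_one, Real.sqrt_div hn1.le, Real.sqrt_mul_self hn0.le]
  have hsqrt' : √(v ^ 2 / N * (1 - v ^ 2 / N)) = √(n - 1) * (u * v) / N := by
    have : v ^ 2 / N * ((n - 1) * u ^ 2 / N) = (n - 1) * (u * v / N) ^ 2 := by
      field_simp
    rw [hcompl', this, Real.sqrt_mul hn1.le, Real.sqrt_sq (by positivity), mul_div_assoc']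
  have hs := Real.sqrt_pos.2 hn1
  have hss := Real.sq_sqrt hn1.le
  have hcrit : Real.log (n - 1) * √(n - 1) / (n - 2) * Real.sinh (halfLogit ((n - 1) / n)) =
      halfLogit ((n - 1) / n) := by
    rw [sinh_halfLogit (by positivity) hA1, hsqrt, hlogit]
    field_simp
    ring
  have h := entropyGap_le_of_critical hA hA1 hcrit (P := v ^ 2 / N) (by positivity)
    ((div_le_one hNpos).2 (by rw [hN]; nlinarith [mul_nonneg hn1.le (sq_nonneg u)]))
  have hentA : Real.binEntropy ((n - 1) / n) =
      Real.log n - (n - 1) / n * Real.log (n - 1) := by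
    rw [Real.binEntropy_eq_negMulLog_add_negMulLog_one_sub, hcompl, Real.negMulLog,
      Real.negMulLog, Real.log_div hn1.ne' hn0.ne', one_div, Real.log_inv]
    field_simp
    ring
  have hentP : N * Real.binEntropy (v ^ 2 / N) = N * Real.log N - v ^ 2 * Real.log (v ^ 2) -
      (n - 1) * (u ^ 2 * Real.log (u ^ 2)) - (n - 1) * u ^ 2 * Real.log (n - 1) := by
    rw [Real.binEntropy_eq_negMulLog_add_negMulLog_one_sub, hcompl', Real.negMulLog,
      Real.negMulLog, Real.log_div (by positivity) hNpos.ne']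
    rcases hu.eq_or_lt with rfl | hu
    · have : N = v ^ 2 := by rw [hN]; ring
      simp [this]
    rw [Real.log_div (by positivity) hNpos.ne', Real.log_mul hn1.ne' (by positivity)]
    field_simp
    rw [hN]
    ring
  rw [entropyGap, entropyGap, hsqrt, hsqrt', hentA] at h
  have h := mul_le_mul_of_nonneg_left h hNpos.le
  rw [mul_sub N (Real.binEntropy _), hentP] at h
  have e1 : N * (Real.log n - (n - 1) / n * Real.log (n - 1) -
      2 * (Real.log (n - 1) * √(n - 1) / (n - 2)) * (√(n - 1) / n)) =
      N * Real.log n - (n - 1) * Real.log (n - 1) / (n - 2) * N := by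
    field_simp
    rw [hss]
    ring
  have e2 : N * (2 * (Real.log (n - 1) * √(n - 1) / (n - 2)) * (√(n - 1) * (u * v) / N)) =
      (n - 1) * Real.log (n - 1) / (n - 2) * (2 * (u * v)) := by
    field_simp
    rw [hss]
    ring
  have e3 : (n - 1) * u ^ 2 * Real.log (n - 1) =
      (n - 1) * Real.log (n - 1) / (n - 2) * ((n - 2) * u ^ 2) := by
    field_simp
  have e4 : (n - 1) * Real.log (n - 1) / (n - 2) * (v - u) ^ 2 =
      (n - 1) * Real.log (n - 1) / (n - 2) * N -
      (n - 1) * Real.log (n - 1) / (n - 2) * ((n - 2) * u ^ 2) -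
      (n - 1) * Real.log (n - 1) / (n - 2) * (2 * (u * v)) := by
    rw [hN]
    ring
  rw [e1, e2, e3] at h
  rw [Real.log_div hNpos.ne' hn0.ne', e4]
  linarith

theorem sq_sum_sub_le (x : V → ℝ) (i : V) :
    (∑ j, x j - x i) ^ 2 ≤ ((Fintype.card V : ℝ) - 1) * (∑ j, x j ^ 2 - x i ^ 2) := by
  classical
  have h := sq_sum_le_card_mul_sum_sq (s := univ.erase i) (f := x)
  have hpos : 1 ≤ Fintype.card V := Fintype.card_pos_iff.2 ⟨i⟩
  rw [card_erase_of_mem (mem_univ i), card_univ, Nat.cast_sub hpos, Nat.cast_one,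
    sum_erase_eq_sub (mem_univ i), sum_erase_eq_sub (mem_univ i)] at h
  exact h

/-- Logarithmic Sobolev inequality for the complete graph, with the sharp constant. -/
theorem sum_sq_mul_log_le (hn : 2 < (Fintype.card V : ℝ)) {x : V → ℝ} (hx : ∀ i, 0 ≤ x i) :
    ∑ i, x i ^ 2 * Real.log (x i ^ 2 / ((∑ j, x j ^ 2) / (Fintype.card V : ℝ))) ≤
      Fintype.card V * Real.log (Fintype.card V - 1) / (Fintype.card V - 2) *
        (∑ j, x j ^ 2 - (∑ j, x j) ^ 2 / Fintype.card V) := by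
  set n : ℝ := (Fintype.card V : ℝ) with hn_def
  set N := ∑ j, x j ^ 2 with hN
  set s := ∑ j, x j with hs
  have hn0 : 0 < n := by linarith
  have hn1 : 0 < n - 1 := by linarith
  have hs0 : 0 ≤ s := sum_nonneg fun i _ ↦ hx i
  have hsN : s ^ 2 ≤ n * N := by
    simpa [hn_def] using sq_sum_le_card_mul_sum_sq (s := univ) (f := x)
  have hNs : N ≤ s ^ 2 := sum_sq_le_sq_sum_of_nonneg fun i _ ↦ hx i
  rcases (sum_nonneg fun i _ ↦ sq_nonneg (x i) : 0 ≤ N).eq_or_lt with h0 | hNpos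
  · have hx0 : ∀ i, x i ^ 2 = 0 := fun i ↦
      (sum_eq_zero_iff_of_nonneg fun i _ ↦ sq_nonneg (x i)).1 h0.symm i (mem_univ i)
    have : s = 0 := sum_eq_zero fun i _ ↦ pow_eq_zero_iff two_ne_zero |>.1 (hx0 i)
    have hN0 : N = 0 := h0.symm
    simp [hx0, hN0, this]
  set d := √((n * N - s ^ 2) / (n - 1)) with hd
  have hdsq : (n - 1) * d ^ 2 = n * N - s ^ 2 := by
    rw [hd, Real.sq_sqrt (div_nonneg (by linarith) hn1.le)]
    field_simp
  have hd0 : 0 ≤ d := Real.sqrt_nonneg _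
  have hds : d ≤ s := by
    apply le_of_sq_le_sq _ hs0
    nlinarith
  obtain ⟨u, hu⟩ : ∃ u, n * u = s - d := ⟨(s - d) / n, by field_simp⟩
  have hu0 : 0 ≤ u := by
    apply nonneg_of_mul_nonneg_right _ hn0
    linarith
  have hsum : (u + d) ^ 2 + (n - 1) * u ^ 2 = N := by
    apply mul_left_cancel₀ hn0.ne'
    linear_combination (n * u + s + d) * hu + hdsq
  have hv : 0 < u + d := by
    by_contra! hneg
    have h1 : u = 0 := by linarith
    have h2 : d = 0 := by linarith
    rw [h1, h2] at hsum
    norm_num at hsum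
    linarith
  have hxv : ∀ i, x i ≤ u + d := by
    intro i
    have h := sq_sum_sub_le x i
    rw [← hn_def, ← hN, ← hs] at h
    have : n * x i - s ≤ (n - 1) * d := by
      apply le_of_sq_le_sq _ (by positivity)
      nlinarith
    apply le_of_mul_le_mul_left _ hn0
    linarith
  obtain ⟨a, b, c, hle, hequ, heqv⟩ := exists_quadratic_majorant hu0 (le_add_of_nonneg_right hd0)
  have hmaj : ∑ i, x i ^ 2 * Real.log (x i ^ 2) ≤
      (u + d) ^ 2 * Real.log ((u + d) ^ 2) + (n - 1) * (u ^ 2 * Real.log (u ^ 2)) := by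
    calc ∑ i, x i ^ 2 * Real.log (x i ^ 2) ≤ ∑ i, (a + b * x i + c * x i ^ 2) :=
          sum_le_sum fun i _ ↦ hle (x i) (hx i) (hxv i)
      _ = n * a + b * s + c * N := by
          simp [sum_add_distrib, ← mul_sum, hn_def, hN, hs]
      _ = _ := by
          rw [hequ, heqv, ← hsum]
          linear_combination -b * hu
  have hmean : ∀ i, x i ^ 2 * Real.log (x i ^ 2 / (N / n)) =
      x i ^ 2 * Real.log (x i ^ 2) - x i ^ 2 * Real.log (N / n) := by
    intro i
    rcases (hx i).eq_or_lt with h | h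
    · simp [← h]
    rw [Real.log_div (by positivity) (by positivity)]
    ring
  have htwo := entropy_two_point_le hn hu0 hv
  rw [hsum] at htwo
  rw [sum_congr rfl fun i _ ↦ hmean i, sum_sub_distrib, ← sum_mul, ← hN]
  have hR : (n - 1) * Real.log (n - 1) / (n - 2) * (u + d - u) ^ 2 =
      n * Real.log (n - 1) / (n - 2) * (N - s ^ 2 / n) := by
    have : N - s ^ 2 / n = (n - 1) * d ^ 2 / n := by
      rw [hdsq]
      field_simp
    rw [this]
    field_simp
    ring
  linarith

theorem log_two_mul_sq_sqrt_sub_sqrt_le {a b : ℝ} (ha : 0 ≤ a) (hb : 0 ≤ b) :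
    Real.log 2 * (√a - √b) ^ 2 ≤
      a * Real.log (a / ((a + b) / 2)) + b * Real.log (b / ((a + b) / 2)) := by
  rcases (add_nonneg ha hb).eq_or_lt with h | hT
  · have h1 : a = 0 := by linarith
    have h2 : b = 0 := by linarith
    simp [h1, h2]
  have hcompl : 1 - a / (a + b) = b / (a + b) := by
    field_simp
    ring
  have hsqrt : √(a / (a + b) * (b / (a + b))) = √a * √b / (a + b) := by
    rw [div_mul_div_comm, Real.sqrt_div (by positivity), Real.sqrt_mul_self hT.le,
      Real.sqrt_mul ha]
  have h := binEntropy_le_log_two_mul_sqrt (P := a / (a + b)) (by positivity)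
    ((div_le_one hT).2 (by linarith))
  rw [Real.binEntropy_eq_negMulLog_add_negMulLog_one_sub, hcompl, hsqrt] at h
  have h := mul_le_mul_of_nonneg_left h hT.le
  have key : ∀ z : ℝ, 0 ≤ z → z * Real.log (z / ((a + b) / 2)) =
      z * Real.log 2 - (a + b) * Real.negMulLog (z / (a + b)) := by
    intro z hz
    rcases hz.eq_or_lt with rfl | hz
    · simp
    rw [Real.negMulLog, Real.log_div hz.ne' (by positivity), Real.log_div hT.ne' two_ne_zero,
      Real.log_div hz.ne' hT.ne']
    field_simp
    ring
  have e : (a + b) * (Real.log 2 * (2 * (√a * √b / (a + b)))) =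
      Real.log 2 * (2 * (√a * √b)) := by
    field_simp
  rw [e] at h
  rw [key a ha, key b hb, sub_sq, Real.sq_sqrt ha, Real.sq_sqrt hb]
  linarith

theorem entEdge_self {α : Type*} (f : α → ℝ) (x : α) : entEdge f x x = 0 := by
  rw [entEdge, add_self_div_two]
  by_cases h : f x = 0 <;> simp [h]

theorem entEdge_comm {α : Type*} (f : α → ℝ) (x y : α) : entEdge f x y = entEdge f y x := by
  rw [entEdge, entEdge, add_comm (f y) (f x), add_comm]

theorem sum_star_entEdge [DecidableEq V] (xstar : V) (c : V → V → ℝ)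
    (hc : ∀ x y, c x y = if x ≠ y ∧ (x = xstar ∨ y = xstar) then 1 else 0) (f : V → ℝ) :
    ∑ x, ∑ y, c x y * entEdge f x y = 2 * ∑ y, entEdge f xstar y := by
  have h : ∀ x y, c x y * entEdge f x y =
      (if x = xstar then entEdge f x y else 0) + (if y = xstar then entEdge f x y else 0) := by
    intro x y
    rw [hc]
    by_cases hxy : x = y
    · subst hxy
      simp [entEdge_self]
    · by_cases hx : x = xstar
      · subst hx
        simp [hxy, Ne.symm hxy]
      · simp [hxy, hx]
  simp only [h, sum_add_distrib, sum_ite_eq', mem_univ, if_true, two_mul]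
  rw [sum_comm]
  simp [fun x ↦ entEdge_comm f x xstar]

theorem log_two_mul_variance_le (xstar : V) {f : V → ℝ} (hf : ∀ x, 0 ≤ f x) :
    Real.log 2 * (∑ x, √(f x) ^ 2 - (∑ x, √(f x)) ^ 2 / Fintype.card V) ≤
      2 * ∑ y, entEdge f xstar y := by
  have hn : 0 < (Fintype.card V : ℝ) := Nat.cast_pos.2 (Fintype.card_pos_iff.2 ⟨xstar⟩)
  have hlog : 0 ≤ Real.log 2 := Real.log_nonneg one_le_two
  calc _ ≤ Real.log 2 * ∑ y, (√(f xstar) - √(f y)) ^ 2 := by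
        gcongr
        simp only [sub_sq, sum_add_distrib, sum_sub_distrib, sum_const, card_univ,
          nsmul_eq_mul, ← mul_sum]
        rw [sub_le_iff_le_add', ← sub_nonneg]
        have : 0 ≤ (Fintype.card V * √(f xstar) - ∑ x, √(f x)) ^ 2 / Fintype.card V := by
          positivity
        refine this.trans_eq ?_
        field_simp
        ring
    _ ≤ 2 * ∑ y, entEdge f xstar y := by
        rw [mul_sum, mul_sum]
        refine sum_le_sum fun y _ ↦ (log_two_mul_sq_sqrt_sub_sqrt_le (hf xstar) (hf y)).trans_eq ?_
        rw [entEdge]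
        ring

theorem Ent_single [DecidableEq V] (y : V) :
    Ent (Pi.single y 1 : V → ℝ) = Real.log (Fintype.card V) / Fintype.card V := by
  rw [Ent, sum_eq_single y (fun x _ hx ↦ by simp [hx]) (by simp)]
  simp
  ring

theorem sum_entEdge_single [DecidableEq V] {xstar y : V} (h : y ≠ xstar) :
    ∑ x, entEdge (Pi.single y 1 : V → ℝ) xstar x = Real.log 2 / 2 := by
  rw [sum_eq_single y (fun x _ hx ↦ by simp [entEdge, hx, h.symm]) (by simp)]
  simp [entEdge, h.symm]
  ring

end Stmt16

open Stmt16 in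
theorem stmt16 {V : Type*} [Fintype V] [DecidableEq V]
    (n : ℕ) (hn : 3 ≤ n) (hcard : Fintype.card V = n)
    (xstar : V) (c : V → V → ℝ)
    (hc : ∀ x y, c x y = if x ≠ y ∧ (x = xstar ∨ y = xstar) then 1 else 0) :
    2 * Real.log 2 * (1 - 2 / (n : ℝ)) / Real.log ((n : ℝ) - 1) ≤ kappaG c
    ∧ kappaG c ≤ 2 * Real.log 2 / Real.log n := by
  subst hcard
  have hn' : 2 < (Fintype.card V : ℝ) := by exact_mod_cast hn
  have hn0 : 0 < (Fintype.card V : ℝ) := by linarith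
  have hn2 : 0 < (Fintype.card V : ℝ) - 2 := by linarith
  have hlog1 : 0 < Real.log ((Fintype.card V : ℝ) - 1) := Real.log_pos (by linarith)
  have hlogn : 0 < Real.log (Fintype.card V) := Real.log_pos (by linarith)
  have hlog2 : 0 < Real.log 2 := Real.log_pos one_lt_two
  have hmem : 2 * Real.log 2 * (1 - 2 / (Fintype.card V : ℝ)) /
      Real.log ((Fintype.card V : ℝ) - 1) ∈ {κ : ℝ | 0 ≤ κ ∧ ∀ f : V → ℝ, (∀ x, 0 ≤ f x) →
        κ * Ent f ≤ (2 / (Fintype.card V : ℝ)) * ∑ x, ∑ y, c x y * entEdge f x y} := by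
    have hfrac : 1 - 2 / (Fintype.card V : ℝ) = (Fintype.card V - 2) / Fintype.card V := by
      field_simp
    rw [hfrac]
    refine ⟨by positivity, fun f hf ↦ ?_⟩
    have hsob := sum_sq_mul_log_le hn' fun x ↦ Real.sqrt_nonneg (f x)
    have hvar := log_two_mul_variance_le xstar hf
    rw [sum_star_entEdge xstar c hc]
    simp only [Real.sq_sqrt (hf _)] at hsob hvar
    rw [Ent]
    calc _ ≤ 2 * Real.log 2 * ((Fintype.card V - 2) / Fintype.card V) /
            Real.log ((Fintype.card V : ℝ) - 1) * (1 / Fintype.card V *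
            (Fintype.card V * Real.log (Fintype.card V - 1) / (Fintype.card V - 2) *
              (∑ x, f x - (∑ x, √(f x)) ^ 2 / Fintype.card V))) := by gcongr
      _ = 2 / Fintype.card V *
            (Real.log 2 * (∑ x, f x - (∑ x, √(f x)) ^ 2 / Fintype.card V)) := by
          field_simp
      _ ≤ _ := by gcongr
  have hbound : ∀ κ ∈ {κ : ℝ | 0 ≤ κ ∧ ∀ f : V → ℝ, (∀ x, 0 ≤ f x) →
      κ * Ent f ≤ (2 / (Fintype.card V : ℝ)) * ∑ x, ∑ y, c x y * entEdge f x y},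
      κ ≤ 2 * Real.log 2 / Real.log (Fintype.card V) := by
    rintro κ ⟨-, hκ⟩
    have : Nontrivial V := Fintype.one_lt_card_iff_nontrivial.1 (by omega)
    obtain ⟨y, hy⟩ := exists_ne xstar
    have h := hκ (Pi.single y 1) fun x ↦ by
      by_cases hx : x = y <;> simp [hx]
    rw [sum_star_entEdge xstar c hc, Ent_single, sum_entEdge_single hy] at h
    rw [le_div_iff₀ hlogn]
    field_simp at h
    linarith
  exact ⟨le_csSup ⟨_, hbound⟩ hmem, csSup_le ⟨_, hmem⟩ hbound⟩
end

section
/- Let G be a weighted graph on a finite vertex set V with |V| = n ≥ 3, with symmetric nonnegative weights c_{xy}, and suppose x ∈ V is a leaf of G, i.e., there is exactly one y ∈ V with c_{xy} > 0. Then the entropy constant is monotone under removal of the leaf: κ(G_x) ≥ κ(G), where G_x is the weighted graph on V∖{x} obtained by restricting the weights of G (equivalently, the electric network reduction of G at the leaf x). -/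
open Finset

namespace Stmt18

variable {W : Type*} [Fintype W]

/-- Relative entropy of `f` w.r.t. the uniform distribution. -/
noncomputable def Ent (f : W → ℝ) : ℝ :=
  (1 / (Fintype.card W : ℝ)) *
    ∑ x, f x * Real.log (f x / ((∑ y, f y) / (Fintype.card W : ℝ)))

/-- The local entropy `ent_{xy} f`. -/
noncomputable def entEdge (f : W → ℝ) (x y : W) : ℝ :=
  (1 / 2) * f x * Real.log (f x / ((f x + f y) / 2)) +
    (1 / 2) * f y * Real.log (f y / ((f x + f y) / 2))

/-- The entropy constant `κ(G)` of the weighted graph with weights `c`. -/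
noncomputable def kappaG (c : W → W → ℝ) : ℝ :=
  sSup {κ : ℝ | 0 ≤ κ ∧ ∀ f : W → ℝ, (∀ x, 0 ≤ f x) →
    κ * Ent f ≤ (2 / (Fintype.card W : ℝ)) * ∑ x, ∑ y, c x y * entEdge f x y}

/-- The graph obtained from `G` by deleting the vertex `x` (restriction of the weights;
for a leaf `x` this is the electric network reduction at `x`). -/
def restrictedWeights {V : Type*} [Fintype V] [DecidableEq V]
    (c : V → V → ℝ) (x : V) : {y : V // y ≠ x} → {y : V // y ≠ x} → ℝ :=
  fun y z => c y.1 z.1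

lemma sub_le_mul_log_div {a b : ℝ} (ha : 0 ≤ a) (hb : 0 < b) :
    a - b ≤ a * Real.log (a / b) := by
  rcases ha.eq_or_lt with rfl | ha
  · simp [hb.le]
  have h := mul_le_mul_of_nonneg_left (Real.one_sub_inv_le_log_of_pos (div_pos ha hb)) ha.le
  have h' : a * (1 - (a / b)⁻¹) = a - b := by field_simp
  rwa [h'] at h

lemma entEdge_of_eq {W : Type*} {f : W → ℝ} {x y : W} (h : f x = f y) : entEdge f x y = 0 := by
  by_cases h0 : f y = 0 <;> simp [entEdge, h, h0]

lemma entEdge_comm {W : Type*} (f : W → ℝ) (x y : W) : entEdge f x y = entEdge f y x := by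
  simp only [entEdge, add_comm (f y) (f x)]
  ring

lemma card_mul_Ent {W : Type*} [Fintype W] [Nonempty W] (f : W → ℝ) :
    (Fintype.card W : ℝ) * Ent f =
      ∑ x, f x * Real.log (f x / ((∑ y, f y) / (Fintype.card W : ℝ))) := by
  have : (Fintype.card W : ℝ) ≠ 0 := by exact_mod_cast Fintype.card_ne_zero
  rw [Ent]
  field_simp

/-- The unnormalised entropy does not decrease when a point is added to the space. -/
lemma card_mul_Ent_subtype_le {V : Type*} [Fintype V] [DecidableEq V] (x : V)
    [Nonempty {y : V // y ≠ x}] (f : V → ℝ) (hf : ∀ y, 0 ≤ f y) :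
    (Fintype.card {y : V // y ≠ x} : ℝ) * Ent (fun y : {y : V // y ≠ x} => f y) ≤
      (Fintype.card V : ℝ) * Ent f := by
  have : Nonempty V := ⟨x⟩
  have hcard : (Fintype.card V : ℝ) = Fintype.card {y : V // y ≠ x} + 1 := by
    have := Fintype.card_subtype_compl (fun y => y = x)
    have h1 : 0 < Fintype.card V := Fintype.card_pos
    rw [Fintype.card_subtype_eq] at this
    have h2 : Fintype.card V = Fintype.card {y : V // y ≠ x} + 1 := by
      simp only [ne_eq]; omega
    exact_mod_cast h2
  rw [card_mul_Ent, card_mul_Ent, hcard, Fintype.sum_eq_add_sum_subtype_ne _ x,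
    Fintype.sum_eq_add_sum_subtype_ne f x]
  have hm : (0 : ℝ) < Fintype.card {y : V // y ≠ x} := by exact_mod_cast Fintype.card_pos
  generalize (Fintype.card {y : V // y ≠ x} : ℝ) = m at hm
  have hS0 : 0 ≤ ∑ y : {y : V // y ≠ x}, f y := Finset.sum_nonneg fun y _ => hf y
  rcases hS0.eq_or_lt with hS | hS
  · have hz : ∀ y : {y : V // y ≠ x}, f y = 0 := fun y =>
      congrFun ((Fintype.sum_eq_zero_iff_of_nonneg
        (f := fun y : {y : V // y ≠ x} => f y) fun y => hf y).1 hS.symm) y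
    simp only [hz, zero_mul, Finset.sum_const_zero, add_zero]
    rcases (hf x).eq_or_lt with h | h
    · simp [← h]
    · refine mul_nonneg h.le (Real.log_nonneg ?_)
      rw [div_div_eq_mul_div, le_div_iff₀ h]
      nlinarith
  · set S := ∑ y : {y : V // y ≠ x}, f y with hSdef
    have hb : 0 < (f x + S) / (m + 1) := by have := hf x; positivity
    have ha : 0 < S / m := by positivity
    set b := (f x + S) / (m + 1) with hbdef
    have hsplit : ∀ y : {y : V // y ≠ x}, f y * Real.log (f y / b) =
        f y * Real.log (f y / (S / m)) + f y * Real.log (S / m / b) := by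
      intro y
      by_cases h : f y = 0
      · simp [h]
      · rw [Real.log_div h hb.ne', Real.log_div h ha.ne', Real.log_div ha.ne' hb.ne']
        ring
    rw [Finset.sum_congr rfl fun y _ => hsplit y, Finset.sum_add_distrib, ← Finset.sum_mul, ← hSdef]
    have h1 := sub_le_mul_log_div (hf x) hb
    have h2 := mul_le_mul_of_nonneg_left (sub_le_mul_log_div ha.le hb) hm.le
    have h3 : m * (S / m * Real.log (S / m / b)) = S * Real.log (S / m / b) := by field_simp
    have h4 : m * (S / m - b) = S - m * b := by field_simp
    have h5 : (m + 1) * b = f x + S := by rw [hbdef]; field_simp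
    linarith

lemma bddAbove_kappaG_set {W : Type*} [Fintype W] (hW : 1 < Fintype.card W) (c : W → W → ℝ) :
    BddAbove {κ : ℝ | 0 ≤ κ ∧ ∀ f : W → ℝ, (∀ x, 0 ≤ f x) →
      κ * Ent f ≤ (2 / (Fintype.card W : ℝ)) * ∑ x, ∑ y, c x y * entEdge f x y} := by
  classical
  obtain ⟨w⟩ : Nonempty W := Fintype.card_pos_iff.1 (by omega)
  set f : W → ℝ := fun z => if z = w then 1 else 0 with hf
  have hcard : (1 : ℝ) < Fintype.card W := by exact_mod_cast hW
  have hEnt : 0 < Ent f := by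
    have : 0 < Real.log (Fintype.card W : ℝ) := Real.log_pos hcard
    simp only [Ent, hf, ite_mul, one_mul, zero_mul, Finset.sum_ite_eq', mem_univ, if_true,
      one_div_one_div]
    positivity
  refine ⟨_, fun κ hκ => (le_div_iff₀ hEnt).2 (hκ.2 f fun z => ?_)⟩
  simp only [hf]
  split_ifs <;> norm_num

lemma sum_eq_sum_restrictedWeights {V : Type*} [Fintype V] [DecidableEq V]
    (c : V → V → ℝ) (hsymm : ∀ x y, c x y = c y x) (x : V) (f : V → ℝ)
    (h : ∀ z, c x z * entEdge f x z = 0) :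
    ∑ u, ∑ v, c u v * entEdge f u v =
      ∑ u, ∑ v, restrictedWeights c x u v *
        entEdge (fun y : {y : V // y ≠ x} => f y) u v := by
  have h' : ∀ z, c z x * entEdge f z x = 0 := fun z => by rw [hsymm, entEdge_comm, h]
  rw [Fintype.sum_eq_add_sum_subtype_ne _ x, Finset.sum_eq_zero fun z _ => h z, zero_add]
  refine Finset.sum_congr rfl fun u _ => ?_
  rw [Fintype.sum_eq_add_sum_subtype_ne _ x, h', zero_add]
  rfl

/-- A function on the complement of a leaf extends to the leaf without local entropy there. -/
lemma exists_extension {V : Type*} [DecidableEq V] (c : V → V → ℝ) (hpos : ∀ x y, 0 ≤ c x y)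
    (x : V) (hleaf : ∃! y : V, 0 < c x y) (f : {y : V // y ≠ x} → ℝ) (hf : ∀ y, 0 ≤ f y) :
    ∃ g : V → ℝ, (∀ y, 0 ≤ g y) ∧ (fun y : {y : V // y ≠ x} => g y) = f ∧
      ∀ z, c x z * entEdge g x z = 0 := by
  obtain ⟨y, -, hy⟩ := hleaf
  set v : ℝ := if h : y ≠ x then f ⟨y, h⟩ else 0 with hv
  have hv0 : 0 ≤ v := by rw [hv]; split_ifs <;> simp [hf]
  refine ⟨fun z => if h : z ≠ x then f ⟨z, h⟩ else v, fun z => ?_, ?_, fun z => ?_⟩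
  · dsimp only
    split_ifs
    exacts [hf _, hv0]
  · funext z
    simp [z.2]
  · by_cases hz : 0 < c x z
    · obtain rfl := hy z hz
      rw [entEdge_of_eq, mul_zero]
      by_cases h : z = x <;> simp [hv, h]
    · rw [le_antisymm (not_lt.1 hz) (hpos x z), zero_mul]

end Stmt18

open Stmt18 in
theorem stmt18 {V : Type*} [Fintype V] [DecidableEq V]
    (n : ℕ) (hn : 3 ≤ n) (hcard : Fintype.card V = n)
    (c : V → V → ℝ) (hsymm : ∀ x y, c x y = c y x) (hpos : ∀ x y, 0 ≤ c x y)
    (x : V) (hleaf : ∃! y : V, 0 < c x y) :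
    kappaG c ≤ kappaG (restrictedWeights c x) := by
  classical
  have hm : 1 < Fintype.card {y : V // y ≠ x} := by
    have := Fintype.card_subtype_compl (fun y => y = x)
    rw [Fintype.card_subtype_eq] at this
    simp only [ne_eq]
    omega
  have : Nonempty {y : V // y ≠ x} := Fintype.card_pos_iff.1 (by omega)
  have : Nonempty V := ⟨x⟩
  refine Real.sSup_le (fun κ hκ => le_csSup (bddAbove_kappaG_set hm _) ⟨hκ.1, fun f hf => ?_⟩)
    (Real.sSup_nonneg fun κ hκ => hκ.1)
  obtain ⟨g, hg0, rfl, hgx⟩ := exists_extension c hpos x hleaf f hf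
  have h1 := hκ.2 g hg0
  rw [sum_eq_sum_restrictedWeights c hsymm x g hgx] at h1
  have h2 := mul_le_mul_of_nonneg_left (card_mul_Ent_subtype_le x g hg0) hκ.1
  have hn0 : (0 : ℝ) < Fintype.card V := by exact_mod_cast Fintype.card_pos
  have hm0 : (0 : ℝ) < Fintype.card {y : V // y ≠ x} := by exact_mod_cast Fintype.card_pos
  rw [div_mul_eq_mul_div, le_div_iff₀ hn0] at h1
  rw [div_mul_eq_mul_div, le_div_iff₀ hm0]
  linarith
end

section
/- Let n ≥ 2 and let α be the star interchange weights on V, |V| = n, with center x_*: α_A = 2 if A = {x_*, y} for some y ≠ x_*, and α_A = 0 otherwise. Then the entropy constant of the corresponding interchange process on permutations satisfies (log 2)²/log n ≤ κ[α,S_n] ≤ 2·log 2/log n. -/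
open Finset

namespace Stmt19

variable {V : Type*} [Fintype V] [DecidableEq V]

/-- The permutations agreeing with `σ` outside the block `A`. -/
def permFiber (A : Finset V) (σ : Equiv.Perm V) : Finset (Equiv.Perm V) :=
  Finset.univ.filter (fun τ => ∀ z ∉ A, τ z = σ z)

/-- The conditional expectation `μ_A f` given the labels outside `A`. -/
noncomputable def condExp (A : Finset V) (f : Equiv.Perm V → ℝ) (σ : Equiv.Perm V) : ℝ :=
  (∑ τ ∈ permFiber A σ, f τ) / ((permFiber A σ).card : ℝ)

/-- The conditional entropy `Ent_A f = μ_A[f log (f / μ_A f)]`. -/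
noncomputable def EntA (A : Finset V) (f : Equiv.Perm V → ℝ) (σ : Equiv.Perm V) : ℝ :=
  (∑ τ ∈ permFiber A σ, f τ * Real.log (f τ / condExp A f σ)) / ((permFiber A σ).card : ℝ)

/-- Expectation w.r.t. the uniform distribution `μ` on the symmetric group. -/
noncomputable def mean (f : Equiv.Perm V → ℝ) : ℝ :=
  (∑ σ : Equiv.Perm V, f σ) / (Fintype.card (Equiv.Perm V) : ℝ)

/-- The global entropy `Ent f = μ[f log (f / μ f)]`. -/
noncomputable def Ent (f : Equiv.Perm V → ℝ) : ℝ :=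
  mean (fun σ => f σ * Real.log (f σ / mean f))

/-- The entropy constant `κ[α, S_n]` of the `α`-shuffle process on permutations. -/
noncomputable def kappaPerm (α : Finset V → ℝ) : ℝ :=
  sSup {κ : ℝ | 0 ≤ κ ∧ ∀ f : Equiv.Perm V → ℝ, (∀ σ, 0 ≤ f σ) →
    κ * Ent f ≤ ∑ A : Finset V, α A * mean (EntA A f)}

end Stmt19

theorem exp_four_lt : Real.exp 4 < 54.6 := by
  have h := Real.exp_one_lt_d9
  have h0 := Real.exp_pos 1
  have : Real.exp 4 = Real.exp 1 ^ 4 := by rw [← Real.exp_nat_mul]; norm_num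
  rw [this]
  calc Real.exp 1 ^ 4 < 2.7182818286 ^ 4 := by gcongr
    _ < 54.6 := by norm_num

theorem two_add_div_le_log (w : ℝ) :
    2 + 44 * (1 + w) / (44 + 5 * w ^ 2) ≤ Real.log (44 + 5 * w ^ 2) := by
  have hx : 0 < 44 + 5 * w ^ 2 := by positivity
  have h1 := Real.one_sub_inv_le_log_of_pos (div_pos hx (Real.exp_pos 4))
  rw [Real.log_div hx.ne' (Real.exp_pos 4).ne', Real.log_exp, inv_div] at h1
  have h2 := exp_four_lt
  have h3 : 44 * (1 + w) / (44 + 5 * w ^ 2) + Real.exp 4 / (44 + 5 * w ^ 2) ≤ 3 := by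
    rw [← add_div, div_le_iff₀ hx]
    nlinarith [sq_nonneg (w - 22 / 15)]
  linarith

/-- The gap in `two_mul_sq_mul_log_le`, divided by `(1 + w) ^ 2`. -/
noncomputable def sqLogGap (w : ℝ) : ℝ :=
  (w ^ 2 * Real.log (44 + 5 * w ^ 2) + 2 * w) / (1 + w) ^ 2 - 2 * Real.log (1 + w)

theorem hasDerivAt_sqLogGap {w : ℝ} (hw : -1 < w) :
    HasDerivAt sqLogGap (2 * w / (1 + w) ^ 3 *
      (Real.log (44 + 5 * w ^ 2) - 2 - 44 * (1 + w) / (44 + 5 * w ^ 2))) w := by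
  have hx : 44 + 5 * w ^ 2 ≠ 0 := by positivity
  have h1w : 1 + w ≠ 0 := by linarith
  have hsq : HasDerivAt (fun w : ℝ => w ^ 2) (2 * w) w := by
    simpa using hasDerivAt_pow 2 w
  have h1 : HasDerivAt (fun w : ℝ => Real.log (44 + 5 * w ^ 2))
      ((5 * (2 * w)) / (44 + 5 * w ^ 2)) w :=
    ((hsq.const_mul 5).const_add 44).log hx
  have h2 : HasDerivAt (fun w : ℝ => 1 + w) 1 w := (hasDerivAt_id w).const_add 1
  have h3 := h2.log h1w
  have h4 := ((hsq.mul h1).add ((hasDerivAt_id w).const_mul 2)).div (h2.pow 2) (pow_ne_zero 2 h1w)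
  have h5 := h4.sub (h3.const_mul 2)
  refine h5.congr_deriv ?_
  simp only [Pi.add_apply, Pi.mul_apply, Pi.pow_apply, id]
  field_simp
  ring

/-- Pointwise bound behind the log-Sobolev inequality on the complete graph. -/
theorem two_mul_sq_mul_log_le {w : ℝ} (hw : -1 ≤ w) :
    2 * (1 + w) ^ 2 * Real.log (1 + w) ≤ 2 * w + w ^ 2 * Real.log (44 + 5 * w ^ 2) := by
  rcases hw.eq_or_lt with rfl | hw
  · have h : (2 : ℝ) ≤ Real.log 49 := by
      have := two_add_div_le_log (-1)
      norm_num at this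
      exact this
    norm_num
    exact h
  · have key : 0 ≤ sqLogGap w := by
      have h0 : sqLogGap 0 = 0 := by simp [sqLogGap]
      have hcont : ∀ s : Set ℝ, s ⊆ Set.Ioi (-1) → ContinuousOn sqLogGap s := fun s hs x hx =>
        (hasDerivAt_sqLogGap (hs hx)).continuousAt.continuousWithinAt
      rcases le_total 0 w with h | h
      · have : MonotoneOn sqLogGap (Set.Icc 0 w) := by
          refine monotoneOn_of_deriv_nonneg (convex_Icc _ _)
            (hcont _ fun x hx => lt_of_lt_of_le (by norm_num) hx.1) ?_ ?_
          · intro x hx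
            rw [interior_Icc] at hx
            exact (hasDerivAt_sqLogGap (by linarith [hx.1])).differentiableAt.differentiableWithinAt
          · intro x hx
            rw [interior_Icc] at hx
            rw [(hasDerivAt_sqLogGap (by linarith [hx.1])).deriv]
            have := two_add_div_le_log x
            have h1 : 0 < 1 + x := by linarith [hx.1]
            have h2 := hx.1.le
            exact mul_nonneg (by positivity) (by linarith)
        rw [← h0]
        exact this ⟨le_rfl, h⟩ ⟨h, le_rfl⟩ h
      · have : AntitoneOn sqLogGap (Set.Icc w 0) := by
          refine antitoneOn_of_deriv_nonpos (convex_Icc _ _)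
            (hcont _ fun x hx => lt_of_lt_of_le hw hx.1) ?_ ?_
          · intro x hx
            rw [interior_Icc] at hx
            exact (hasDerivAt_sqLogGap (by linarith [hx.1])).differentiableAt.differentiableWithinAt
          · intro x hx
            rw [interior_Icc] at hx
            rw [(hasDerivAt_sqLogGap (by linarith [hx.1])).deriv]
            have := two_add_div_le_log x
            have h1 : 0 < 1 + x := by linarith [hx.1]
            refine mul_nonpos_of_nonpos_of_nonneg ?_ (by linarith)
            exact div_nonpos_of_nonpos_of_nonneg (by linarith [hx.2]) (by positivity)
        rw [← h0]
        exact this ⟨le_rfl, h⟩ ⟨h, le_rfl⟩ h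
    have h1 : 0 < 1 + w := by linarith
    unfold sqLogGap at key
    rw [sub_nonneg, le_div_iff₀ (by positivity)] at key
    linarith

theorem two_mul_sub_one_div_le_log {y : ℝ} (hy : 1 ≤ y) : 2 * (y - 1) / (y + 1) ≤ Real.log y := by
  have := Real.le_log_one_add_of_nonneg (sub_nonneg.2 hy)
  convert this using 2 <;> ring

theorem mul_log_add_le_one_add_mul_log {v : ℝ} (hv : 0 ≤ v) :
    v * Real.log (176 / 65 + v) ≤ (1 + v) * Real.log (1 + v) := by
  have h1 : 0 < 1 + v := by linarith
  have hq : 0 < 176 / 65 + v := by linarith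
  have hlog := two_mul_sub_one_div_le_log (show 1 ≤ 1 + v by linarith)
  have tangent : ∀ c : ℝ, Real.log (176 / 65 + v) ≤
      Real.log (1 + v) + c + (176 / 65 + v) / (1 + v) * Real.exp (-c) - 1 := by
    intro c
    have h := Real.log_le_sub_one_of_pos
      (mul_pos (div_pos hq h1) (Real.exp_pos (-c)))
    rw [Real.log_mul (div_pos hq h1).ne' (Real.exp_pos _).ne', Real.log_div hq.ne' h1.ne',
      Real.log_exp] at h
    linarith
  suffices h : ∃ c, c + (176 / 65 + v) / (1 + v) * Real.exp (-c) - 1 ≤ 2 / (v + 2) by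
    obtain ⟨c, hc⟩ := h
    have h2 := mul_le_mul_of_nonneg_left (tangent c) hv
    have h3 := mul_le_mul_of_nonneg_left hc hv
    have h4 : v * (2 / (v + 2)) = 2 * (1 + v - 1) / (1 + v + 1) := by
      have : v + 2 ≠ 0 := by linarith
      have : 1 + v + 1 ≠ 0 := by linarith
      field_simp
      ring
    nlinarith
  have he1 := Real.exp_one_gt_d9
  have bound : ∀ c r : ℝ, Real.exp (-c) ≤ r →
      (c - 1) * ((1 + v) * (v + 2)) + (176 / 65 + v) * r * (v + 2) ≤ 2 * (1 + v) →
      ∃ c, c + (176 / 65 + v) / (1 + v) * Real.exp (-c) - 1 ≤ 2 / (v + 2) := by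
    intro c r hr h
    refine ⟨c, ?_⟩
    have : (176 / 65 + v) / (1 + v) * Real.exp (-c) ≤ (176 / 65 + v) / (1 + v) * r := by gcongr
    refine le_trans (sub_le_sub_right (add_le_add_right this c) 1) ?_
    rw [le_div_iff₀ (by linarith), ← sub_nonneg]
    have h5 : 2 - (c + (176 / 65 + v) / (1 + v) * r - 1) * (v + 2)
      = (2 * (1 + v) - ((c - 1) * ((1 + v) * (v + 2)) + (176 / 65 + v) * r * (v + 2)))
        / (1 + v) := by
      field_simp
      ring
    rw [h5]
    exact div_nonneg (by linarith) h1.le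
  have hinv : Real.exp (-1) ≤ 0.36788 := by
    rw [Real.exp_neg, inv_le_comm₀ (Real.exp_pos 1) (by norm_num)]
    norm_num at he1 ⊢
    linarith
  rcases le_total v 0.6 with hva | hva
  · exact bound 1 0.36788 hinv (by nlinarith)
  rcases le_total v 5.3 with hvb | hvb
  · refine bound (1 / 2) 0.6066 ?_ (by nlinarith)
    have h6 : Real.exp (-(1 / 2)) ^ 2 = Real.exp (-1) := by
      rw [← Real.exp_nat_mul]; norm_num
    nlinarith [Real.exp_pos (-(1 / 2))]
  · exact bound 0 1 (by simp) (by nlinarith)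

/-- The gap in `le_pairEnt` for the values `1 + t` and `1 - t`, up to the factor `2`. -/
noncomputable def entGap (t : ℝ) : ℝ :=
  (1 + t) * Real.log (1 + t) + (1 - t) * Real.log (1 - t)
    + 2 * Real.log 2 * √(1 - t ^ 2) - 2 * Real.log 2

theorem continuous_entGap : Continuous entGap := by
  have h := Real.continuous_mul_log
  have h1 : Continuous fun t : ℝ => (1 + t) * Real.log (1 + t) := h.comp (by fun_prop)
  have h2 : Continuous fun t : ℝ => (1 - t) * Real.log (1 - t) := h.comp (by fun_prop)
  unfold entGap
  fun_prop

theorem hasDerivAt_sqrt_one_sub_sq {t : ℝ} (h0 : -1 < t) (h1 : t < 1) :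
    HasDerivAt (fun t : ℝ => √(1 - t ^ 2)) (-(t / √(1 - t ^ 2))) t := by
  have hpos : 0 < 1 - t ^ 2 := by nlinarith
  have h := ((hasDerivAt_pow 2 t).const_sub 1).sqrt hpos.ne'
  refine h.congr_deriv ?_
  simp
  field_simp

theorem hasDerivAt_entGap {t : ℝ} (h0 : -1 < t) (h1 : t < 1) :
    HasDerivAt entGap (Real.log (1 + t) - Real.log (1 - t)
      - 2 * Real.log 2 * (t / √(1 - t ^ 2))) t := by
  have ha : 1 + t ≠ 0 := by linarith
  have hb : 1 - t ≠ 0 := by linarith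
  have d1 : HasDerivAt (fun t : ℝ => 1 + t) 1 t := (hasDerivAt_id t).const_add 1
  have d2 : HasDerivAt (fun t : ℝ => 1 - t) (-1) t := (hasDerivAt_id t).const_sub 1
  have d := (((d1.mul (d1.log ha)).add (d2.mul (d2.log hb))).add
    ((hasDerivAt_sqrt_one_sub_sq h0 h1).const_mul (2 * Real.log 2))).sub_const (2 * Real.log 2)
  refine d.congr_deriv ?_
  field_simp
  ring

theorem hasDerivAt_deriv_entGap {t : ℝ} (h0 : -1 < t) (h1 : t < 1) :
    HasDerivAt (fun t : ℝ => Real.log (1 + t) - Real.log (1 - t)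
      - 2 * Real.log 2 * (t / √(1 - t ^ 2)))
      (2 / (1 - t ^ 2) * (1 - Real.log 2 / √(1 - t ^ 2))) t := by
  have ha : 1 + t ≠ 0 := by linarith
  have hb : 1 - t ≠ 0 := by linarith
  have hpos : 0 < 1 - t ^ 2 := by nlinarith
  have hs : √(1 - t ^ 2) ≠ 0 := (Real.sqrt_pos.2 hpos).ne'
  have hsq : √(1 - t ^ 2) ^ 2 = 1 - t ^ 2 := Real.sq_sqrt hpos.le
  have d1 : HasDerivAt (fun t : ℝ => 1 + t) 1 t := (hasDerivAt_id t).const_add 1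
  have d2 : HasDerivAt (fun t : ℝ => 1 - t) (-1) t := (hasDerivAt_id t).const_sub 1
  have d := ((d1.log ha).sub (d2.log hb)).sub
    (((hasDerivAt_id t).div (hasDerivAt_sqrt_one_sub_sq h0 h1) hs).const_mul (2 * Real.log 2))
  refine d.congr_deriv ?_
  have e1 : 1 / (1 + t) - -1 / (1 - t) = 2 / (1 - t ^ 2) := by
    have : 1 - t ^ 2 ≠ 0 := hpos.ne'
    field_simp
    ring
  simp only [id]
  rw [e1, hsq]
  have e2 : 1 * √(1 - t ^ 2) - t * -(t / √(1 - t ^ 2)) = 1 / √(1 - t ^ 2) := by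
    field_simp
    rw [hsq]
    ring
  rw [e2]
  have : 1 - t ^ 2 ≠ 0 := hpos.ne'
  field_simp

theorem entGap_nonneg {t : ℝ} (h0 : 0 ≤ t) (h1 : t ≤ 1) : 0 ≤ entGap t := by
  have l1 := Real.log_two_gt_d9
  have l2 := Real.log_two_lt_d9
  set t₁ : ℝ := √(1 - Real.log 2 ^ 2) with ht₁
  have hnn : 0 ≤ 1 - Real.log 2 ^ 2 := by nlinarith
  have ht₁sq : t₁ ^ 2 = 1 - Real.log 2 ^ 2 := Real.sq_sqrt hnn
  have ht₁0 : 0 ≤ t₁ := Real.sqrt_nonneg _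
  have ht₁1 : t₁ < 1 := by nlinarith
  have gap_zero : entGap 0 = 0 := by simp [entGap]
  have gap_one : entGap 1 = 0 := by norm_num [entGap]
  have left : ∀ t, 0 ≤ t → t ≤ t₁ → 0 ≤ entGap t := by
    intro t ht ht'
    have : MonotoneOn entGap (Set.Icc 0 t₁) := by
      refine monotoneOn_of_deriv_nonneg (convex_Icc _ _) continuous_entGap.continuousOn ?_ ?_
      · intro x hx
        rw [interior_Icc] at hx
        exact (hasDerivAt_entGap (by linarith [hx.1]) (by linarith [hx.2])).differentiableAt
          |>.differentiableWithinAt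
      · intro x hx
        rw [interior_Icc] at hx
        have hx0 := hx.1
        have hx1 : x < 1 := hx.2.trans ht₁1
        rw [(hasDerivAt_entGap (by linarith) hx1).deriv]
        have hs : Real.log 2 ≤ √(1 - x ^ 2) := by
          apply Real.le_sqrt_of_sq_le
          nlinarith [hx.2]
        have hspos : 0 < √(1 - x ^ 2) := by linarith
        have b1 : Real.log 2 * (x / √(1 - x ^ 2)) ≤ x := by
          rw [mul_div_assoc', div_le_iff₀ hspos]
          nlinarith
        have b2 := Real.hasSum_log_sub_log_of_abs_lt_one (abs_lt.2 ⟨by linarith, hx1⟩)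
        have b3 : 2 * x ≤ Real.log (1 + x) - Real.log (1 - x) := by
          have := le_hasSum b2 0 (fun k _ => by positivity)
          simpa using this
        linarith
    rw [← gap_zero]
    exact this ⟨le_rfl, ht₁0⟩ ⟨ht, ht'⟩ ht
  rcases le_total t t₁ with h | h
  · exact left t h0 h
  · have conc : ConcaveOn ℝ (Set.Icc t₁ 1) entGap := by
      refine concaveOn_of_hasDerivWithinAt2_nonpos (convex_Icc _ _)
        continuous_entGap.continuousOn
        (f' := fun t : ℝ => Real.log (1 + t) - Real.log (1 - t)
          - 2 * Real.log 2 * (t / √(1 - t ^ 2)))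
        (f'' := fun t => 2 / (1 - t ^ 2) * (1 - Real.log 2 / √(1 - t ^ 2))) ?_ ?_ ?_
      · intro x hx
        rw [interior_Icc] at hx
        exact (hasDerivAt_entGap (by linarith [hx.1]) hx.2).hasDerivWithinAt
      · intro x hx
        rw [interior_Icc] at hx
        exact (hasDerivAt_deriv_entGap (by linarith [hx.1]) hx.2).hasDerivWithinAt
      · intro x hx
        rw [interior_Icc] at hx
        have hx0 : 0 ≤ x := ht₁0.trans hx.1.le
        have hpos : 0 < 1 - x ^ 2 := by nlinarith [hx.2]
        refine mul_nonpos_of_nonneg_of_nonpos (by positivity) ?_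
        have : √(1 - x ^ 2) ≤ Real.log 2 := by
          rw [Real.sqrt_le_left (by linarith)]
          nlinarith [hx.1]
        rw [sub_nonpos, le_div_iff₀ (Real.sqrt_pos.2 hpos)]
        linarith
    have := conc.min_le_of_mem_Icc ⟨le_rfl, ht₁1.le⟩ ⟨ht₁1.le, le_rfl⟩ ⟨h, h1⟩
    rw [gap_one] at this
    exact (le_min (left t₁ ht₁0 le_rfl) le_rfl).trans this

/-- Entropy of the function with values `a`, `b` on a fair two-point space. -/
noncomputable def pairEnt (a b : ℝ) : ℝ :=
  (a * Real.log (a / ((a + b) / 2)) + b * Real.log (b / ((a + b) / 2))) / 2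

theorem pairEnt_comm (a b : ℝ) : pairEnt a b = pairEnt b a := by
  unfold pairEnt
  rw [add_comm b a]
  ring

/-- Comparison of the entropy on two points with the square-root Dirichlet form. -/
theorem le_pairEnt {a b : ℝ} (ha : 0 ≤ a) (hb : 0 ≤ b) :
    Real.log 2 / 2 * (√a - √b) ^ 2 ≤ pairEnt a b := by
  wlog hab : b ≤ a generalizing a b
  · rw [pairEnt_comm, ← neg_sub, neg_sq]
    exact this hb ha (le_of_not_ge hab)
  rcases ha.eq_or_lt with rfl | ha
  · obtain rfl : b = 0 := le_antisymm hab hb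
    simp [pairEnt]
  set s := (a + b) / 2 with hs
  have hs0 : 0 < s := by linarith
  set t := (a - b) / (a + b) with ht
  have hne : a + b ≠ 0 := by linarith
  have e1 : a = s * (1 + t) := by rw [hs, ht]; field_simp; ring
  have e2 : b = s * (1 - t) := by rw [hs, ht]; field_simp; ring
  have t0 : 0 ≤ t := div_nonneg (by linarith) (by linarith)
  have t1 : t ≤ 1 := by rw [ht, div_le_one (by linarith)]; linarith
  have h := entGap_nonneg t0 t1
  have hdiva : a / s = 1 + t := by rw [e1]; field_simp
  have hdivb : b / s = 1 - t := by rw [e2]; field_simp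
  have hsqrt : √a * √b = s * √(1 - t ^ 2) := by
    rw [← Real.sqrt_mul ha.le, e1, e2]
    rw [show s * (1 + t) * (s * (1 - t)) = s ^ 2 * (1 - t ^ 2) by ring,
      Real.sqrt_mul (sq_nonneg s), Real.sqrt_sq hs0.le]
  have hexp : (√a - √b) ^ 2 = 2 * s - 2 * (s * √(1 - t ^ 2)) := by
    rw [sub_sq, Real.sq_sqrt ha.le, Real.sq_sqrt hb, ← hsqrt, hs]
    ring
  rw [hexp]
  unfold pairEnt
  rw [← hs, hdiva, hdivb, e1, e2]
  unfold entGap at h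
  have := mul_nonneg hs0.le h
  nlinarith

theorem sq_le_card_sub_one_mul {ι : Type*} [DecidableEq ι] {A : Finset ι} {w : ι → ℝ}
    (h0 : ∑ y ∈ A, w y = 0) {y : ι} (hy : y ∈ A) :
    #A * w y ^ 2 ≤ (#A - 1) * ∑ z ∈ A, w z ^ 2 := by
  have h1 := add_sum_erase A w hy
  have h2 := add_sum_erase A (fun z => w z ^ 2) hy
  have h3 := sq_sum_le_card_mul_sum_sq (s := A.erase y) (f := w)
  have h4 : ((#(A.erase y) : ℕ) : ℝ) = #A - 1 := by
    rw [card_erase_of_mem hy, Nat.cast_sub (card_pos.2 ⟨y, hy⟩)]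
    simp
  have h5 : ∑ z ∈ A.erase y, w z = -w y := by linarith
  rw [h4, h5] at h3
  rw [← h2]
  nlinarith

/-- Log-Sobolev inequality on the complete graph for a function `1 + w` of mean one. -/
theorem sum_one_add_sq_mul_log_le {ι : Type*} {A : Finset ι} {w : ι → ℝ} {L : ℝ}
    (hA : A.Nonempty) (hw : ∀ y ∈ A, -1 ≤ w y) (h0 : ∑ y ∈ A, w y = 0)
    (hL : 65 / 4 ≤ L) (hL' : 5 * ((#A : ℝ) - 1) ≤ L) :
    ∑ y ∈ A, (1 + w y) ^ 2 * Real.log ((1 + w y) ^ 2 / (1 + (∑ z ∈ A, w z ^ 2) / #A))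
      ≤ Real.log L * ∑ y ∈ A, w y ^ 2 := by
  classical
  have hk : (0 : ℝ) < #A := by exact_mod_cast card_pos.2 hA
  set v := (∑ z ∈ A, w z ^ 2) / #A with hv
  have hv0 : 0 ≤ v := div_nonneg (sum_nonneg fun _ _ => sq_nonneg _) hk.le
  have hsum : ∑ z ∈ A, w z ^ 2 = #A * v := by rw [hv]; field_simp
  have hk1 : (1 : ℝ) ≤ #A := by exact_mod_cast card_pos.2 hA
  have hX : 0 < 44 + 5 * ((#A - 1) * v) := by
    have := mul_nonneg (sub_nonneg.2 hk1) hv0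
    linarith
  have point : ∀ y ∈ A,
      (1 + w y) ^ 2 * Real.log ((1 + w y) ^ 2 / (1 + v)) ≤
        2 * w y + w y ^ 2 * Real.log (44 + 5 * ((#A - 1) * v))
          - (1 + 2 * w y + w y ^ 2) * Real.log (1 + v) := by
    intro y hy
    have e : (1 + w y) ^ 2 * Real.log ((1 + w y) ^ 2 / (1 + v)) =
        2 * (1 + w y) ^ 2 * Real.log (1 + w y) - (1 + w y) ^ 2 * Real.log (1 + v) := by
      rcases eq_or_ne (1 + w y) 0 with h | h
      · simp [h]
      · rw [Real.log_div (pow_ne_zero 2 h) (by linarith), Real.log_pow]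
        push_cast
        ring
    have h1 := two_mul_sq_mul_log_le (hw y hy)
    have h2 : w y ^ 2 ≤ (#A - 1) * v := by
      have := sq_le_card_sub_one_mul h0 hy
      rw [hsum] at this
      nlinarith
    have h3 : Real.log (44 + 5 * w y ^ 2) ≤ Real.log (44 + 5 * ((#A - 1) * v)) :=
      Real.log_le_log (by positivity) (by linarith)
    have h4 := mul_le_mul_of_nonneg_left h3 (sq_nonneg (w y))
    rw [e]
    nlinarith
  refine (sum_le_sum point).trans ?_
  rw [sum_sub_distrib, sum_add_distrib, ← mul_sum, ← sum_mul,
    ← sum_mul, sum_add_distrib, sum_add_distrib, ← mul_sum, h0, hsum]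
  simp only [sum_const, nsmul_eq_mul, mul_one, mul_zero, zero_add, add_zero]
  have h5 : Real.log (44 + 5 * ((#A - 1) * v)) ≤ Real.log L + Real.log (176 / 65 + v) := by
    rw [← Real.log_mul (by linarith) (by linarith)]
    apply Real.log_le_log hX
    nlinarith
  have h6 := mul_log_add_le_one_add_mul_log hv0
  have h7 := mul_le_mul_of_nonneg_left h5 hv0
  have h8 : v * Real.log (44 + 5 * ((#A - 1) * v)) - (1 + v) * Real.log (1 + v)
      ≤ v * Real.log L := by linarith
  have := mul_le_mul_of_nonneg_left h8 hk.le
  nlinarith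

/-- Entropy inequality for a single particle on the star whose center has weight `b ^ 2`. -/
theorem sum_mul_log_le_star {ι : Type*} {A : Finset ι} {u : ι → ℝ} {L : ℝ}
    (hA : A.Nonempty) (hu : ∀ y ∈ A, 0 ≤ u y) (b : ℝ)
    (hL : 65 / 4 ≤ L) (hL' : 5 * ((#A : ℝ) - 1) ≤ L) :
    ∑ y ∈ A, u y * Real.log (#A * u y / ∑ z ∈ A, u z)
      ≤ Real.log L * ∑ y ∈ A, (√(u y) - b) ^ 2 := by
  have hk : (0 : ℝ) < #A := by exact_mod_cast card_pos.2 hA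
  have hlogL : 0 ≤ Real.log L := Real.log_nonneg (by linarith)
  obtain ⟨M, hM0, hMsum⟩ : ∃ M, 0 ≤ M ∧ ∑ y ∈ A, √(u y) = #A * M :=
    ⟨(∑ y ∈ A, √(u y)) / #A,
      div_nonneg (sum_nonneg fun _ _ => Real.sqrt_nonneg _) hk.le, by field_simp⟩
  rcases hM0.eq_or_lt with hz | hpos
  · rw [← hz, mul_zero, sum_eq_zero_iff_of_nonneg fun _ _ => Real.sqrt_nonneg _] at hMsum
    have hu0 : ∀ y ∈ A, u y = 0 := fun y hy =>
      le_antisymm (Real.sqrt_eq_zero'.1 (hMsum y hy)) (hu y hy)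
    rw [sum_eq_zero fun y hy => by rw [hu0 y hy, zero_mul]]
    exact mul_nonneg hlogL (sum_nonneg fun _ _ => sq_nonneg _)
  obtain ⟨w, hw⟩ : ∃ w : ι → ℝ, ∀ y, √(u y) = M * (1 + w y) :=
    ⟨fun y => √(u y) / M - 1, fun y => by rw [add_sub_cancel, mul_div_cancel₀ _ hpos.ne']⟩
  have hwu : ∀ y ∈ A, u y = M ^ 2 * (1 + w y) ^ 2 := by
    intro y hy
    rw [← mul_pow, ← hw, Real.sq_sqrt (hu y hy)]
  have hw0 : ∑ y ∈ A, w y = 0 := by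
    rw [sum_congr rfl fun y _ => hw y, ← mul_sum, sum_add_distrib,
      sum_const, nsmul_eq_mul, mul_one, mul_comm] at hMsum
    linarith [mul_right_cancel₀ hpos.ne' hMsum]
  have hw1 : ∀ y ∈ A, -1 ≤ w y := fun y _ => by
    have := nonneg_of_mul_nonneg_right (hw y ▸ Real.sqrt_nonneg (u y)) hpos
    linarith
  have key := sum_one_add_sq_mul_log_le hA hw1 hw0 hL hL'
  set v := (∑ z ∈ A, w z ^ 2) / #A with hv
  have hsumw : ∑ z ∈ A, w z ^ 2 = #A * v := by rw [hv]; field_simp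
  have hv0 : 0 ≤ v := div_nonneg (sum_nonneg fun _ _ => sq_nonneg _) hk.le
  have hS : ∑ z ∈ A, u z = #A * (M ^ 2 * (1 + v)) := by
    have e : ∀ z, (1 + w z) ^ 2 = 1 + 2 * w z + w z ^ 2 := fun z => by ring
    rw [sum_congr rfl hwu, ← mul_sum, sum_congr rfl fun z _ => e z,
      sum_add_distrib, sum_add_distrib, ← mul_sum, hw0, hsumw]
    simp
    ring
  have hL1 : ∑ y ∈ A, u y * Real.log (#A * u y / ∑ z ∈ A, u z) =
      M ^ 2 * ∑ y ∈ A, (1 + w y) ^ 2 * Real.log ((1 + w y) ^ 2 / (1 + v)) := by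
    rw [hS, mul_sum]
    refine sum_congr rfl fun y hy => ?_
    rw [hwu y hy, mul_assoc]
    rw [mul_div_mul_left _ _ hk.ne', mul_div_mul_left _ _ (pow_pos hpos 2).ne']
  have hvar : M ^ 2 * ∑ y ∈ A, w y ^ 2 ≤ ∑ y ∈ A, (√(u y) - b) ^ 2 := by
    have e : ∀ y, (√(u y) - b) ^ 2 = M ^ 2 * w y ^ 2 + 2 * M * (M - b) * w y + (M - b) ^ 2 := by
      intro y
      rw [hw]
      ring
    rw [sum_congr rfl fun y _ => e y, sum_add_distrib, sum_add_distrib,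
      ← mul_sum, ← mul_sum, hw0]
    have : 0 ≤ ∑ _y ∈ A, (M - b) ^ 2 := sum_nonneg fun _ _ => sq_nonneg _
    linarith
  rw [hL1]
  calc M ^ 2 * ∑ y ∈ A, (1 + w y) ^ 2 * Real.log ((1 + w y) ^ 2 / (1 + v))
      ≤ M ^ 2 * (Real.log L * ∑ y ∈ A, w y ^ 2) := by gcongr
    _ = Real.log L * (M ^ 2 * ∑ y ∈ A, w y ^ 2) := by ring
    _ ≤ _ := by gcongr

namespace Stmt19

theorem ne_mul_swap {V : Type*} [DecidableEq V] {x y : V} (hxy : x ≠ y) (σ : Equiv.Perm V) :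
    σ ≠ σ * Equiv.swap x y := by
  intro h
  have := congrArg (fun τ : Equiv.Perm V => τ x) h
  simp at this
  exact hxy this

variable {V : Type*} [Fintype V] [DecidableEq V]

theorem mem_permFiber {A : Finset V} {σ τ : Equiv.Perm V} :
    τ ∈ permFiber A σ ↔ ∀ z ∉ A, τ z = σ z := by
  simp [permFiber]

theorem permFiber_univ (σ : Equiv.Perm V) : permFiber univ σ = univ := by
  ext τ
  simp [mem_permFiber]

theorem apply_mem_image_of_mem_permFiber {A : Finset V} {σ τ : Equiv.Perm V}
    (h : τ ∈ permFiber A σ) {y : V} (hy : y ∈ A) : τ y ∈ A.image σ := by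
  rw [mem_permFiber] at h
  refine mem_image.2 ⟨σ⁻¹ (τ y), ?_, by simp⟩
  by_contra hz
  have h1 : τ (σ⁻¹ (τ y)) = τ y := (h _ hz).trans (σ.apply_symm_apply _)
  exact hz (by rwa [τ.injective h1])

theorem inv_apply_mem_of_mem_permFiber {A : Finset V} {σ τ : Equiv.Perm V}
    (h : τ ∈ permFiber A σ) {l : V} (hl : l ∈ A.image σ) : τ⁻¹ l ∈ A := by
  rw [mem_permFiber] at h
  obtain ⟨y, hy, rfl⟩ := mem_image.1 hl
  by_contra hz
  have h1 : σ y = σ (τ⁻¹ (σ y)) := (τ.apply_symm_apply _).symm.trans (h _ hz)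
  exact hz (by rwa [← σ.injective h1])

theorem mul_swap_mem_permFiber {A : Finset V} {σ τ : Equiv.Perm V} {x y : V}
    (hx : x ∈ A) (hy : y ∈ A) (h : τ ∈ permFiber A σ) :
    τ * Equiv.swap x y ∈ permFiber A σ := by
  rw [mem_permFiber] at h ⊢
  intro z hz
  rw [Equiv.Perm.mul_apply, Equiv.swap_apply_of_ne_of_ne (by grind) (by grind)]
  exact h z hz

theorem permFiber_pair {x y : V} (σ : Equiv.Perm V) :
    permFiber {x, y} σ = {σ, σ * Equiv.swap x y} := by
  ext τ
  constructor
  · intro h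
    have hx := apply_mem_image_of_mem_permFiber h (y := x) (by simp)
    have hy := apply_mem_image_of_mem_permFiber h (y := y) (by simp)
    rw [mem_permFiber] at h
    simp only [image_insert, image_singleton, mem_insert, mem_singleton] at hx hy
    rw [mem_insert, mem_singleton]
    have inj := τ.injective.eq_iff (a := x) (b := y)
    rcases eq_or_ne x y with rfl | hxy
    · left
      ext z
      by_cases hz : z = x
      · subst hz; simpa using hx
      · exact h z (by simpa using hz)
    rcases hx with hx | hx
    · left
      have hy' : τ y = σ y := by grind
      ext z
      by_cases hzx : z = x
      · rw [hzx, hx]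
      by_cases hzy : z = y
      · rw [hzy, hy']
      exact h z (by simp [hzx, hzy])
    · right
      have hy' : τ y = σ x := by grind
      ext z
      rw [Equiv.Perm.mul_apply]
      by_cases hzx : z = x
      · rw [hzx, hx, Equiv.swap_apply_left]
      by_cases hzy : z = y
      · rw [hzy, hy', Equiv.swap_apply_right]
      rw [Equiv.swap_apply_of_ne_of_ne hzx hzy]
      exact h z (by simp [hzx, hzy])
  · intro h
    have hσ : σ ∈ permFiber {x, y} σ := mem_permFiber.2 fun _ _ => rfl
    rw [mem_insert, mem_singleton] at h
    rcases h with rfl | rfl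
    · exact hσ
    · exact mul_swap_mem_permFiber (by simp) (by simp) hσ

theorem EntA_pair {x y : V} (hxy : x ≠ y) (f : Equiv.Perm V → ℝ) (σ : Equiv.Perm V) :
    EntA {x, y} f σ = pairEnt (f σ) (f (σ * Equiv.swap x y)) := by
  have hne := ne_mul_swap hxy σ
  unfold EntA condExp pairEnt
  rw [permFiber_pair, sum_pair hne, sum_pair hne, card_pair hne]
  norm_num

theorem filter_permFiber {A : Finset V} {σ τ : Equiv.Perm V} {y : V}
    (h : τ ∈ permFiber A σ) :
    (permFiber A σ).filter (fun ρ => ρ y = τ y) = permFiber (A.erase y) τ := by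
  rw [mem_permFiber] at h
  ext ρ
  simp only [mem_filter, mem_permFiber, mem_erase, not_and]
  constructor
  · rintro ⟨h1, h2⟩ z hz
    by_cases hzy : z = y
    · rw [hzy, h2]
    · rw [h1 z (hz hzy), h z (hz hzy)]
  · intro h1
    refine ⟨fun z hz => ?_, h1 y fun hy => (hy rfl).elim⟩
    rw [h1 z fun _ => hz, h z hz]

/-- Total weight of the permutations in the block `permFiber A σ` that send `y` to `l`. -/
noncomputable def siteSum (A : Finset V) (σ : Equiv.Perm V) (f : Equiv.Perm V → ℝ) (y l : V) : ℝ :=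
  ∑ τ ∈ permFiber A σ with τ y = l, f τ

/-- Unnormalized entropy of `f` on `permFiber A σ`. -/
noncomputable def blockEnt (A : Finset V) (σ : Equiv.Perm V) (f : Equiv.Perm V → ℝ) : ℝ :=
  ∑ τ ∈ permFiber A σ, f τ * Real.log (f τ)
    - (∑ τ ∈ permFiber A σ, f τ) * Real.log ((∑ τ ∈ permFiber A σ, f τ) / (#A).factorial)

/-- Unnormalized star entropy production of `f` along the edge `{c, y}` on `permFiber A σ`. -/
noncomputable def edgeProd (c : V) (A : Finset V) (σ : Equiv.Perm V) (f : Equiv.Perm V → ℝ)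
    (y : V) : ℝ :=
  ∑ τ ∈ permFiber A σ, 2 * pairEnt (f τ) (f (τ * Equiv.swap c y))

/-- The star entropy inequality with constant `a` for all blocks with `k` sites. -/
def StarIneq (c : V) (f : Equiv.Perm V → ℝ) (k : ℕ) (a : ℝ) : Prop :=
  ∀ A : Finset V, c ∈ A → #A = k → ∀ σ : Equiv.Perm V,
    blockEnt A σ f ≤ a * ∑ y ∈ A.erase c, edgeProd c A σ f y

variable {c : V} {A : Finset V} {σ : Equiv.Perm V} {f : Equiv.Perm V → ℝ}

theorem sum_siteSum (y : V) : ∑ l, siteSum A σ f y l = ∑ τ ∈ permFiber A σ, f τ :=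
  sum_fiberwise _ _ _

theorem siteSum_nonneg (hf : ∀ σ, 0 ≤ f σ) (y l : V) : 0 ≤ siteSum A σ f y l :=
  sum_nonneg fun τ _ => hf τ

theorem siteSum_eq_zero {y l : V} (hy : y ∈ A) (hl : l ∉ A.image σ) :
    siteSum A σ f y l = 0 := by
  unfold siteSum
  rw [filter_false_of_mem, sum_empty]
  rintro τ hτ rfl
  exact hl (apply_mem_image_of_mem_permFiber hτ hy)

theorem sum_siteSum_image {y : V} (hy : y ∈ A) :
    ∑ l ∈ A.image σ, siteSum A σ f y l = ∑ τ ∈ permFiber A σ, f τ := by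
  rw [← sum_siteSum y]
  exact sum_subset (subset_univ _) fun l _ hl => siteSum_eq_zero hy hl

theorem sum_siteSum_sites {l : V} (hl : l ∈ A.image σ) :
    ∑ y ∈ A, siteSum A σ f y l = ∑ τ ∈ permFiber A σ, f τ := by
  rw [← sum_fiberwise_of_maps_to (s := permFiber A σ) (t := A) (g := fun τ => τ⁻¹ l)
    fun τ hτ => inv_apply_mem_of_mem_permFiber hτ hl]
  refine sum_congr rfl fun y _ => ?_
  unfold siteSum
  congr 1
  ext τ
  simp only [mem_filter, Equiv.Perm.inv_eq_iff_eq]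
  tauto

theorem edgeProd_nonneg (hf : ∀ σ, 0 ≤ f σ) (y : V) : 0 ≤ edgeProd c A σ f y := by
  refine sum_nonneg fun τ _ => mul_nonneg zero_le_two ?_
  refine le_trans ?_ (le_pairEnt (hf _) (hf _))
  have := Real.log_pos (one_lt_two (α := ℝ))
  positivity

theorem siteSum_mul_swap {y : V} (hc : c ∈ A) (hy : y ∈ A) (l : V) :
    ∑ τ ∈ permFiber A σ with τ y = l, f (τ * Equiv.swap c y) = siteSum A σ f c l := by
  unfold siteSum
  refine sum_bij (fun τ _ => τ * Equiv.swap c y) ?_ (fun _ _ _ _ h => mul_right_cancel h) ?_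
    fun _ _ => rfl
  · intro τ hτ
    rw [mem_filter] at hτ ⊢
    exact ⟨mul_swap_mem_permFiber hc hy hτ.1, by simpa using hτ.2⟩
  · intro τ hτ
    rw [mem_filter] at hτ
    refine ⟨τ * Equiv.swap c y, ?_, by simp [mul_assoc]⟩
    rw [mem_filter]
    exact ⟨mul_swap_mem_permFiber hc hy hτ.1, by simpa using hτ.2⟩

/-- The law of the label at `y` contracts the entropy production along `{c, y}`. -/
theorem log_two_mul_sum_le_edgeProd (hf : ∀ σ, 0 ≤ f σ) {y : V} (hc : c ∈ A) (hy : y ∈ A) :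
    Real.log 2 * ∑ l, (√(siteSum A σ f y l) - √(siteSum A σ f c l)) ^ 2
      ≤ edgeProd c A σ f y := by
  unfold edgeProd
  rw [← sum_fiberwise (permFiber A σ) (fun τ => τ y), mul_sum]
  refine sum_le_sum fun l _ => ?_
  have h1 : ∀ τ : Equiv.Perm V, Real.log 2 * (f τ + f (τ * Equiv.swap c y)
      - 2 * (√(f τ) * √(f (τ * Equiv.swap c y)))) ≤
        2 * pairEnt (f τ) (f (τ * Equiv.swap c y)) := by
    intro τ
    have := le_pairEnt (hf τ) (hf (τ * Equiv.swap c y))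
    rw [sub_sq, Real.sq_sqrt (hf _), Real.sq_sqrt (hf _)] at this
    linarith
  refine le_trans ?_ (sum_le_sum fun τ _ => h1 τ)
  rw [← mul_sum, sum_sub_distrib, sum_add_distrib, ← mul_sum, siteSum_mul_swap hc hy]
  refine mul_le_mul_of_nonneg_left ?_ (Real.log_pos one_lt_two).le
  have h2 := Real.sum_sqrt_mul_sqrt_le ((permFiber A σ).filter fun τ => τ y = l)
    (f := f) (g := fun τ => f (τ * Equiv.swap c y)) hf (fun τ => hf _)
  rw [siteSum_mul_swap hc hy] at h2
  rw [sub_sq, Real.sq_sqrt (siteSum_nonneg hf _ _), Real.sq_sqrt (siteSum_nonneg hf _ _)]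
  change _ ≤ √(siteSum A σ f y l) * _ at h2
  change _ ≤ siteSum A σ f y l + _ - _
  linarith

theorem sum_siteSum_mul_log_le (hf : ∀ σ, 0 ≤ f σ) (hc : c ∈ A) {L : ℝ}
    (hL : 65 / 4 ≤ L) (hL' : 5 * ((#A : ℝ) - 1) ≤ L) :
    ∑ y ∈ A.erase c, ∑ l ∈ A.image σ, siteSum A σ f y l *
        Real.log (#A * siteSum A σ f y l / ∑ τ ∈ permFiber A σ, f τ)
      ≤ Real.log L / Real.log 2 * ∑ y ∈ A.erase c, edgeProd c A σ f y := by
  set S := ∑ τ ∈ permFiber A σ, f τ with hS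
  have hA : A.Nonempty := ⟨c, hc⟩
  have hk : (0 : ℝ) < #A := by exact_mod_cast card_pos.2 hA
  have hS0 : 0 ≤ S := sum_nonneg fun τ _ => hf τ
  have hlog2 := Real.log_pos (one_lt_two (α := ℝ))
  have hlogL : 0 ≤ Real.log L := Real.log_nonneg (by linarith)
  have center : 0 ≤ ∑ l ∈ A.image σ, siteSum A σ f c l *
      Real.log (#A * siteSum A σ f c l / S) := by
    have h : ∀ l ∈ A.image σ, siteSum A σ f c l - S / #A ≤
        siteSum A σ f c l * Real.log (#A * siteSum A σ f c l / S) := by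
      intro l _
      rcases (siteSum_nonneg hf c l).eq_or_lt with h0 | h0
      · rw [← h0]
        have := div_nonneg hS0 hk.le
        simpa using this
      · rcases hS0.eq_or_lt with hz | hz
        · have hle : siteSum A σ f c l ≤ S := by
            rw [hS, ← sum_siteSum c]
            exact single_le_sum (f := fun l => siteSum A σ f c l)
              (fun l _ => siteSum_nonneg hf c l) (mem_univ l)
          linarith
        · have := Real.one_sub_inv_le_log_of_pos (div_pos (mul_pos hk h0) hz)
          have h2 := mul_le_mul_of_nonneg_left this h0.le
          refine le_trans (le_of_eq ?_) h2
          field_simp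
    refine le_trans (le_of_eq ?_) (sum_le_sum h)
    rw [sum_sub_distrib, sum_siteSum_image hc, sum_const, card_image_of_injective _ σ.injective,
      nsmul_eq_mul, ← hS]
    field_simp
    ring
  have single : ∀ l ∈ A.image σ, ∑ y ∈ A, siteSum A σ f y l *
      Real.log (#A * siteSum A σ f y l / S) ≤
        Real.log L * ∑ y ∈ A, (√(siteSum A σ f y l) - √(siteSum A σ f c l)) ^ 2 := by
    intro l hl
    have := sum_mul_log_le_star (u := fun y => siteSum A σ f y l) hA
      (fun y _ => siteSum_nonneg hf y l) (√(siteSum A σ f c l)) hL hL'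
    rwa [sum_siteSum_sites hl] at this
  have h1 := sum_le_sum single
  rw [sum_comm, ← add_sum_erase A _ hc, ← mul_sum, sum_comm (s := A.image σ),
    ← add_sum_erase A (fun y => ∑ l ∈ A.image σ, (√(siteSum A σ f y l) - _) ^ 2) hc] at h1
  simp only [sub_self, ne_eq, OfNat.ofNat_ne_zero, not_false_eq_true, zero_pow, sum_const_zero,
    zero_add] at h1
  have h2 : Real.log 2 * ∑ y ∈ A.erase c, ∑ l ∈ A.image σ,
      (√(siteSum A σ f y l) - √(siteSum A σ f c l)) ^ 2 ≤
        ∑ y ∈ A.erase c, edgeProd c A σ f y := by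
    rw [mul_sum]
    refine sum_le_sum fun y hy => ?_
    refine le_trans ?_ (log_two_mul_sum_le_edgeProd hf hc (mem_of_mem_erase hy))
    exact mul_le_mul_of_nonneg_left (sum_le_sum_of_subset_of_nonneg (subset_univ _)
      fun _ _ _ => sq_nonneg _) hlog2.le
  rw [div_mul_eq_mul_div, le_div_iff₀ hlog2]
  have h3 := mul_le_mul_of_nonneg_left h2 hlogL
  nlinarith

/-- The star inequality applied after conditioning on the label at `y`. -/
theorem StarIneq.sum_filter_le {k : ℕ} {a : ℝ} (h : StarIneq c f k a) (hc : c ∈ A)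
    (hA : #A = k + 1) {y : V} (hy : y ∈ A.erase c) :
    ∑ τ ∈ permFiber A σ, f τ * Real.log (f τ)
      - ∑ l, siteSum A σ f y l * Real.log (siteSum A σ f y l / k.factorial)
      ≤ a * ∑ z ∈ (A.erase c).erase y, edgeProd c A σ f z := by
  have e : ∀ z, edgeProd c A σ f z = ∑ l, ∑ τ ∈ permFiber A σ with τ y = l,
      2 * pairEnt (f τ) (f (τ * Equiv.swap c z)) := fun z => (sum_fiberwise _ _ _).symm
  rw [sum_congr rfl fun z _ => e z, sum_comm, mul_sum,
    ← sum_fiberwise (permFiber A σ) (fun τ => τ y), ← sum_sub_distrib]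
  refine sum_le_sum fun l _ => ?_
  rcases ((permFiber A σ).filter fun τ => τ y = l).eq_empty_or_nonempty with h0 | ⟨τ, hτ⟩
  · simp [siteSum, h0]
  · obtain rfl := (mem_filter.1 hτ).2
    unfold siteSum
    rw [filter_permFiber (mem_filter.1 hτ).1, erase_right_comm]
    have hcard : #(A.erase y) = k := by
      rw [card_erase_of_mem (mem_of_mem_erase hy), hA, Nat.add_sub_cancel]
    have := h (A.erase y) (mem_erase.2 ⟨(ne_of_mem_erase hy).symm, hc⟩) hcard τ
    unfold blockEnt edgeProd at this
    rwa [hcard] at this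

theorem sum_sum_erase {ι : Type*} [DecidableEq ι] (B : Finset ι) (g : ι → ℝ) :
    ∑ y ∈ B, ∑ z ∈ B.erase y, g z = (#B - 1) * ∑ z ∈ B, g z := by
  rw [sum_congr rfl fun y hy => eq_sub_of_add_eq' (add_sum_erase B g hy), sum_sub_distrib,
    sum_const, nsmul_eq_mul]
  ring

/-- Averaging over the revealed site turns a bound for `k` sites into one for `k + 1` sites. -/
theorem StarIneq.succ (hf : ∀ σ, 0 ≤ f σ) {k : ℕ} (hk : 1 ≤ k) {a L : ℝ}
    (h : StarIneq c f k a) (hL : 65 / 4 ≤ L) (hL' : 5 * (k : ℝ) ≤ L) :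
    StarIneq c f (k + 1) (((k - 1) * a + Real.log L / Real.log 2) / k) := by
  intro A hc hA σ
  set S := ∑ τ ∈ permFiber A σ, f τ with hS
  set D := ∑ y ∈ A.erase c, edgeProd c A σ f y with hD
  have hk0 : (0 : ℝ) < k := by exact_mod_cast hk
  have hB : #(A.erase c) = k := by rw [card_erase_of_mem hc, hA, Nat.add_sub_cancel]
  have h1 : ∑ y ∈ A.erase c, (∑ τ ∈ permFiber A σ, f τ * Real.log (f τ)
      - ∑ l, siteSum A σ f y l * Real.log (siteSum A σ f y l / k.factorial))
      ≤ (k - 1) * (a * D) := by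
    refine (sum_le_sum fun y hy => h.sum_filter_le hc hA hy).trans (le_of_eq ?_)
    rw [← mul_sum, sum_sum_erase, hB]
    ring
  have h2 := sum_siteSum_mul_log_le (σ := σ) hf hc hL
    (by rw [hA]; push_cast; simpa using hL')
  have h3 : ∀ y ∈ A.erase c,
      ∑ l, siteSum A σ f y l * Real.log (siteSum A σ f y l / k.factorial) =
        S * Real.log (S / (k + 1).factorial) + ∑ l ∈ A.image σ, siteSum A σ f y l *
          Real.log (#A * siteSum A σ f y l / S) := by
    intro y hy
    have hy' := mem_of_mem_erase hy
    rw [hS, ← sum_siteSum_image hy', sum_mul, ← sum_add_distrib, sum_siteSum_image hy', ← hS]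
    rw [← sum_subset (subset_univ (A.image σ)) fun l _ hl => by
      rw [siteSum_eq_zero hy' hl, zero_mul]]
    refine sum_congr rfl fun l _ => ?_
    rw [← mul_add]
    rcases (siteSum_nonneg (A := A) (σ := σ) hf y l).eq_or_lt with h0 | h0
    · rw [← h0]; simp
    · have hSpos : 0 < S := by
        refine h0.trans_le ?_
        rw [hS, ← sum_siteSum y]
        exact single_le_sum (f := fun l => siteSum A σ f y l)
          (fun l _ => siteSum_nonneg hf y l) (mem_univ l)
      have hf1 : (0 : ℝ) < k.factorial := by exact_mod_cast k.factorial_pos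
      have hA0 : (0 : ℝ) < #A := by rw [hA]; positivity
      rw [← Real.log_mul (by positivity) (by positivity), Nat.factorial_succ, hA]
      congr 2
      push_cast
      field_simp
  rw [sum_sub_distrib, sum_congr rfl h3, sum_add_distrib, sum_const, sum_const, hB, nsmul_eq_mul,
    nsmul_eq_mul] at h1
  unfold blockEnt
  rw [hA, ← hS, ← hD] at *
  rw [div_mul_eq_mul_div, le_div_iff₀ hk0]
  nlinarith

theorem StarIneq.mono (hf : ∀ σ, 0 ≤ f σ) {k : ℕ} {a b : ℝ} (h : StarIneq c f k a)
    (hab : a ≤ b) : StarIneq c f k b := fun A hc hA σ =>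
  (h A hc hA σ).trans <| mul_le_mul_of_nonneg_right hab <|
    sum_nonneg fun y _ => edgeProd_nonneg hf y

theorem starIneq_two (hf : ∀ σ, 0 ≤ f σ) : StarIneq c f 2 (1 / 2) := by
  intro A hc hA σ
  obtain ⟨y, hy⟩ := card_eq_one.1 (show #(A.erase c) = 1 by rw [card_erase_of_mem hc, hA])
  have hyA : y ∈ A.erase c := by rw [hy]; exact mem_singleton_self y
  have hcy : c ≠ y := (ne_of_mem_erase hyA).symm
  have hAeq : A = {c, y} := by rw [← insert_erase hc, hy]
  subst hAeq
  have hne := ne_mul_swap hcy σ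
  unfold blockEnt edgeProd
  rw [hy, sum_singleton, permFiber_pair, sum_pair hne, sum_pair hne, sum_pair hne, hA, mul_assoc σ,
    Equiv.swap_mul_self, mul_one, pairEnt_comm (f (σ * _))]
  set a := f σ with ha
  set b := f (σ * Equiv.swap c y) with hb
  have ha0 : 0 ≤ a := hf _
  have hb0 : 0 ≤ b := hf _
  have expand : ∀ x, 0 ≤ x → x ≤ a + b →
      x * Real.log (x / ((a + b) / 2)) = x * Real.log x - x * Real.log ((a + b) / 2) := by
    intro x hx hxs
    rcases hx.eq_or_lt with rfl | hx
    · simp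
    · rw [Real.log_div hx.ne' (by linarith)]
      ring
  unfold pairEnt
  rw [expand a ha0 (by linarith), expand b hb0 (by linarith)]
  norm_num
  linarith

theorem mul_log_le_mul_log {a b : ℝ} {m k : ℕ} (h : a ^ m ≤ b ^ k) (ha : 0 < a) :
    m * Real.log a ≤ k * Real.log b := by
  simpa using Real.log_le_log (pow_pos ha m) h

theorem starIneq_log (hf : ∀ σ, 0 ≤ f σ) {n : ℕ} (hn : 2 ≤ n) :
    StarIneq c f n (Real.log n / Real.log 2 ^ 2) := by
  have g1 := Real.log_two_gt_d9
  have g2 := Real.log_two_lt_d9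
  have hsq : 0 < Real.log 2 ^ 2 := by positivity
  have hlog3 : 19 / 12 * Real.log 2 ≤ Real.log 3 := by
    have := mul_log_le_mul_log (show (2 : ℝ) ^ 19 ≤ 3 ^ 12 by norm_num) (by norm_num)
    push_cast at this
    linarith
  have hlog3' : Real.log 3 ≤ 8 / 5 * Real.log 2 := by
    have := mul_log_le_mul_log (show (3 : ℝ) ^ 5 ≤ 2 ^ 8 by norm_num) (by norm_num)
    push_cast at this
    linarith
  have hlog5 : 16 / 7 * Real.log 2 ≤ Real.log 5 := by
    have := mul_log_le_mul_log (show (2 : ℝ) ^ 16 ≤ 5 ^ 7 by norm_num) (by norm_num)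
    push_cast at this
    linarith
  have hlog5' : Real.log 5 ≤ 7 / 3 * Real.log 2 := by
    have := mul_log_le_mul_log (show (5 : ℝ) ^ 3 ≤ 2 ^ 7 by norm_num) (by norm_num)
    push_cast at this
    linarith
  have hlogL : Real.log (65 / 4) ≤ 4 * Real.log 2 + 1 / 64 := by
    have h := Real.log_le_sub_one_of_pos (show (0 : ℝ) < 65 / 64 by norm_num)
    have e : (65 / 4 : ℝ) = 2 ^ 4 * (65 / 64) := by norm_num
    rw [e, Real.log_mul (by norm_num) (by norm_num), Real.log_pow]
    push_cast
    linarith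
  have hlog4 : Real.log 4 = 2 * Real.log 2 := by
    rw [show (4 : ℝ) = 2 ^ 2 by norm_num, Real.log_pow]
    norm_num
  induction n, hn using Nat.le_induction with
  | base =>
    refine (starIneq_two hf).mono hf ?_
    rw [le_div_iff₀ hsq]
    push_cast
    nlinarith
  | succ k hk ih =>
    rcases (show k = 2 ∨ k = 3 ∨ 4 ≤ k by omega) with rfl | rfl | hk4
    · refine ((starIneq_two hf).succ hf one_le_two le_rfl (by norm_num)).mono hf ?_
      have : Real.log (65 / 4) * Real.log 2 + Real.log 2 ^ 2 / 2 ≤ 2 * Real.log 3 := by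
        nlinarith
      push_cast
      norm_num
      rw [le_div_iff₀ hsq]
      field_simp
      nlinarith
    · refine (ih.succ hf (by norm_num) le_rfl (by norm_num)).mono hf ?_
      have : Real.log (65 / 4) * Real.log 2 + 2 * Real.log 3 ≤ 6 * Real.log 2 := by
        nlinarith
      push_cast
      norm_num
      rw [hlog4, le_div_iff₀ hsq]
      field_simp
      nlinarith
    · have hk' : (4 : ℝ) ≤ k := by exact_mod_cast hk4
      refine (ih.succ hf (by omega) (L := 5 * k) (by linarith) le_rfl).mono hf ?_
      have hk0 : (0 : ℝ) < k := by linarith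
      have hdiff : Real.log k ≤ Real.log (k + 1) - 1 / (k + 1) := by
        have := Real.log_le_sub_one_of_pos (show (0 : ℝ) < k / (k + 1) by positivity)
        rw [Real.log_div hk0.ne' (by positivity)] at this
        have e : (k : ℝ) / (k + 1) - 1 = -(1 / (k + 1)) := by field_simp; ring
        linarith
      have hx : 1 / ((k : ℝ) + 1) ≤ 1 / 5 := by
        apply one_div_le_one_div_of_le <;> linarith
      have hmono : Real.log 5 ≤ Real.log (k + 1) := Real.log_le_log (by norm_num) (by linarith)
      have hx1 : ((k : ℝ) + 1) * (1 / (k + 1)) = 1 := by field_simp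
      rw [Real.log_mul (by norm_num) hk0.ne']
      push_cast
      set x := 1 / ((k : ℝ) + 1)
      set l := Real.log ((k : ℝ) + 1)
      have main : (k - 1) * Real.log k + (Real.log 5 + Real.log k) * Real.log 2 ≤ k * l := by
        have h1 : (k - 1 + Real.log 2) * Real.log k ≤ (k - 1 + Real.log 2) * (l - x) :=
          mul_le_mul_of_nonneg_left hdiff (by linarith)
        have h2 : Real.log 5 * Real.log 2 ≤ 7 / 3 * Real.log 2 * Real.log 2 := by gcongr
        have h3 : (1 - Real.log 2) * (16 / 7 * Real.log 2) ≤ (1 - Real.log 2) * l :=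
          mul_le_mul_of_nonneg_left (hlog5.trans hmono) (by linarith)
        have h4 : (2 - Real.log 2) * x ≤ (2 - Real.log 2) * (1 / 5) :=
          mul_le_mul_of_nonneg_left hx (by linarith)
        nlinarith
      rw [div_le_div_iff₀ hk0 hsq]
      have hl2 : Real.log 2 ≠ 0 := by positivity
      field_simp
      nlinarith

/-- The star entropy production as a sum over the leaves. -/
theorem sum_star_mean_EntA (f : Equiv.Perm V → ℝ) :
    ∑ A : Finset V, (if c ∈ A ∧ #A = 2 then (2 : ℝ) else 0) * mean (EntA A f) =
      (∑ y ∈ univ.erase c, edgeProd c univ 1 f y) / Fintype.card (Equiv.Perm V) := by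
  have himage : (univ : Finset (Finset V)).filter (fun A => c ∈ A ∧ #A = 2) =
      (univ.erase c).image fun y => {c, y} := by
    ext A
    simp only [mem_filter, mem_univ, true_and, mem_image, mem_erase, and_true]
    constructor
    · rintro ⟨hc, hA⟩
      obtain ⟨y, hy⟩ := card_eq_one.1 (show #(A.erase c) = 1 by rw [card_erase_of_mem hc, hA])
      refine ⟨y, ne_of_mem_erase (by rw [hy]; exact mem_singleton_self y), ?_⟩
      rw [← hy, insert_erase hc]
    · rintro ⟨y, hy, rfl⟩
      exact ⟨mem_insert_self _ _, card_pair hy.symm⟩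
  have hinj : Set.InjOn (fun y : V => ({c, y} : Finset V)) (univ.erase c : Finset V) := by
    intro y hy z hz h
    have h1 : y ∈ ({c, z} : Finset V) := by
      rw [← show ({c, y} : Finset V) = {c, z} from h]
      simp
    have h2 : y ≠ c := by simpa using hy
    simpa [h2] using h1
  simp only [ite_mul, zero_mul]
  rw [← sum_filter, himage, sum_image hinj, sum_div]
  refine sum_congr rfl fun y hy => ?_
  unfold mean edgeProd
  rw [permFiber_univ, ← mul_sum, mul_div_assoc,
    sum_congr rfl fun σ _ => EntA_pair (ne_of_mem_erase hy).symm f σ]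

theorem Ent_eq_blockEnt (hf : ∀ σ, 0 ≤ f σ) :
    Ent f = blockEnt univ 1 f / Fintype.card (Equiv.Perm V) := by
  unfold Ent blockEnt
  rw [permFiber_univ, card_univ, ← Fintype.card_perm]
  change _ = (_ - _ * Real.log (mean f)) / _
  rw [mean, sum_mul, ← sum_sub_distrib]
  congr 1
  refine sum_congr rfl fun σ _ => ?_
  rcases (hf σ).eq_or_lt with h | h
  · rw [← h]; simp
  · have : 0 < mean f := div_pos (sum_pos' (fun τ _ => hf τ) ⟨σ, mem_univ _, h⟩)
      (by exact_mod_cast Fintype.card_pos)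
    rw [Real.log_div h.ne' this.ne', mul_sub]

theorem card_mul_card_apply_eq (y l : V) :
    Fintype.card V * ∑ σ : Equiv.Perm V, (if σ y = l then (1 : ℝ) else 0) =
      Fintype.card (Equiv.Perm V) := by
  have h1 := sum_siteSum_sites (A := univ) (σ := 1) (f := fun _ => (1 : ℝ)) (l := l) (by simp)
  have h2 : ∀ z, siteSum univ 1 (fun _ => (1 : ℝ)) z l = siteSum univ 1 (fun _ => (1 : ℝ)) y l :=
    fun z => siteSum_mul_swap (c := y) (f := fun _ => (1 : ℝ)) (mem_univ y) (mem_univ z) l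
  rw [sum_congr rfl fun z _ => h2 z, sum_const, card_univ, nsmul_eq_mul, permFiber_univ] at h1
  unfold siteSum at h1
  rw [permFiber_univ, sum_filter] at h1
  rw [h1]
  simp

theorem Ent_indicator (y l : V) :
    Ent (fun σ : Equiv.Perm V => if σ y = l then (1 : ℝ) else 0) =
      Real.log (Fintype.card V) / Fintype.card V := by
  have hn : (0 : ℝ) < Fintype.card V := by exact_mod_cast Fintype.card_pos_iff.2 ⟨y⟩
  have hN : (0 : ℝ) < Fintype.card (Equiv.Perm V) := by exact_mod_cast Fintype.card_pos
  have hmean : mean (fun σ : Equiv.Perm V => if σ y = l then (1 : ℝ) else 0) =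
      1 / Fintype.card V := by
    unfold mean
    rw [div_eq_div_iff hN.ne' hn.ne', mul_comm, card_mul_card_apply_eq, one_mul]
  have h : ∀ σ : Equiv.Perm V, (if σ y = l then (1 : ℝ) else 0) *
      Real.log ((if σ y = l then (1 : ℝ) else 0) / (1 / Fintype.card V)) =
        (if σ y = l then (1 : ℝ) else 0) * Real.log (Fintype.card V) := fun σ => by
    split_ifs <;> simp
  unfold Ent
  rw [hmean]
  unfold mean at hmean ⊢
  rw [sum_congr rfl fun σ _ => h σ, ← sum_mul, mul_div_right_comm, hmean]
  ring

theorem sum_edgeProd_indicator_le {y : V} (hy : y ≠ c) (l : V) :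
    ∑ z ∈ univ.erase c, edgeProd c univ 1
        (fun σ : Equiv.Perm V => if σ y = l then (1 : ℝ) else 0) z
      ≤ 2 * Real.log 2 * (Fintype.card (Equiv.Perm V) / Fintype.card V) := by
  have hn : (0 : ℝ) < Fintype.card V := by exact_mod_cast Fintype.card_pos_iff.2 ⟨y⟩
  have hcount : ∀ z, ∑ σ : Equiv.Perm V, (if σ z = l then (1 : ℝ) else 0) =
      Fintype.card (Equiv.Perm V) / Fintype.card V := fun z => by
    rw [eq_div_iff hn.ne', mul_comm, card_mul_card_apply_eq]
  rw [sum_eq_single_of_mem y (mem_erase.2 ⟨hy, mem_univ y⟩)]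
  · unfold edgeProd
    have h : ∀ τ : Equiv.Perm V, 2 * pairEnt (if τ y = l then 1 else 0)
        (if (τ * Equiv.swap c y) y = l then 1 else 0) ≤
          Real.log 2 * (if τ y = l then 1 else 0) + Real.log 2 * (if τ c = l then 1 else 0) := by
      intro τ
      rw [Equiv.Perm.mul_apply, Equiv.swap_apply_right]
      have hne : ¬(τ y = l ∧ τ c = l) := fun h => hy (τ.injective (h.1.trans h.2.symm))
      unfold pairEnt
      split_ifs <;> first | tauto | (norm_num <;> linarith)
    rw [permFiber_univ]
    refine (sum_le_sum fun τ _ => h τ).trans (le_of_eq ?_)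
    rw [sum_add_distrib, ← mul_sum, ← mul_sum, hcount, hcount]
    ring
  · intro z hz hzy
    refine sum_eq_zero fun τ _ => ?_
    beta_reduce
    rw [Equiv.Perm.mul_apply, Equiv.swap_apply_of_ne_of_ne hy hzy.symm]
    unfold pairEnt
    split_ifs <;> norm_num

end Stmt19

open Stmt19 in
theorem stmt19 {V : Type*} [Fintype V] [DecidableEq V]
    (n : ℕ) (hn : 2 ≤ n) (hcard : Fintype.card V = n)
    (xstar : V) (α : Finset V → ℝ)
    (hα : ∀ A : Finset V, α A = if xstar ∈ A ∧ A.card = 2 then 2 else 0) :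
    (Real.log 2) ^ 2 / Real.log n ≤ kappaPerm α
    ∧ kappaPerm α ≤ 2 * Real.log 2 / Real.log n := by
  have hn' : (2 : ℝ) ≤ n := by exact_mod_cast hn
  have hlog2 := Real.log_pos (one_lt_two (α := ℝ))
  have hlogn : 0 < Real.log n := Real.log_pos (by linarith)
  have hN : (0 : ℝ) < Fintype.card (Equiv.Perm V) := by exact_mod_cast Fintype.card_pos
  have lower : (Real.log 2) ^ 2 / Real.log n ∈ {κ : ℝ | 0 ≤ κ ∧ ∀ f : Equiv.Perm V → ℝ,
      (∀ σ, 0 ≤ f σ) → κ * Ent f ≤ ∑ A : Finset V, α A * mean (EntA A f)} := by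
    refine ⟨by positivity, fun f hf => ?_⟩
    have h := starIneq_log (c := xstar) hf hn univ (mem_univ _) (by rw [card_univ, hcard]) 1
    simp only [hα]
    rw [sum_star_mean_EntA, Ent_eq_blockEnt hf, ← mul_div_assoc]
    refine div_le_div_of_nonneg_right ?_ hN.le
    refine (mul_le_mul_of_nonneg_left h (by positivity)).trans (le_of_eq ?_)
    field_simp
  have upper : ∀ κ ∈ {κ : ℝ | 0 ≤ κ ∧ ∀ f : Equiv.Perm V → ℝ,
      (∀ σ, 0 ≤ f σ) → κ * Ent f ≤ ∑ A : Finset V, α A * mean (EntA A f)},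
      κ ≤ 2 * Real.log 2 / Real.log n := by
    rintro κ ⟨_, hκ⟩
    have : Nontrivial V := Fintype.one_lt_card_iff_nontrivial.1 (by omega)
    obtain ⟨y, hy⟩ := exists_ne xstar
    have h := hκ (fun σ => if σ y = y then 1 else 0) fun σ => by split_ifs <;> norm_num
    simp only [hα] at h
    rw [sum_star_mean_EntA, Ent_indicator, hcard, le_div_iff₀ hN] at h
    have h2 := h.trans (sum_edgeProd_indicator_le hy y)
    rw [hcard] at h2
    rw [le_div_iff₀ hlogn]
    have hpos : (0 : ℝ) < Fintype.card (Equiv.Perm V) / n := by positivity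
    refine le_of_mul_le_mul_right (le_trans (le_of_eq ?_) h2) hpos
    ring
  exact ⟨le_csSup ⟨_, upper⟩ lower, csSup_le ⟨_, lower⟩ upper⟩
end
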